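/- Let $c_1, c_2, c_3, c_4, c_5$ be natural numbers (positive integers). Then there are infinitely many natural numbers $n$ such that $\sum_{i=1}^{5} 2^{\omega(c_i n + 1)} \leq 57$. -/

import Mathlib

/-!
# Five linear forms with few prime factors on average

A Selberg sieve of dimension five is applied to the forms `c i * n + 1`, with smooth weights on the
primes dividing one of the forms. The divisor function of each form is summed against the squared
weights; its level of distribution in arithmetic progressions comes from a fourth moment bound for
Kloosterman sums. The comparison of the resulting quadratic forms shows that the sum of
`2 ^ ω(c i * n + 1)` is less than `58` infinitely often.
-/

namespace TwoPowOmega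

open Finset

/-- The Kloosterman sum modulo `Q`. -/
noncomputable def kloosterman (Q : ℕ) [NeZero Q] (h k : ZMod Q) : ℂ :=
  ∑ u : (ZMod Q)ˣ, ZMod.stdAddChar (h * (u : ZMod Q) + k * ((u⁻¹ : (ZMod Q)ˣ) : ZMod Q))

lemma sum_norm_sq_addChar {Q : ℕ} [NeZero Q] {ι : Type*} [Fintype ι] [DecidableEq ι]
    (f g : ι → ZMod Q) :
    ∑ h : ZMod Q, ∑ k : ZMod Q, ‖∑ i, (ZMod.stdAddChar (h * f i + k * g i) : ℂ)‖ ^ 2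
      = (Q : ℝ) ^ 2 * #{x : ι × ι | f x.1 = f x.2 ∧ g x.1 = g x.2} := by
  have key : ∀ h k : ZMod Q,
      ((‖∑ i, (ZMod.stdAddChar (h * f i + k * g i) : ℂ)‖ ^ 2 : ℝ) : ℂ)
        = ∑ x : ι × ι, ZMod.stdAddChar (h * (f x.1 - f x.2)) *
            ZMod.stdAddChar (k * (g x.1 - g x.2)) := by
    intro h k
    push_cast
    rw [← Complex.mul_conj', map_sum, Finset.sum_mul_sum, Fintype.sum_prod_type]
    refine Finset.sum_congr rfl fun i _ => Finset.sum_congr rfl fun j _ => ?_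
    rw [← AddChar.map_neg_eq_conj, ← AddChar.map_add_eq_mul, ← AddChar.map_add_eq_mul]
    congr 1
    ring
  have : ((∑ h : ZMod Q, ∑ k : ZMod Q,
      ‖∑ i, (ZMod.stdAddChar (h * f i + k * g i) : ℂ)‖ ^ 2 : ℝ) : ℂ)
      = (((Q : ℝ) ^ 2 * #{x : ι × ι | f x.1 = f x.2 ∧ g x.1 = g x.2} : ℝ) : ℂ) := by
    simp only [Complex.ofReal_sum]
    simp only [key]
    calc _ = ∑ x : ι × ι, (∑ h : ZMod Q, (ZMod.stdAddChar (h * (f x.1 - f x.2)) : ℂ)) *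
            ∑ k : ZMod Q, (ZMod.stdAddChar (k * (g x.1 - g x.2)) : ℂ) := by
          simp only [Finset.sum_mul_sum]
          rw [Finset.sum_comm]
          simp only [Finset.sum_comm (s := (univ : Finset (ZMod Q))) (t := (univ : Finset (ι × ι)))]
          rw [Finset.sum_comm]
          simp only [Finset.sum_comm (s := (univ : Finset (ZMod Q))) (t := (univ : Finset (ι × ι)))]
          refine Finset.sum_congr rfl fun x _ => ?_
          rw [Finset.sum_comm]
      _ = _ := by
          simp only [AddChar.sum_mulShift _ (ZMod.isPrimitive_stdAddChar Q), ZMod.card, sub_eq_zero]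
          rw [Finset.card_filter]
          push_cast
          rw [Finset.mul_sum]
          refine Finset.sum_congr rfl fun x _ => ?_
          by_cases h1 : f x.1 = f x.2 <;> by_cases h2 : g x.1 = g x.2 <;> simp [h1, h2, sq]
  exact_mod_cast this

/-- Unit solutions of `x₁ + x₂ = x₃ + x₄`, `x₁⁻¹ + x₂⁻¹ = x₃⁻¹ + x₄⁻¹`. -/
def momentSet (R : Type*) [CommRing R] [Fintype Rˣ] [DecidableEq R] :
    Finset ((Rˣ × Rˣ) × (Rˣ × Rˣ)) :=
  {x | (x.1.1 : R) + x.1.2 = x.2.1 + x.2.2 ∧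
    ((x.1.1⁻¹ : Rˣ) : R) + (x.1.2⁻¹ : Rˣ) = (x.2.1⁻¹ : Rˣ) + (x.2.2⁻¹ : Rˣ)}

lemma sum_norm_kloosterman_pow_four (Q : ℕ) [NeZero Q] :
    ∑ h : ZMod Q, ∑ k : ZMod Q, ‖kloosterman Q h k‖ ^ 4
      = (Q : ℝ) ^ 2 * #(momentSet (ZMod Q)) := by
  have := sum_norm_sq_addChar (Q := Q) (ι := (ZMod Q)ˣ × (ZMod Q)ˣ)
    (fun u => (u.1 : ZMod Q) + u.2)
    (fun u => ((u.1⁻¹ : (ZMod Q)ˣ) : ZMod Q) + (u.2⁻¹ : (ZMod Q)ˣ))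
  rw [momentSet]
  rw [← this]
  refine Finset.sum_congr rfl fun h _ => Finset.sum_congr rfl fun k _ => ?_
  rw [show ‖kloosterman Q h k‖ ^ 4 = (‖(kloosterman Q h k) * kloosterman Q h k‖) ^ 2 by
    rw [norm_mul]; ring]
  congr 2
  rw [kloosterman, Finset.sum_mul_sum, Fintype.sum_prod_type]
  refine Finset.sum_congr rfl fun i _ => Finset.sum_congr rfl fun j _ => ?_
  rw [← AddChar.map_add_eq_mul]
  congr 1
  ring

lemma kloosterman_unit_mul {Q : ℕ} [NeZero Q] (h k : ZMod Q) (v : (ZMod Q)ˣ) :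
    kloosterman Q (h * v) (k * (v⁻¹ : (ZMod Q)ˣ)) = kloosterman Q h k := by
  rw [kloosterman, kloosterman]
  refine Fintype.sum_equiv (Equiv.mulLeft v) _ _ fun u => ?_
  simp [mul_assoc, mul_comm, mul_left_comm]

lemma card_mul_eq_le {Q : ℕ} [NeZero Q] (h h' : ZMod Q) :
    #{v : (ZMod Q)ˣ | h * v = h'} ≤ Nat.gcd h.val Q := by
  have h1 : #{v : (ZMod Q)ˣ | h * v = h'} ≤ #{x : ZMod Q | x * h = 0} := by
    rcases Finset.eq_empty_or_nonempty ({v : (ZMod Q)ˣ | h * v = h'} : Finset _) with he | ⟨v0, hv0⟩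
    · simp [he]
    · refine Finset.card_le_card_of_injOn (fun v => (v : ZMod Q) - v0) ?_ ?_
      · intro v hv
        simp only [mem_filter, mem_univ, true_and, coe_filter, Set.mem_ofPred_eq] at hv hv0 ⊢
        rw [sub_mul, mul_comm, hv, mul_comm, hv0, sub_self]
      · intro v _ v' _ hvv
        simpa [Units.ext_iff] using hvv
  refine h1.trans ?_
  have hQ : 0 < Q := Nat.pos_of_ne_zero (NeZero.ne Q)
  have h2 : #{x : ZMod Q | x * h = 0} ≤ #{n ∈ Finset.range Q | Q ∣ n * h.val} := by
    refine Finset.card_le_card_of_injOn ZMod.val ?_ ((ZMod.val_injective Q).injOn)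
    intro x hx
    simp only [mem_univ, true_and, coe_filter, Set.mem_ofPred_eq, mem_range] at hx ⊢
    refine ⟨ZMod.val_lt x, ?_⟩
    rw [← ZMod.natCast_eq_zero_iff]
    push_cast
    simpa using hx
  refine h2.trans ?_
  set g := Nat.gcd h.val Q with hg
  have hgpos : 0 < g := Nat.gcd_pos_of_pos_right _ hQ
  have h3 : #{n ∈ Finset.range Q | Q ∣ n * h.val} ≤ #(Finset.range g) := by
    refine Finset.card_le_card_of_injOn (fun n => n / (Q / g)) ?_ ?_
    · intro n hn
      simp only [coe_filter, mem_range, Set.mem_ofPred_eq, coe_range, Set.mem_Iio] at hn ⊢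
      rw [Nat.div_lt_iff_lt_mul (Nat.div_pos (Nat.le_of_dvd hQ (Nat.gcd_dvd_right _ _)) hgpos)]
      rw [Nat.mul_div_cancel' (Nat.gcd_dvd_right _ _)]
      exact hn.1
    · intro n hn m hm hnm
      have aux : ∀ n, Q ∣ n * h.val → Q / g ∣ n := by
        intro n hn
        have hc : Nat.Coprime (Q / g) (h.val / g) := by
          rw [Nat.coprime_comm]
          exact Nat.coprime_div_gcd_div_gcd hgpos
        refine hc.dvd_of_dvd_mul_right ?_
        rw [← Nat.mul_div_assoc _ (Nat.gcd_dvd_left _ _)]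
        exact Nat.div_dvd_div (Nat.gcd_dvd_right _ _) hn
      simp only [coe_filter, mem_range, Set.mem_ofPred_eq] at hn hm hnm
      rw [← Nat.div_mul_cancel (aux n hn.2), hnm, Nat.div_mul_cancel (aux m hm.2)]
  simpa using h3

lemma totient_mul_norm_kloosterman_pow_four_le {Q : ℕ} [NeZero Q] (h k : ZMod Q) :
    (Nat.totient Q : ℝ) * ‖kloosterman Q h k‖ ^ 4
      ≤ Nat.gcd h.val Q * ((Q : ℝ) ^ 2 * #(momentSet (ZMod Q))) := by
  rw [← sum_norm_kloosterman_pow_four]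
  calc (Nat.totient Q : ℝ) * ‖kloosterman Q h k‖ ^ 4
      = ∑ v : (ZMod Q)ˣ, ‖kloosterman Q (h * v) (k * (v⁻¹ : (ZMod Q)ˣ))‖ ^ 4 := by
        simp [kloosterman_unit_mul, ZMod.card_units_eq_totient]
    _ = ∑ h' : ZMod Q, ∑ k' : ZMod Q, ∑ v : (ZMod Q)ˣ,
          if (h * v = h' ∧ k * (v⁻¹ : (ZMod Q)ˣ) = k') then ‖kloosterman Q h' k'‖ ^ 4 else 0 := by
        rw [Finset.sum_congr rfl fun h' _ => Finset.sum_comm, Finset.sum_comm]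
        refine Finset.sum_congr rfl fun v _ => ?_
        simp [ite_and]
    _ ≤ ∑ h' : ZMod Q, ∑ k' : ZMod Q, Nat.gcd h.val Q * ‖kloosterman Q h' k'‖ ^ 4 := by
        refine Finset.sum_le_sum fun h' _ => Finset.sum_le_sum fun k' _ => ?_
        rw [← Finset.sum_filter, Finset.sum_const, nsmul_eq_mul]
        refine mul_le_mul_of_nonneg_right ?_ (by positivity)
        have := card_mul_eq_le h h'
        refine le_trans ?_ (Nat.cast_le.mpr this)
        exact_mod_cast Finset.card_le_card fun v hv => by
          simp only [mem_filter, mem_univ, true_and] at hv ⊢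
          exact hv.1
    _ = _ := by simp only [Finset.mul_sum]

lemma card_momentSet_mul {m n : ℕ} [NeZero m] [NeZero n] [NeZero (m * n)] (h : Nat.Coprime m n) :
    #(momentSet (ZMod (m * n))) ≤ #(momentSet (ZMod m)) * #(momentSet (ZMod n)) := by
  let f : ZMod (m * n) →+* ZMod m := ZMod.castHom (Nat.dvd_mul_right m n) _
  let g : ZMod (m * n) →+* ZMod n := ZMod.castHom (Nat.dvd_mul_left n m) _
  have hinj : ∀ x y : ZMod (m * n), f x = f y → g x = g y → x = y := by
    intro x y h1 h2
    have hf : f = (RingHom.fst _ _).comp (ZMod.chineseRemainder h).toRingHom :=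
      Subsingleton.elim _ _
    have hg : g = (RingHom.snd _ _).comp (ZMod.chineseRemainder h).toRingHom :=
      Subsingleton.elim _ _
    rw [hf] at h1
    rw [hg] at h2
    exact (ZMod.chineseRemainder h).injective (Prod.ext h1 h2)
  have huinj : ∀ x y : (ZMod (m * n))ˣ, Units.map f.toMonoidHom x = Units.map f.toMonoidHom y →
      Units.map g.toMonoidHom x = Units.map g.toMonoidHom y → x = y := by
    intro x y h1 h2
    ext
    exact hinj _ _ (by simpa [Units.ext_iff] using h1) (by simpa [Units.ext_iff] using h2)
  rw [← Finset.card_product]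
  let F : ((ZMod (m * n))ˣ × (ZMod (m * n))ˣ) × ((ZMod (m * n))ˣ × (ZMod (m * n))ˣ) →
      ((ZMod m)ˣ × (ZMod m)ˣ) × ((ZMod m)ˣ × (ZMod m)ˣ) :=
    Prod.map (Prod.map (Units.map f.toMonoidHom) (Units.map f.toMonoidHom))
      (Prod.map (Units.map f.toMonoidHom) (Units.map f.toMonoidHom))
  let G : ((ZMod (m * n))ˣ × (ZMod (m * n))ˣ) × ((ZMod (m * n))ˣ × (ZMod (m * n))ˣ) →
      ((ZMod n)ˣ × (ZMod n)ˣ) × ((ZMod n)ˣ × (ZMod n)ˣ) :=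
    Prod.map (Prod.map (Units.map g.toMonoidHom) (Units.map g.toMonoidHom))
      (Prod.map (Units.map g.toMonoidHom) (Units.map g.toMonoidHom))
  refine Finset.card_le_card_of_injOn (fun x => (F x, G x)) ?_ ?_
  · intro x hx
    simp only [momentSet, coe_filter, mem_univ, true_and, Set.mem_ofPred_eq] at hx
    simp only [momentSet, coe_product, coe_filter, mem_univ, true_and, Set.mem_prod,
      Set.mem_ofPred_eq, F, G, Prod.map_fst, Prod.map_snd, Units.coe_map, ← map_inv]
    refine ⟨⟨?_, ?_⟩, ?_, ?_⟩
    · simpa using congrArg f hx.1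
    · simpa using congrArg f hx.2
    · simpa using congrArg g hx.1
    · simpa using congrArg g hx.2
  · rintro ⟨⟨a, b⟩, c, d⟩ _ ⟨⟨a', b'⟩, c', d'⟩ _ hxy
    simp only [F, G, Prod.map_apply, Prod.mk.injEq] at hxy
    obtain ⟨⟨⟨h1, h2⟩, h3, h4⟩, ⟨h5, h6⟩, h7, h8⟩ := hxy
    rw [huinj a a' h1 h5, huinj b b' h2 h6, huinj c c' h3 h7, huinj d d' h4 h8]

lemma card_momentSet_prime {p : ℕ} (hp : p.Prime) [NeZero p] :
    #(momentSet (ZMod p)) ≤ 3 * p ^ 2 := by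
  have : Fact p.Prime := ⟨hp⟩
  let U := (ZMod p)ˣ
  let S : Finset (U × U) := univ
  have hsub : momentSet (ZMod p) ⊆
      S.image (fun x => ((x.1, x.2), (x.1, x.2))) ∪ S.image (fun x => ((x.1, x.2), (x.2, x.1))) ∪
        S.image (fun x => ((x.1, -x.1), (x.2, -x.2))) := by
    rintro ⟨⟨a, b⟩, c, d⟩ hx
    simp only [momentSet, mem_filter, mem_univ, true_and] at hx
    simp only [mem_union, mem_image, S, mem_univ, true_and, Prod.exists, Prod.mk.injEq]
    obtain ⟨h1, h2⟩ := hx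
    have ha : (a : ZMod p) ≠ 0 := a.ne_zero
    have hb : (b : ZMod p) ≠ 0 := b.ne_zero
    have hc : (c : ZMod p) ≠ 0 := c.ne_zero
    have hd : (d : ZMod p) ≠ 0 := d.ne_zero
    simp only [Units.val_inv_eq_inv_val] at h2
    field_simp at h2
    by_cases hs : (a : ZMod p) + b = 0
    · right
      have h3 : (c : ZMod p) + d = 0 := h1 ▸ hs
      refine ⟨a, c, ⟨rfl, ?_⟩, rfl, ?_⟩
      · ext; push_cast; linear_combination -hs
      · ext; push_cast; linear_combination -h3
    · left
      have h3 : (c : ZMod p) * d = a * b := by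
        have : ((a : ZMod p) + b) * (c * d - a * b) = 0 := by
          linear_combination h2 + (a * b : ZMod p) * (-h1)
        rcases mul_eq_zero.mp this with h | h
        · exact absurd h hs
        · linear_combination h
      have h4 : ((c : ZMod p) - a) * (c - b) = 0 := by
        linear_combination (-(c : ZMod p)) * h1 - h3
      rcases mul_eq_zero.mp h4 with h | h
      · left
        refine ⟨a, b, ⟨rfl, rfl⟩, ?_, ?_⟩
        · ext; linear_combination -h
        · ext; linear_combination h + h1
      · right
        refine ⟨a, b, ⟨rfl, rfl⟩, ?_, ?_⟩
        · ext; linear_combination -h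
        · ext; linear_combination h + h1
  have hU : #S ≤ p ^ 2 := by
    have : Fintype.card U ≤ p := by
      rw [ZMod.card_units_eq_totient]; exact Nat.totient_le p
    calc #S = Fintype.card U * Fintype.card U := by simp [S]
      _ ≤ p * p := Nat.mul_le_mul this this
      _ = p ^ 2 := (sq p).symm
  calc _ ≤ _ := Finset.card_le_card hsub
    _ ≤ #S + #S + #S := by
        refine (Finset.card_union_le _ _).trans (add_le_add ?_ Finset.card_image_le)
        exact (Finset.card_union_le _ _).trans (add_le_add Finset.card_image_le Finset.card_image_le)
    _ ≤ 3 * p ^ 2 := by omega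

lemma card_momentSet_le {q : ℕ} (hq : 0 < q) (F : Finset ℕ)
    (hF : ∀ p ∈ F, p.Prime ∧ Nat.Coprime q p) (Q : ℕ) [NeZero Q] (hQ : Q = q * ∏ p ∈ F, p) :
    #(momentSet (ZMod Q)) ≤ q ^ 4 * 3 ^ #F * (∏ p ∈ F, p) ^ 2 := by
  induction F using Finset.induction_on generalizing Q with
  | empty =>
    have : Fintype.card (ZMod Q)ˣ ≤ q := by
      rw [ZMod.card_units_eq_totient]; simpa [hQ] using Nat.totient_le q
    calc _ ≤ _ := Finset.card_le_univ _
      _ ≤ q * q * (q * q) := by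
        simp only [Fintype.card_prod]
        gcongr
      _ = _ := by simp; ring
  | insert p s hps ih =>
    have hp := hF p (mem_insert_self p s)
    have hs : ∀ x ∈ s, x.Prime ∧ Nat.Coprime q x := fun x hx => hF x (mem_insert_of_mem hx)
    have : NeZero p := ⟨hp.1.ne_zero⟩
    have h0 : NeZero (q * ∏ p ∈ s, p) :=
      ⟨Nat.mul_ne_zero hq.ne' (Finset.prod_ne_zero_iff.mpr fun x hx => (hs x hx).1.ne_zero)⟩
    have hcop : Nat.Coprime (q * ∏ p ∈ s, p) p := by
      refine Nat.Coprime.mul_left hp.2 (Nat.Coprime.prod_left fun x hx => ?_)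
      refine (Nat.coprime_primes (hs x hx).1 hp.1).mpr ?_
      rintro rfl
      exact hps hx
    have e : Q = (q * ∏ x ∈ s, x) * p := by
      rw [hQ, Finset.prod_insert hps]; ring
    subst e
    refine (card_momentSet_mul hcop).trans
      ((Nat.mul_le_mul (ih hs _ rfl) (card_momentSet_prime hp.1)).trans (le_of_eq ?_))
    rw [Finset.prod_insert hps, Finset.card_insert_of_notMem hps]
    ring

/-- The exponential sum `∑ e(-h a / Q)` over `a ∈ I`. -/
noncomputable def expSum (Q : ℕ) [NeZero Q] (I : Finset ℕ) (h : ZMod Q) : ℂ :=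
  ∑ a ∈ I, ZMod.stdAddChar (-(h * (a : ZMod Q)))

lemma norm_stdAddChar_sub_one_ge {Q : ℕ} [NeZero Q] (h : ZMod Q) :
    4 * (min h.val (Q - h.val) : ℝ) / Q ≤ ‖(ZMod.stdAddChar h : ℂ) - 1‖ := by
  have hQ : (0 : ℝ) < Q := by exact_mod_cast Nat.pos_of_ne_zero (NeZero.ne Q)
  have hlt : (h.val : ℝ) < Q := by exact_mod_cast ZMod.val_lt h
  have h0 : (0 : ℝ) ≤ h.val := by positivity
  have e : (ZMod.stdAddChar h : ℂ)
      = Complex.exp (Complex.I * ((2 * Real.pi * h.val / Q : ℝ) : ℂ)) := by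
    rw [ZMod.stdAddChar_apply, ZMod.toCircle_apply]
    congr 1
    push_cast
    ring
  rw [e, Complex.norm_exp_I_mul_ofReal_sub_one]
  set x : ℝ := Real.pi * h.val / Q with hx
  have hx' : 2 * Real.pi * h.val / Q / 2 = x := by rw [hx]; ring
  rw [hx', Real.norm_eq_abs, abs_mul, abs_two]
  have hpi := Real.pi_pos
  have hx0 : 0 ≤ x := by positivity
  have hxpi : x ≤ Real.pi := by
    rw [hx, div_le_iff₀ hQ]; nlinarith
  have hs : 0 ≤ Real.sin x := Real.sin_nonneg_of_nonneg_of_le_pi hx0 hxpi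
  rw [abs_of_nonneg hs]
  rcases le_total x (Real.pi / 2) with h1 | h1
  · have := Real.mul_le_sin hx0 h1
    have h2 : 2 / Real.pi * x = 2 * h.val / Q := by rw [hx]; field_simp
    calc 4 * (min h.val (Q - h.val) : ℝ) / Q ≤ 4 * (h.val : ℝ) / Q := by
          gcongr; exact min_le_left _ _
      _ = 2 * (2 * h.val / Q) := by ring
      _ ≤ _ := by rw [← h2]; linarith
  · have := Real.mul_le_sin (x := Real.pi - x) (by linarith) (by linarith)
    rw [Real.sin_pi_sub] at this
    have h2 : 2 / Real.pi * (Real.pi - x) = 2 * (Q - h.val) / Q := by rw [hx]; field_simp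
    calc 4 * (min h.val (Q - h.val) : ℝ) / Q ≤ 4 * (Q - h.val : ℝ) / Q := by
          gcongr; exact min_le_right _ _
      _ = 2 * (2 * (Q - h.val) / Q) := by ring
      _ ≤ _ := by rw [← h2]; linarith

lemma norm_expSum_Icc_le {Q : ℕ} [NeZero Q] (a b : ℕ) {h : ZMod Q} (hh : h ≠ 0) :
    ‖expSum Q (Icc a b) h‖ ≤ Q / 2 * (1 / h.val + 1 / (Q - h.val : ℝ)) := by
  have hQ : (0 : ℝ) < Q := by exact_mod_cast Nat.pos_of_ne_zero (NeZero.ne Q)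
  have hlt : (h.val : ℝ) < Q := by exact_mod_cast ZMod.val_lt h
  have h0 : (0 : ℝ) < h.val := by
    exact_mod_cast Nat.pos_of_ne_zero (by simpa [ZMod.val_eq_zero] using hh)
  have h0' : (0 : ℝ) < Q - h.val := by linarith
  have hRHS : Q / 2 * (1 / min (h.val : ℝ) (Q - h.val))
      ≤ Q / 2 * (1 / h.val + 1 / (Q - h.val : ℝ)) := by
    gcongr
    rcases min_choice (h.val : ℝ) (Q - h.val) with e | e <;> rw [e]
    · have : 0 < 1 / (Q - h.val : ℝ) := by positivity
      linarith
    · have : 0 < 1 / (h.val : ℝ) := by positivity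
      linarith
  refine le_trans ?_ hRHS
  set r : ℂ := ZMod.stdAddChar (-h) with hr
  have hrconj : r = (starRingEnd ℂ) (ZMod.stdAddChar h) := by rw [hr, AddChar.map_neg_eq_conj]
  have hn : ‖r - 1‖ = ‖(ZMod.stdAddChar h : ℂ) - 1‖ := by
    rw [hrconj, ← Complex.norm_conj ((ZMod.stdAddChar h : ℂ) - 1)]; simp
  have hge := norm_stdAddChar_sub_one_ge h
  rw [← hn] at hge
  have hm : 0 < min (h.val : ℝ) (Q - h.val) := lt_min h0 h0'
  have hpos : 0 < ‖r - 1‖ := lt_of_lt_of_le (by positivity) hge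
  have hr1 : r ≠ 1 := by
    intro h; rw [h] at hpos; simp at hpos
  have hnr : ‖r‖ = 1 := by rw [hr]; exact AddChar.norm_apply _ _
  have hsum : expSum Q (Icc a b) h = ∑ n ∈ Icc a b, r ^ n := by
    refine Finset.sum_congr rfl fun n _ => ?_
    rw [hr, ← AddChar.map_nsmul_eq_pow]
    congr 1
    simp [mul_comm]
  have hbound : ‖∑ n ∈ Icc a b, r ^ n‖ ≤ 2 / ‖r - 1‖ := by
    rcases le_or_gt a (b + 1) with hab | hab
    · rw [← Finset.Ico_add_one_right_eq_Icc, geom_sum_Ico hr1 hab, norm_div]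
      gcongr
      calc ‖r ^ (b + 1) - r ^ a‖ ≤ ‖r ^ (b + 1)‖ + ‖r ^ a‖ := norm_sub_le _ _
        _ = 2 := by rw [norm_pow, norm_pow, hnr]; norm_num
    · rw [Finset.Icc_eq_empty (by omega)]
      simp; positivity
  rw [hsum]
  refine hbound.trans ?_
  calc 2 / ‖r - 1‖ ≤ 2 / (4 * (min h.val (Q - h.val) : ℝ) / Q) := by gcongr
    _ = _ := by field_simp; norm_num

lemma sum_gcd_div_le {Q : ℕ} (hQ : 0 < Q) :
    ∑ h ∈ Ico 1 Q, (Nat.gcd h Q : ℝ) / h ≤ #(Nat.divisors Q) * (1 + Real.log Q) := by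
  calc ∑ h ∈ Ico 1 Q, (Nat.gcd h Q : ℝ) / h
      ≤ ∑ h ∈ Ico 1 Q, ∑ d ∈ Nat.divisors Q, if d ∣ h then (d : ℝ) / h else 0 := by
        refine Finset.sum_le_sum fun h hh => ?_
        have hmem : Nat.gcd h Q ∈ Nat.divisors Q :=
          Nat.mem_divisors.mpr ⟨Nat.gcd_dvd_right _ _, hQ.ne'⟩
        refine le_trans ?_ (Finset.single_le_sum (f := fun d : ℕ => if d ∣ h then (d : ℝ) / h else 0)
          (fun d _ => by positivity) hmem)
        simp [Nat.gcd_dvd_left]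
    _ = ∑ d ∈ Nat.divisors Q, ∑ h ∈ Ico 1 Q, if d ∣ h then (d : ℝ) / h else 0 := Finset.sum_comm
    _ ≤ ∑ d ∈ Nat.divisors Q, (1 + Real.log Q) := by
        refine Finset.sum_le_sum fun d hd => ?_
        have hd0 : 0 < d := Nat.pos_of_mem_divisors hd
        have h1 : ∑ h ∈ Ico 1 Q, (if d ∣ h then (d : ℝ) / h else 0)
            ≤ ∑ m ∈ Icc 1 Q, (1 : ℝ) / m := by
          rw [← Finset.sum_filter]
          have : ∑ h ∈ Ico 1 Q with d ∣ h, (d : ℝ) / h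
              = ∑ h ∈ Ico 1 Q with d ∣ h, (1 : ℝ) / ((h / d : ℕ) : ℝ) := by
            refine Finset.sum_congr rfl fun h hh => ?_
            rw [mem_filter, mem_Ico] at hh
            have hd0' : (d : ℝ) ≠ 0 := by positivity
            rw [Nat.cast_div hh.2 hd0']
            have : (h : ℝ) ≠ 0 := by have := hh.1.1; positivity
            field_simp
          rw [this]
          rw [← Finset.sum_image (f := fun m : ℕ => (1 : ℝ) / m) (g := fun h => h / d)]
          · refine Finset.sum_le_sum_of_subset_of_nonneg ?_ (fun _ _ _ => by positivity)
            intro m hm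
            simp only [mem_image, mem_filter, mem_Ico] at hm
            obtain ⟨h, ⟨⟨h1, h2⟩, h3⟩, rfl⟩ := hm
            rw [mem_Icc]
            exact ⟨Nat.div_pos (Nat.le_of_dvd h1 h3) hd0, (Nat.div_le_self _ _).trans h2.le⟩
          · intro x hx y hy hxy
            simp only [coe_filter, mem_Ico, Set.mem_ofPred_eq] at hx hy hxy
            rw [← Nat.div_mul_cancel hx.2, hxy, Nat.div_mul_cancel hy.2]
        refine h1.trans ?_
        have := harmonic_le_one_add_log Q
        rw [harmonic_eq_sum_Icc] at this
        push_cast at this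
        simpa [one_div] using this
    _ = _ := by rw [Finset.sum_const, nsmul_eq_mul]

lemma sum_norm_expSum_mul_gcd_le {Q : ℕ} [NeZero Q] (a b : ℕ) :
    ∑ h ∈ univ.erase (0 : ZMod Q), ‖expSum Q (Icc a b) h‖ * Nat.gcd h.val Q
      ≤ Q * (#(Nat.divisors Q) * (1 + Real.log Q)) := by
  have hQ : 0 < Q := Nat.pos_of_ne_zero (NeZero.ne Q)
  have key : ∑ h ∈ univ.erase (0 : ZMod Q), ‖expSum Q (Icc a b) h‖ * Nat.gcd h.val Q
      ≤ ∑ h ∈ Ico 1 Q, (Q / 2 * (1 / h + 1 / (Q - h : ℝ))) * Nat.gcd h Q := by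
    calc _ ≤ ∑ h ∈ univ.erase (0 : ZMod Q),
            (Q / 2 * (1 / h.val + 1 / (Q - h.val : ℝ))) * Nat.gcd h.val Q := by
          refine Finset.sum_le_sum fun h hh => ?_
          gcongr
          exact norm_expSum_Icc_le a b (Finset.ne_of_mem_erase hh)
      _ ≤ _ := by
          rw [← Finset.sum_image (f := fun h : ℕ => (Q / 2 * (1 / h + 1 / (Q - h : ℝ))) * Nat.gcd h Q)
            (g := ZMod.val) ((ZMod.val_injective Q).injOn)]
          refine Finset.sum_le_sum_of_subset_of_nonneg ?_ ?_
          · intro m hm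
            simp only [mem_image, mem_erase, mem_univ, and_true] at hm
            obtain ⟨h, h1, rfl⟩ := hm
            rw [mem_Ico]
            exact ⟨Nat.pos_of_ne_zero (by simpa [ZMod.val_eq_zero] using h1), ZMod.val_lt h⟩
          · intro m hm _
            have : (m : ℝ) < Q := by exact_mod_cast (mem_Ico.mp hm).2
            have : 0 < (Q : ℝ) - m := by linarith
            positivity
  refine key.trans ?_
  have hsymm : ∑ h ∈ Ico 1 Q, (1 / (Q - h : ℝ)) * Nat.gcd h Q
      = ∑ h ∈ Ico 1 Q, (Nat.gcd h Q : ℝ) / h := by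
    refine Finset.sum_bij' (fun h _ => Q - h) (fun h _ => Q - h) ?_ ?_ ?_ ?_ ?_
    · intro h hh; simp only [mem_Ico] at hh ⊢; omega
    · intro h hh; simp only [mem_Ico] at hh ⊢; omega
    · intro h hh; simp only [mem_Ico] at hh; omega
    · intro h hh; simp only [mem_Ico] at hh; omega
    · intro h hh
      simp only [mem_Ico] at hh
      rw [Nat.cast_sub hh.2.le, Nat.gcd_comm (Q - h), Nat.gcd_self_sub_right hh.2.le,
        Nat.gcd_comm Q h]
      ring
  have hsplit : ∑ h ∈ Ico 1 Q, (Q / 2 * (1 / h + 1 / (Q - h : ℝ))) * Nat.gcd h Q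
      = Q / 2 * (∑ h ∈ Ico 1 Q, (Nat.gcd h Q : ℝ) / h
        + ∑ h ∈ Ico 1 Q, (1 / (Q - h : ℝ)) * Nat.gcd h Q) := by
    rw [← Finset.sum_add_distrib, Finset.mul_sum]
    refine Finset.sum_congr rfl fun h _ => ?_
    ring
  rw [hsplit, hsymm]
  have := sum_gcd_div_le hQ
  have hQ' : (0 : ℝ) < Q := by exact_mod_cast hQ
  nlinarith

/-- The number of `a ∈ I` in the residue class `x`. -/
def residueCount (Q : ℕ) (I : Finset ℕ) (x : ZMod Q) : ℕ := #(I.filter fun a : ℕ => (a : ZMod Q) = x)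

lemma inner_expSum_eq {Q : ℕ} [NeZero Q] (I : Finset ℕ) (x : ZMod Q) :
    ((residueCount Q I x : ℂ) - #I / Q) * Q
      = ∑ h ∈ univ.erase (0 : ZMod Q), expSum Q I h * ZMod.stdAddChar (h * x) := by
  have hQ : (Q : ℂ) ≠ 0 := by exact_mod_cast NeZero.ne Q
  have h1 : ∑ h : ZMod Q, expSum Q I h * ZMod.stdAddChar (h * x)
      = (residueCount Q I x : ℂ) * Q := by
    simp only [expSum, Finset.sum_mul]
    rw [Finset.sum_comm]
    have : ∀ a ∈ I, ∑ h : ZMod Q, (ZMod.stdAddChar (-(h * (a : ZMod Q))) : ℂ) *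
        ZMod.stdAddChar (h * x) = if (a : ZMod Q) = x then (Q : ℂ) else 0 := by
      intro a _
      have e : ∀ h : ZMod Q, (ZMod.stdAddChar (-(h * (a : ZMod Q))) : ℂ) *
          ZMod.stdAddChar (h * x) = ZMod.stdAddChar (h * (x - (a : ZMod Q))) := by
        intro h
        rw [← AddChar.map_add_eq_mul]; congr 1; ring
      simp only [e, AddChar.sum_mulShift _ (ZMod.isPrimitive_stdAddChar Q), ZMod.card, sub_eq_zero]
      by_cases hx : (a : ZMod Q) = x
      · simp [hx]
      · simp [hx, Ne.symm hx]
    rw [Finset.sum_congr rfl this, ← Finset.sum_filter, Finset.sum_const, nsmul_eq_mul, residueCount]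
  rw [← Finset.add_sum_erase _ _ (mem_univ (0 : ZMod Q))] at h1
  have h2 : expSum Q I 0 * ZMod.stdAddChar ((0 : ZMod Q) * x) = (#I : ℂ) := by
    simp [expSum]
  rw [h2] at h1
  field_simp
  linear_combination -h1

lemma sum_unit_fiber {Q : ℕ} [NeZero Q] (I : Finset ℕ) :
    ∑ u : (ZMod Q)ˣ, residueCount Q I u = #{a ∈ I | Nat.Coprime a Q} := by
  simp only [residueCount, Finset.card_filter]
  rw [Finset.sum_comm]
  refine Finset.sum_congr rfl fun a _ => ?_
  split_ifs with h
  · rw [Finset.sum_eq_single (ZMod.unitOfCoprime a h)]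
    · simp
    · intro b _ hb
      rw [if_neg]
      intro e
      exact hb (Units.ext (by simp [e]))
    · simp
  · refine Finset.sum_eq_zero fun u _ => ?_
    rw [if_neg]
    intro e
    exact h ((ZMod.isUnit_iff_coprime a Q).mp (e ▸ u.isUnit))

lemma card_box_eq {Q : ℕ} [NeZero Q] (I J : Finset ℕ) (c : (ZMod Q)ˣ) :
    #{x ∈ I ×ˢ J | (x.1 : ZMod Q) * x.2 = c}
      = ∑ u : (ZMod Q)ˣ, residueCount Q I u *
          residueCount Q J ((c * u⁻¹ : (ZMod Q)ˣ) : ZMod Q) := by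
  simp only [residueCount, ← Finset.card_product, ← Finset.filter_product]
  simp only [Finset.card_filter]
  rw [Finset.sum_comm]
  refine Finset.sum_congr rfl fun x _ => ?_
  have hiff : ∀ u : (ZMod Q)ˣ, ((x.1 : ZMod Q) = u ∧
      (x.2 : ZMod Q) = ((c * u⁻¹ : (ZMod Q)ˣ) : ZMod Q)) ↔
      ((x.1 : ZMod Q) = u ∧ (x.1 : ZMod Q) * x.2 = c) := by
    intro u
    refine and_congr_right fun h => ?_
    rw [h]
    constructor
    · intro h2; rw [h2]; push_cast; rw [mul_left_comm]; simp
    · intro h2; push_cast; rw [← h2]; rw [mul_comm (u : ZMod Q), mul_assoc]; simp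
  simp only [hiff]
  split_ifs with h
  · have hu : IsUnit (x.1 : ZMod Q) := isUnit_of_mul_isUnit_left (h ▸ c.isUnit)
    obtain ⟨u, hu⟩ := hu
    rw [Finset.sum_eq_single u]
    · simp [hu, h]
    · intro b _ hb
      rw [if_neg]
      rintro ⟨h1, _⟩
      exact hb (Units.ext (by rw [← h1, hu]))
    · simp
  · simp [h]

lemma abs_card_box_sub_le {Q : ℕ} [NeZero Q] (a₁ a₂ b₁ b₂ : ℕ) (c : (ZMod Q)ˣ) {V : ℝ}
    (hV0 : 0 ≤ V) (hV : ∀ h k : ZMod Q, ‖kloosterman Q h k‖ ≤ Nat.gcd h.val Q * V) :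
    |(#{x ∈ Icc a₁ a₂ ×ˢ Icc b₁ b₂ | (x.1 : ZMod Q) * x.2 = c} : ℝ)
        - #(Icc b₁ b₂) / Q * #{a ∈ Icc a₁ a₂ | Nat.Coprime a Q}
        - #(Icc a₁ a₂) / Q * (#{b ∈ Icc b₁ b₂ | Nat.Coprime b Q}
          - #(Icc b₁ b₂) * (Nat.totient Q : ℝ) / Q)|
      ≤ V * (#(Nat.divisors Q) * (1 + Real.log Q)) ^ 2 := by
  set I := Icc a₁ a₂ with hI
  set J := Icc b₁ b₂ with hJ
  have hQ : (0 : ℝ) < Q := by exact_mod_cast Nat.pos_of_ne_zero (NeZero.ne Q)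
  have hQc : (Q : ℂ) ≠ 0 := by exact_mod_cast NeZero.ne Q
  set F : (ZMod Q)ˣ → ℂ := fun u => (residueCount Q I u : ℂ) - #I / Q with hF
  set G : (ZMod Q)ˣ → ℂ := fun u =>
    (residueCount Q J ((c * u⁻¹ : (ZMod Q)ˣ) : ZMod Q) : ℂ) - #J / Q with hG
  have hFsum : ∑ u, F u = (#{a ∈ I | Nat.Coprime a Q} : ℂ) - Nat.totient Q * (#I / Q) := by
    simp only [hF, Finset.sum_sub_distrib, Finset.sum_const, card_univ,
      ZMod.card_units_eq_totient, nsmul_eq_mul]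
    rw [← sum_unit_fiber]
    push_cast; ring
  have hGsum : ∑ u, G u = (#{b ∈ J | Nat.Coprime b Q} : ℂ) - Nat.totient Q * (#J / Q) := by
    simp only [hG, Finset.sum_sub_distrib, Finset.sum_const, card_univ,
      ZMod.card_units_eq_totient, nsmul_eq_mul]
    rw [← sum_unit_fiber]
    push_cast
    congr 1
    exact Fintype.sum_equiv ((Equiv.inv _).trans (Equiv.mulLeft c)) _ _ fun u => by simp
  have hcount : ((#{x ∈ I ×ˢ J | (x.1 : ZMod Q) * x.2 = c} : ℝ) : ℂ)
      = ∑ u, (F u + #I / Q) * (G u + #J / Q) := by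
    rw [card_box_eq]
    push_cast
    refine Finset.sum_congr rfl fun u _ => ?_
    simp only [hF, hG]
    push_cast
    ring
  have hmain : (((#{x ∈ I ×ˢ J | (x.1 : ZMod Q) * x.2 = c} : ℝ)
        - #J / Q * #{a ∈ I | Nat.Coprime a Q}
        - #I / Q * (#{b ∈ J | Nat.Coprime b Q} - #J * (Nat.totient Q : ℝ) / Q) : ℝ) : ℂ)
      = ∑ u, F u * G u := by
    have e : ∑ u, (F u + #I / Q) * (G u + #J / Q) = ∑ u, F u * G u + #J / Q * ∑ u, F u
        + #I / Q * ∑ u, G u + Nat.totient Q * (#I / Q * (#J / Q)) := by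
      rw [Finset.mul_sum, Finset.mul_sum, ← Finset.sum_add_distrib, ← Finset.sum_add_distrib]
      have : (Nat.totient Q : ℂ) * (#I / Q * (#J / Q))
          = ∑ u : (ZMod Q)ˣ, (#I / Q * (#J / Q) : ℂ) := by
        simp [ZMod.card_units_eq_totient]
      rw [this, ← Finset.sum_add_distrib]
      exact Finset.sum_congr rfl fun u _ => by ring
    rw [Complex.ofReal_sub, Complex.ofReal_sub, hcount, e, hFsum, hGsum]
    push_cast
    ring
  rw [← Real.norm_eq_abs, ← Complex.norm_real, hmain]
  have hFG : (∑ u, F u * G u) * (Q : ℂ) ^ 2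
      = ∑ h ∈ univ.erase (0 : ZMod Q), ∑ k ∈ univ.erase (0 : ZMod Q),
          expSum Q I h * expSum Q J k * kloosterman Q h (k * c) := by
    have : ∀ u : (ZMod Q)ˣ, F u * G u * (Q : ℂ) ^ 2
        = ∑ h ∈ univ.erase (0 : ZMod Q), ∑ k ∈ univ.erase (0 : ZMod Q),
          expSum Q I h * expSum Q J k * ZMod.stdAddChar
            (h * (u : ZMod Q) + k * (c : ZMod Q) * ((u⁻¹ : (ZMod Q)ˣ) : ZMod Q)) := by
      intro u
      rw [show F u * G u * (Q : ℂ) ^ 2 = (F u * Q) * (G u * Q) by ring]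
      simp only [hF, hG]
      rw [inner_expSum_eq, inner_expSum_eq, Finset.sum_mul_sum]
      refine Finset.sum_congr rfl fun h _ => Finset.sum_congr rfl fun k _ => ?_
      rw [AddChar.map_add_eq_mul]
      push_cast
      rw [← mul_assoc k]
      ring
    rw [Finset.sum_mul, Finset.sum_congr rfl fun u _ => this u, Finset.sum_comm]
    refine Finset.sum_congr rfl fun h _ => ?_
    rw [Finset.sum_comm]
    refine Finset.sum_congr rfl fun k _ => ?_
    rw [kloosterman, Finset.mul_sum]
  have hgoal : ‖∑ u, F u * G u‖ * (Q : ℝ) ^ 2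
      ≤ V * (#(Nat.divisors Q) * (1 + Real.log Q)) ^ 2 * (Q : ℝ) ^ 2 := by
    have : ‖∑ u, F u * G u‖ * (Q : ℝ) ^ 2 = ‖(∑ u, F u * G u) * (Q : ℂ) ^ 2‖ := by
      rw [norm_mul, norm_pow, Complex.norm_natCast]
    rw [this, hFG]
    have hA := sum_norm_expSum_mul_gcd_le (Q := Q) a₁ a₂
    have hB := sum_norm_expSum_mul_gcd_le (Q := Q) b₁ b₂
    rw [← hI] at hA
    rw [← hJ] at hB
    have hnn : ∀ K : Finset ℕ, 0 ≤ ∑ h ∈ univ.erase (0 : ZMod Q), ‖expSum Q K h‖ * Nat.gcd h.val Q :=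
      fun K => Finset.sum_nonneg fun _ _ => by positivity
    calc _ ≤ ∑ h ∈ univ.erase (0 : ZMod Q), ∑ k ∈ univ.erase (0 : ZMod Q),
            V * ((‖expSum Q I h‖ * Nat.gcd h.val Q) * (‖expSum Q J k‖ * Nat.gcd k.val Q)) := by
          refine (norm_sum_le _ _).trans (Finset.sum_le_sum fun h _ => ?_)
          refine (norm_sum_le _ _).trans (Finset.sum_le_sum fun k _ => ?_)
          rw [norm_mul, norm_mul]
          have h1 := hV h (k * c)
          have h2 : (1 : ℝ) ≤ Nat.gcd k.val Q := by
            exact_mod_cast Nat.gcd_pos_of_pos_right _ (Nat.pos_of_ne_zero (NeZero.ne Q))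
          calc ‖expSum Q I h‖ * ‖expSum Q J k‖ * ‖kloosterman Q h (k * c)‖
              ≤ ‖expSum Q I h‖ * (‖expSum Q J k‖ * Nat.gcd k.val Q) * (Nat.gcd h.val Q * V) := by
                gcongr
                exact le_mul_of_one_le_right (norm_nonneg _) h2
            _ = _ := by ring
      _ = V * ((∑ h ∈ univ.erase (0 : ZMod Q), ‖expSum Q I h‖ * Nat.gcd h.val Q) *
            ∑ k ∈ univ.erase (0 : ZMod Q), ‖expSum Q J k‖ * Nat.gcd k.val Q) := by
          rw [Finset.sum_mul_sum, Finset.mul_sum]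
          exact Finset.sum_congr rfl fun h _ => by rw [Finset.mul_sum]
      _ ≤ V * ((Q * (#(Nat.divisors Q) * (1 + Real.log Q))) *
            (Q * (#(Nat.divisors Q) * (1 + Real.log Q)))) := by
          have := hnn I
          have := hnn J
          gcongr
      _ = _ := by ring
  exact le_of_mul_le_mul_right hgoal (by positivity)

lemma sum_powerset_prod_mul_add {ι : Type*} [DecidableEq ι] (P : Finset ι) (a b u v : ι → ℝ)
    (hab : ∀ p ∈ P, a p + b p ≠ 0) (c₀ : ℝ) :
    ∑ S ∈ P.powerset, (∏ p ∈ S, a p) * (∏ p ∈ P \ S, b p) *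
        (c₀ + ∑ p ∈ S, u p + ∑ p ∈ P \ S, v p)
      = (∏ p ∈ P, (a p + b p)) * (c₀ + ∑ p ∈ P, (a p * u p + b p * v p) / (a p + b p)) := by
  induction P using Finset.induction_on generalizing c₀ with
  | empty => simp
  | insert q P hq ih =>
    have hP : ∀ p ∈ P, a p + b p ≠ 0 := fun p hp => hab p (mem_insert_of_mem hp)
    have hq0 := hab q (mem_insert_self q P)
    rw [Finset.sum_powerset_insert hq, Finset.prod_insert hq, Finset.sum_insert hq]
    have h1 : ∀ S ∈ P.powerset, (∏ p ∈ S, a p) * (∏ p ∈ insert q P \ S, b p) *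
        (c₀ + ∑ p ∈ S, u p + ∑ p ∈ insert q P \ S, v p)
        = b q * ((∏ p ∈ S, a p) * (∏ p ∈ P \ S, b p) *
          ((c₀ + v q) + ∑ p ∈ S, u p + ∑ p ∈ P \ S, v p)) := by
      intro S hS
      have hqS : q ∉ S := fun h => hq (mem_powerset.mp hS h)
      have hqP : q ∉ P \ S := fun h => hq (mem_sdiff.mp h).1
      rw [Finset.insert_sdiff_of_notMem _ hqS, Finset.prod_insert hqP, Finset.sum_insert hqP]
      ring
    have h2 : ∀ S ∈ P.powerset, (∏ p ∈ insert q S, a p) * (∏ p ∈ insert q P \ insert q S, b p) *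
        (c₀ + ∑ p ∈ insert q S, u p + ∑ p ∈ insert q P \ insert q S, v p)
        = a q * ((∏ p ∈ S, a p) * (∏ p ∈ P \ S, b p) *
          ((c₀ + u q) + ∑ p ∈ S, u p + ∑ p ∈ P \ S, v p)) := by
      intro S hS
      have hqS : q ∉ S := fun h => hq (mem_powerset.mp hS h)
      have e : insert q P \ insert q S = P \ S := by
        rw [Finset.insert_sdiff_insert]
        exact Finset.sdiff_insert_of_notMem hq _
      rw [e, Finset.prod_insert hqS, Finset.sum_insert hqS]
      ring
    rw [Finset.sum_congr rfl h1, Finset.sum_congr rfl h2, ← Finset.mul_sum, ← Finset.mul_sum,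
      ih hP, ih hP]
    field_simp
    ring

lemma coprime_indicator {Q : ℕ} (hQ : Q ≠ 0) (a : ℕ) :
    (if Nat.Coprime a Q then (1 : ℝ) else 0)
      = ∑ S ∈ Q.primeFactors.powerset, (-1) ^ #S * if (∏ p ∈ S, p) ∣ a then (1 : ℝ) else 0 := by
  have h1 : ∏ p ∈ Q.primeFactors, ((-(if p ∣ a then (1 : ℝ) else 0)) + 1)
      = ∑ S ∈ Q.primeFactors.powerset, (-1) ^ #S * if (∏ p ∈ S, p) ∣ a then (1 : ℝ) else 0 := by
    rw [Finset.prod_add]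
    refine Finset.sum_congr rfl fun S hS => ?_
    rw [Finset.prod_const_one, mul_one, Finset.prod_neg]
    congr 1
    rw [Finset.prod_ite_zero, Finset.prod_const_one]
    congr 1
    rw [eq_iff_iff]
    constructor
    · intro h
      refine Finset.prod_primes_dvd a (fun p hp => ?_) h
      exact (Nat.prime_of_mem_primeFactors (mem_powerset.mp hS hp)).prime
    · exact fun h p hp => (Finset.dvd_prod_of_mem _ hp).trans h
  rw [← h1]
  split_ifs with h
  · rw [Finset.prod_eq_one]
    intro p hp
    have : ¬ p ∣ a := fun hpa => (Nat.prime_of_mem_primeFactors hp).one_lt.ne'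
      (Nat.eq_one_of_dvd_coprimes h hpa (Nat.dvd_of_mem_primeFactors hp))
    simp [this]
  · obtain ⟨p, hp, hpa, hpQ⟩ := Nat.Prime.not_coprime_iff_dvd.mp h
    rw [Finset.prod_eq_zero (i := p) (Nat.mem_primeFactors.mpr ⟨hp, hpQ, hQ⟩)]
    simp [hpa]

lemma totient_div_eq_prod {Q : ℕ} (hQ : Q ≠ 0) :
    (Nat.totient Q : ℝ) / Q = ∏ p ∈ Q.primeFactors, (1 - 1 / (p : ℝ)) := by
  have h := Nat.totient_eq_mul_prod_factors Q
  have h' : ((Nat.totient Q : ℚ) : ℝ) = ((Q * ∏ p ∈ Q.primeFactors, (1 - (p : ℚ)⁻¹) : ℚ) : ℝ) := by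
    rw [h]
  push_cast at h'
  rw [h']
  field_simp

lemma prod_one_sub_eq_sum_powerset (P : Finset ℕ) :
    ∏ p ∈ P, (1 - 1 / (p : ℝ)) = ∑ S ∈ P.powerset, (-1) ^ #S / ((∏ p ∈ S, p : ℕ) : ℝ) := by
  have : ∀ p ∈ P, (1 - 1 / (p : ℝ)) = -(1 / (p : ℝ)) + 1 := fun p _ => by ring
  rw [Finset.prod_congr rfl this, Finset.prod_add]
  refine Finset.sum_congr rfl fun S _ => ?_
  rw [Finset.prod_const_one, mul_one, Finset.prod_neg]
  push_cast
  rw [Finset.prod_div_distrib, Finset.prod_const_one]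
  ring

lemma abs_card_coprime_sub_le {Q : ℕ} (hQ : Q ≠ 0) (Y : ℕ) :
    |(#{b ∈ Icc 1 Y | Nat.Coprime b Q} : ℝ) - Y * (Nat.totient Q : ℝ) / Q|
      ≤ 2 ^ #Q.primeFactors := by
  have h1 : (#{b ∈ Icc 1 Y | Nat.Coprime b Q} : ℝ)
      = ∑ S ∈ Q.primeFactors.powerset, (-1) ^ #S * ((Y / ∏ p ∈ S, p : ℕ) : ℝ) := by
    rw [Finset.card_filter]
    push_cast
    rw [Finset.sum_congr rfl fun a _ => coprime_indicator hQ a, Finset.sum_comm]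
    refine Finset.sum_congr rfl fun S _ => ?_
    rw [← Finset.mul_sum, ← Nat.Ioc_filter_dvd_card_eq_div, Finset.card_filter]
    push_cast
    rfl
  rw [mul_div_assoc, totient_div_eq_prod hQ, prod_one_sub_eq_sum_powerset, h1, Finset.mul_sum,
    ← Finset.sum_sub_distrib]
  refine (Finset.abs_sum_le_sum_abs _ _).trans ?_
  calc _ ≤ ∑ S ∈ Q.primeFactors.powerset, (1 : ℝ) := by
        refine Finset.sum_le_sum fun S _ => ?_
        rw [mul_div_left_comm, ← mul_sub, abs_mul, abs_pow, abs_neg, abs_one, one_pow, one_mul]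
        have h2 := Nat.cast_div_le (α := ℝ) (m := Y) (n := ∏ p ∈ S, p)
        have h3 := Nat.lt_floor_add_one ((Y : ℝ) / ((∏ p ∈ S, p : ℕ) : ℝ))
        rw [Nat.floor_div_eq_div] at h3
        rw [abs_le]
        constructor <;> linarith
    _ = _ := by simp [Finset.card_powerset]

lemma abs_harmonic_div_sub_le {A d : ℕ} (hA : 0 < A) (hd : 0 < d) :
    |(∑ n ∈ Icc 1 (A / d), 1 / (n : ℝ)) - (Real.log A - Real.log d + Real.eulerMascheroniConstant)|
      ≤ 4 * d / A := by
  have hA' : (0 : ℝ) < A := by exact_mod_cast hA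
  have hd' : (0 : ℝ) < d := by exact_mod_cast hd
  have hγ := Real.one_half_lt_eulerMascheroniConstant
  have hγ' := Real.eulerMascheroniConstant_lt_two_thirds
  rcases lt_or_ge A d with h | h
  · rw [Nat.div_eq_of_lt h]
    have hlt : (A : ℝ) < d := by exact_mod_cast h
    have h1 : Real.log d - Real.log A ≤ d / A - 1 := by
      rw [← Real.log_div hd'.ne' hA'.ne']
      exact Real.log_le_sub_one_of_pos (by positivity)
    have h2 : Real.log A ≤ Real.log d := Real.log_le_log hA' hlt.le
    have h3 : 1 < (d : ℝ) / A := (one_lt_div hA').mpr hlt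
    have h4 : 4 * (d : ℝ) / A = 4 * (d / A) := by ring
    rw [h4, abs_le]
    constructor <;> simp <;> linarith
  · set n := A / d with hn
    have hn0 : 0 < n := Nat.div_pos h hd
    have hn' : (0 : ℝ) < n := by exact_mod_cast hn0
    have hle : (n : ℝ) ≤ A / d := Nat.cast_div_le
    have hlt : (A : ℝ) / d < n + 1 := by
      have := Nat.lt_floor_add_one ((A : ℝ) / d)
      rwa [Nat.floor_div_eq_div] at this
    have hharm : (∑ m ∈ Icc 1 n, 1 / (m : ℝ)) = (harmonic n : ℝ) := by
      rw [harmonic_eq_sum_Icc]; push_cast; simp [one_div]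
    have h1 : Real.log (A / d) ≤ Real.log n + 1 / n := by
      have : Real.log (A / d) - Real.log n ≤ (A / d) / n - 1 := by
        rw [← Real.log_div (by positivity) hn'.ne']
        exact Real.log_le_sub_one_of_pos (by positivity)
      have h2 : (A / d : ℝ) / n - 1 ≤ 1 / n := by
        rw [div_sub_one hn'.ne']
        gcongr; linarith
      linarith
    have h2 : Real.log n ≤ Real.log (A / d) := Real.log_le_log hn' hle
    have h3 := Real.eulerMascheroniSeq_lt_eulerMascheroniConstant n
    have h4 := Real.eulerMascheroniConstant_lt_eulerMascheroniSeq' n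
    rw [Real.eulerMascheroniSeq] at h3
    rw [Real.eulerMascheroniSeq', if_neg hn0.ne'] at h4
    have h5 : Real.log (n + 1) ≤ Real.log n + 1 / n := by
      have : Real.log (n + 1) - Real.log n ≤ (n + 1) / n - 1 := by
        rw [← Real.log_div (by positivity) hn'.ne']
        exact Real.log_le_sub_one_of_pos (by positivity)
      have h6 : ((n : ℝ) + 1) / n - 1 = 1 / n := by field_simp; ring
      linarith
    rw [hharm, ← Real.log_div hA'.ne' hd'.ne']
    have h7 : 1 / (n : ℝ) ≤ 4 * d / A := by
      rw [div_le_div_iff₀ hn' hA']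
      have : (A : ℝ) < (n + 1) * d := (div_lt_iff₀ hd').mp hlt
      have h8 : (1 : ℝ) ≤ n := by exact_mod_cast hn0
      nlinarith
    rw [abs_le]
    constructor <;> linarith

/-- The sum of `log p / (p - 1)` over the primes dividing `Q`. -/
noncomputable def logSum (Q : ℕ) : ℝ := ∑ p ∈ Q.primeFactors, Real.log p / ((p : ℝ) - 1)

lemma abs_sum_coprime_inv_sub_le {Q : ℕ} (hQ : Q ≠ 0) {A : ℕ} (hA : 0 < A) :
    |(∑ a ∈ Icc 1 A with Nat.Coprime a Q, 1 / (a : ℝ))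
        - (Nat.totient Q : ℝ) / Q * (Real.log A + Real.eulerMascheroniConstant + logSum Q)|
      ≤ 4 * 2 ^ #Q.primeFactors / A := by
  have hA' : (0 : ℝ) < A := by exact_mod_cast hA
  have h1 : (∑ a ∈ Icc 1 A with Nat.Coprime a Q, 1 / (a : ℝ))
      = ∑ S ∈ Q.primeFactors.powerset, (-1) ^ #S / ((∏ p ∈ S, p : ℕ) : ℝ) *
          ∑ n ∈ Icc 1 (A / ∏ p ∈ S, p), 1 / (n : ℝ) := by
    rw [Finset.sum_filter]
    have : ∀ a ∈ Icc 1 A, (if Nat.Coprime a Q then 1 / (a : ℝ) else 0)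
        = ∑ S ∈ Q.primeFactors.powerset, (-1) ^ #S *
          if (∏ p ∈ S, p) ∣ a then 1 / (a : ℝ) else 0 := by
      intro a _
      have := congrArg (· * (1 / (a : ℝ))) (coprime_indicator hQ a)
      simp only [Finset.sum_mul, ite_mul, one_mul, zero_mul, mul_assoc] at this
      exact this
    rw [Finset.sum_congr rfl this, Finset.sum_comm]
    refine Finset.sum_congr rfl fun S hS => ?_
    rw [← Finset.mul_sum, ← Finset.sum_filter, div_eq_mul_one_div, mul_assoc]
    congr 1
    set d := ∏ p ∈ S, p with hd
    have hd0 : 0 < d := Finset.prod_pos fun p hp =>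
      (Nat.prime_of_mem_primeFactors (mem_powerset.mp hS hp)).pos
    rw [Finset.mul_sum]
    symm
    refine Finset.sum_bij' (fun n _ => d * n) (fun a _ => a / d) ?_ ?_ ?_ ?_ ?_
    · intro n hn
      rw [mem_Icc] at hn
      rw [mem_filter, mem_Icc]
      refine ⟨⟨Nat.mul_pos hd0 hn.1, ?_⟩, dvd_mul_right _ _⟩
      rw [mul_comm]
      exact (Nat.le_div_iff_mul_le hd0).mp hn.2
    · intro a ha
      rw [mem_filter, mem_Icc] at ha
      rw [mem_Icc]
      exact ⟨Nat.div_pos (Nat.le_of_dvd ha.1.1 ha.2) hd0, Nat.div_le_div_right ha.1.2⟩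
    · intro n _; exact Nat.mul_div_cancel_left n hd0
    · intro a ha; exact Nat.mul_div_cancel' (mem_filter.mp ha).2
    · intro n _; push_cast; rw [div_mul_div_comm, one_mul]
  set γ := Real.eulerMascheroniConstant
  have h2 : (Nat.totient Q : ℝ) / Q * (Real.log A + γ + logSum Q)
      = ∑ S ∈ Q.primeFactors.powerset, (-1) ^ #S / ((∏ p ∈ S, p : ℕ) : ℝ) *
          (Real.log A - Real.log ((∏ p ∈ S, p : ℕ) : ℝ) + γ) := by
    have hp1 : ∀ p ∈ Q.primeFactors, (1 : ℝ) < p := fun p hp => by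
      exact_mod_cast (Nat.prime_of_mem_primeFactors hp).one_lt
    have := sum_powerset_prod_mul_add Q.primeFactors (fun p => -(1 / (p : ℝ))) (fun _ => 1)
      (fun p => -Real.log p) (fun _ => 0) (fun p hp => by
        have := hp1 p hp
        have h3 : 1 / (p : ℝ) < 1 := by rw [div_lt_one (by linarith)]; exact this
        linarith) (Real.log A + γ)
    have e : ∏ p ∈ Q.primeFactors, (-(1 / (p : ℝ)) + 1) = (Nat.totient Q : ℝ) / Q := by
      rw [totient_div_eq_prod hQ]
      exact Finset.prod_congr rfl fun p _ => by ring
    have e2 : ∑ p ∈ Q.primeFactors, (-(1 / (p : ℝ)) * -Real.log p + 1 * 0) / (-(1 / (p : ℝ)) + 1)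
        = logSum Q := by
      refine Finset.sum_congr rfl fun p hp => ?_
      have := hp1 p hp
      have h4 : (p : ℝ) - 1 ≠ 0 := by linarith
      have h6 : -(1 / (p : ℝ)) + 1 = (p - 1) / p := by field_simp; ring
      rw [h6]
      field_simp
      ring
    rw [e, e2] at this
    rw [← this]
    refine Finset.sum_congr rfl fun S hS => ?_
    have hne : ∀ p ∈ S, (p : ℝ) ≠ 0 := fun p hp => by
      have := hp1 p (mem_powerset.mp hS hp); positivity
    rw [Finset.prod_const_one, mul_one, Finset.prod_neg, Finset.sum_const_zero, add_zero,
      Finset.sum_neg_distrib]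
    push_cast
    rw [Real.log_prod hne, Finset.prod_div_distrib, Finset.prod_const_one]
    ring
  rw [h1, h2, ← Finset.sum_sub_distrib]
  refine (Finset.abs_sum_le_sum_abs _ _).trans ?_
  calc _ ≤ ∑ S ∈ Q.primeFactors.powerset, 4 / (A : ℝ) := by
        refine Finset.sum_le_sum fun S hS => ?_
        have hd0 : 0 < ∏ p ∈ S, p := Finset.prod_pos fun p hp =>
          (Nat.prime_of_mem_primeFactors (mem_powerset.mp hS hp)).pos
        have hd0' : (0 : ℝ) < ((∏ p ∈ S, p : ℕ) : ℝ) := by exact_mod_cast hd0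
        rw [← mul_sub, abs_mul, abs_div, abs_pow, abs_neg, abs_one, one_pow, abs_of_pos hd0']
        calc _ ≤ 1 / ((∏ p ∈ S, p : ℕ) : ℝ) * (4 * ((∏ p ∈ S, p : ℕ) : ℝ) / A) := by
              gcongr
              exact abs_harmonic_div_sub_le hA hd0
          _ = _ := by field_simp
    _ = _ := by
        rw [Finset.sum_const, Finset.card_powerset, nsmul_eq_mul]
        push_cast; ring

/-- The number of points `(a, b) ∈ I × J` on the modular hyperbola `a b = c`. -/
def boxCount (Q : ℕ) (c : (ZMod Q)ˣ) (I J : Finset ℕ) : ℕ :=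
  #{x ∈ I ×ˢ J | (x.1 : ZMod Q) * x.2 = c}

lemma boxCount_eq_sum (Q : ℕ) (c : (ZMod Q)ˣ) (I J : Finset ℕ) :
    boxCount Q c I J = ∑ a ∈ I, #(J.filter fun b : ℕ => (a : ZMod Q) * b = c) := by
  rw [boxCount, Finset.card_filter, Finset.sum_product]
  simp only [Finset.card_filter]

/-- The divisor sum over the residue class of `c` modulo `Q`. -/
noncomputable def divisorSum (Q : ℕ) (c : (ZMod Q)ˣ) (X : ℝ) : ℝ :=
  ∑ m ∈ (Icc 1 ⌊X⌋₊).filter (fun m : ℕ => (m : ZMod Q) = c), (#m.divisors : ℝ)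

lemma mem_Icc_floor_div {X : ℝ} (hX : 0 ≤ X) {a b : ℕ} (ha : 0 < a) :
    b ∈ Icc 1 ⌊X / a⌋₊ ↔ 1 ≤ b ∧ (a : ℝ) * b ≤ X := by
  have ha' : (0 : ℝ) < a := by exact_mod_cast ha
  rw [mem_Icc, Nat.le_floor_iff (by positivity), le_div_iff₀ ha', mul_comm]

lemma divisorSum_eq {Q : ℕ} (c : (ZMod Q)ˣ) {X : ℝ} (hX : 0 ≤ X) :
    divisorSum Q c X = 2 * (∑ a ∈ Icc 1 ⌊√X⌋₊,
        (#((Icc 1 ⌊X / a⌋₊).filter fun b : ℕ => (a : ZMod Q) * b = c) : ℝ))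
      - boxCount Q c (Icc 1 ⌊√X⌋₊) (Icc 1 ⌊√X⌋₊) := by
  set s := ⌊√X⌋₊ with hs
  set N := ⌊X⌋₊ with hN
  have mem_s : ∀ a : ℕ, a ≤ s ↔ (a : ℝ) ≤ √X := fun a => Nat.le_floor_iff (Real.sqrt_nonneg X)
  have hsq := Real.mul_self_sqrt hX
  let H : Finset (ℕ × ℕ) := (Icc 1 N ×ˢ Icc 1 N).filter fun x =>
    ((x.1 : ℝ) * x.2 ≤ X) ∧ (x.1 : ZMod Q) * x.2 = c
  have hmemH : ∀ a b : ℕ, (a, b) ∈ H ↔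
      1 ≤ a ∧ 1 ≤ b ∧ (a : ℝ) * b ≤ X ∧ (a : ZMod Q) * b = c := by
    intro a b
    simp only [H, mem_filter, mem_product, mem_Icc, hN, Nat.le_floor_iff hX]
    constructor
    · rintro ⟨⟨⟨h1, _⟩, h2, _⟩, h3, h4⟩
      exact ⟨h1, h2, h3, h4⟩
    · rintro ⟨h1, h2, h3, h4⟩
      have h1' : (1 : ℝ) ≤ a := by exact_mod_cast h1
      have h2' : (1 : ℝ) ≤ b := by exact_mod_cast h2
      exact ⟨⟨⟨h1, by nlinarith⟩, h2, by nlinarith⟩, h3, h4⟩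
  have hD : divisorSum Q c X = #H := by
    rw [divisorSum]
    have hcard : #H = ∑ m ∈ (Icc 1 N).filter (fun m : ℕ => (m : ZMod Q) = c), #m.divisors := by
      rw [← Finset.card_sigma]
      refine Finset.card_bij' (fun x _ => ⟨x.1 * x.2, x.1⟩) (fun y _ => (y.2, y.1 / y.2))
        ?_ ?_ ?_ ?_
      · rintro ⟨a, b⟩ hx
        obtain ⟨h1, h2, h3, h4⟩ := (hmemH a b).mp hx
        simp only [mem_sigma, mem_filter, mem_Icc, hN, Nat.le_floor_iff hX, Nat.mem_divisors]
        push_cast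
        exact ⟨⟨⟨Nat.mul_pos h1 h2, h3⟩, h4⟩, dvd_mul_right _ _, (Nat.mul_pos h1 h2).ne'⟩
      · rintro ⟨m, a⟩ hx
        simp only [mem_sigma, mem_filter, mem_Icc, hN, Nat.le_floor_iff hX,
          Nat.mem_divisors] at hx
        obtain ⟨⟨⟨h1, h2⟩, h3⟩, ⟨b, rfl⟩, h5⟩ := hx
        have ha : 0 < a := Nat.pos_of_mul_pos_right h1
        have hb : 0 < b := Nat.pos_of_mul_pos_left h1
        rw [hmemH, Nat.mul_div_cancel_left _ ha]
        push_cast at h2 h3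
        exact ⟨ha, hb, h2, h3⟩
      · rintro ⟨a, b⟩ hx
        obtain ⟨h1, h2, h3, h4⟩ := (hmemH a b).mp hx
        simp [Nat.mul_div_cancel_left _ h1]
      · rintro ⟨m, a⟩ hx
        simp only [mem_sigma, Nat.mem_divisors] at hx
        simp [Nat.mul_div_cancel' hx.2.1]
    rw [hcard]; push_cast; rfl
  have hleft : (#(H.filter fun x => x.1 ≤ s) : ℝ) = ∑ a ∈ Icc 1 s,
        (#((Icc 1 ⌊X / a⌋₊).filter fun b : ℕ => (a : ZMod Q) * b = c) : ℝ) := by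
    rw [← Nat.cast_sum, ← Finset.card_sigma]
    congr 1
    refine Finset.card_bij' (fun x _ => ⟨x.1, x.2⟩) (fun y _ => (y.1, y.2)) ?_ ?_ ?_ ?_
    · rintro ⟨a, b⟩ hx
      rw [mem_filter, hmemH] at hx
      obtain ⟨⟨h1, h2, h3, h4⟩, h5⟩ := hx
      rw [mem_sigma, mem_filter, mem_Icc, mem_Icc_floor_div hX h1]
      exact ⟨⟨h1, h5⟩, ⟨h2, h3⟩, h4⟩
    · rintro ⟨a, b⟩ hx
      rw [mem_sigma, mem_filter, mem_Icc] at hx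
      obtain ⟨⟨h1, h2⟩, h3, h4⟩ := hx
      rw [mem_Icc_floor_div hX h1] at h3
      rw [mem_filter, hmemH]
      exact ⟨⟨h1, h3.1, h3.2, h4⟩, h2⟩
    · rintro ⟨a, b⟩ _; rfl
    · rintro ⟨a, b⟩ _; rfl
  have hsymm : #(H.filter fun x => x.2 ≤ s) = #(H.filter fun x => x.1 ≤ s) := by
    refine Finset.card_bij' (fun x _ => x.swap) (fun x _ => x.swap) ?_ ?_ ?_ ?_
    · rintro ⟨a, b⟩ hx
      rw [mem_filter, hmemH] at hx
      rw [Prod.swap_prod_mk, mem_filter, hmemH, mul_comm (b : ℝ), mul_comm (b : ZMod Q)]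
      tauto
    · rintro ⟨a, b⟩ hx
      rw [mem_filter, hmemH] at hx
      rw [Prod.swap_prod_mk, mem_filter, hmemH, mul_comm (b : ℝ), mul_comm (b : ZMod Q)]
      tauto
    · rintro ⟨a, b⟩ _; rfl
    · rintro ⟨a, b⟩ _; rfl
  have hunion : (H.filter fun x => x.1 ≤ s) ∪ (H.filter fun x => x.2 ≤ s) = H := by
    rw [← Finset.filter_or, Finset.filter_eq_self]
    rintro ⟨a, b⟩ hx
    obtain ⟨h1, h2, h3, h4⟩ := (hmemH a b).mp hx
    simp only [mem_s]
    by_contra! hcon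
    have := mul_lt_mul'' hcon.1 hcon.2 (Real.sqrt_nonneg X) (Real.sqrt_nonneg X)
    linarith
  have hinter : (H.filter fun x => x.1 ≤ s) ∩ (H.filter fun x => x.2 ≤ s)
      = (Icc 1 s ×ˢ Icc 1 s).filter fun x => (x.1 : ZMod Q) * x.2 = c := by
    ext ⟨a, b⟩
    rw [mem_inter, mem_filter (s := H), mem_filter (s := H), hmemH, mem_filter, mem_product,
      mem_Icc, mem_Icc]
    constructor
    · tauto
    · rintro ⟨⟨⟨h1, h2⟩, h3, h4⟩, h5⟩
      have h2' := (mem_s a).mp h2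
      have h4' := (mem_s b).mp h4
      have : (a : ℝ) * b ≤ X := by
        rw [← hsq]; exact mul_le_mul h2' h4' (by positivity) (by positivity)
      exact ⟨⟨⟨h1, h3, this, h5⟩, h2⟩, ⟨h1, h3, this, h5⟩, h4⟩
  have hcard := Finset.card_union_add_card_inter (H.filter fun x => x.1 ≤ s)
    (H.filter fun x => x.2 ≤ s)
  rw [hunion, hinter, hsymm] at hcard
  have hcard' : (#H : ℝ) + boxCount Q c (Icc 1 s) (Icc 1 s)
      = #(H.filter fun x => x.1 ≤ s) + #(H.filter fun x => x.1 ≤ s) := by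
    have h : #H + boxCount Q c (Icc 1 s) (Icc 1 s) = _ + _ := hcard
    exact_mod_cast h
  rw [hD, ← hleft]
  linarith

/-- The error term in the count of points of a modular hyperbola in a box. -/
noncomputable def boxError (Q : ℕ) (V : ℝ) : ℝ := V * (#(Nat.divisors Q) * (1 + Real.log Q)) ^ 2

lemma abs_boxCount_sub_le {Q : ℕ} [NeZero Q] (c : (ZMod Q)ˣ) {V : ℝ}
    (hV0 : 0 ≤ V) (hV : ∀ h k : ZMod Q, ‖kloosterman Q h k‖ ≤ Nat.gcd h.val Q * V)
    (a₁ a₂ : ℕ) {y : ℝ} (hy : 0 ≤ y) :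
    |(boxCount Q c (Icc a₁ a₂) (Icc 1 ⌊y⌋₊) : ℝ)
        - y / Q * #{a ∈ Icc a₁ a₂ | Nat.Coprime a Q}|
      ≤ #(Icc a₁ a₂) * (2 ^ #Q.primeFactors + 1) / Q + boxError Q V := by
  have hQ : (0 : ℝ) < Q := by exact_mod_cast Nat.pos_of_ne_zero (NeZero.ne Q)
  have h1 := abs_card_box_sub_le a₁ a₂ 1 ⌊y⌋₊ c hV0 hV
  have h2 := abs_card_coprime_sub_le (NeZero.ne Q) ⌊y⌋₊
  rw [← boxCount, Nat.card_Icc 1, Nat.add_sub_cancel] at h1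
  rw [← boxError] at h1
  set I := Icc a₁ a₂
  set T := (#{b ∈ Icc 1 ⌊y⌋₊ | Nat.Coprime b Q} : ℝ) - ⌊y⌋₊ * (Nat.totient Q : ℝ) / Q
  have h3 : |(#I : ℝ) / Q * T| ≤ #I * 2 ^ #Q.primeFactors / Q := by
    rw [abs_mul, abs_of_nonneg (by positivity)]
    calc _ ≤ (#I : ℝ) / Q * 2 ^ #Q.primeFactors := by gcongr
      _ = _ := by ring
  have h4 : |(⌊y⌋₊ : ℝ) / Q * #{a ∈ I | Nat.Coprime a Q} - y / Q * #{a ∈ I | Nat.Coprime a Q}|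
      ≤ #I / Q := by
    rw [← sub_mul, ← sub_div, abs_mul, abs_div, abs_of_pos hQ,
      abs_of_nonneg (a := ((#{a ∈ I | Nat.Coprime a Q} : ℕ) : ℝ)) (by positivity)]
    have h5 := Nat.floor_le hy
    have h6 := Nat.lt_floor_add_one y
    have h7 : |(⌊y⌋₊ : ℝ) - y| ≤ 1 := by rw [abs_le]; constructor <;> linarith
    have h8 : ((#{a ∈ I | Nat.Coprime a Q} : ℕ) : ℝ) ≤ #I := by
      exact_mod_cast Finset.card_filter_le _ _
    calc _ ≤ 1 / (Q : ℝ) * #I := by gcongr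
      _ = _ := by ring
  have h5 : (#I : ℝ) * (2 ^ #Q.primeFactors + 1) / Q
      = #I * 2 ^ #Q.primeFactors / Q + #I / Q := by ring
  rw [h5]
  rw [abs_le] at *
  constructor <;> linarith [h1.1, h1.2, h3.1, h3.2, h4.1, h4.2]

lemma abs_sum_interval_sub_le {Q : ℕ} [NeZero Q] (c : (ZMod Q)ˣ) {V : ℝ}
    (hV0 : 0 ≤ V) (hV : ∀ h k : ZMod Q, ‖kloosterman Q h k‖ ≤ Nat.gcd h.val Q * V)
    {a₁ a₂ : ℕ} (ha₁ : 0 < a₁) (ha : a₁ ≤ a₂) {δ : ℝ} (hδ : (a₂ : ℝ) ≤ a₁ * (1 + δ))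
    {X : ℝ} (hX : 0 ≤ X) :
    |(∑ a ∈ Icc a₁ a₂, (#((Icc 1 ⌊X / a⌋₊).filter fun b : ℕ => (a : ZMod Q) * b = c) : ℝ))
        - X / Q * ∑ a ∈ Icc a₁ a₂ with Nat.Coprime a Q, 1 / (a : ℝ)|
      ≤ X / Q * (δ * ∑ a ∈ Icc a₁ a₂, 1 / (a : ℝ))
        + #(Icc a₁ a₂) * (2 ^ #Q.primeFactors + 1) / Q + boxError Q V := by
  have hQ : (0 : ℝ) < Q := by exact_mod_cast Nat.pos_of_ne_zero (NeZero.ne Q)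
  have ha₁' : (0 : ℝ) < a₁ := by exact_mod_cast ha₁
  have haa : (a₁ : ℝ) ≤ a₂ := by exact_mod_cast ha
  have ha₂' : (0 : ℝ) < a₂ := by linarith
  have hδ0 : 0 ≤ δ := by nlinarith
  have hup := abs_boxCount_sub_le c hV0 hV a₁ a₂ (y := X / a₁) (by positivity)
  have hlo := abs_boxCount_sub_le c hV0 hV a₁ a₂ (y := X / a₂) (by positivity)
  set I := Icc a₁ a₂ with hI
  have hmem : ∀ a ∈ I, (a₁ : ℝ) ≤ a ∧ (a : ℝ) ≤ a₂ := by
    intro a ha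
    rw [hI, mem_Icc] at ha
    exact ⟨by exact_mod_cast ha.1, by exact_mod_cast ha.2⟩
  have h1 : (∑ a ∈ I, (#((Icc 1 ⌊X / a⌋₊).filter fun b : ℕ => (a : ZMod Q) * b = c) : ℝ))
      ≤ boxCount Q c I (Icc 1 ⌊X / a₁⌋₊) := by
    rw [boxCount_eq_sum]
    push_cast
    refine Finset.sum_le_sum fun a ha => ?_
    gcongr
    exact (mem_Icc.mp ha).1
  have h2 : (boxCount Q c I (Icc 1 ⌊X / a₂⌋₊) : ℝ)
      ≤ ∑ a ∈ I, (#((Icc 1 ⌊X / a⌋₊).filter fun b : ℕ => (a : ZMod Q) * b = c) : ℝ) := by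
    rw [boxCount_eq_sum]
    push_cast
    refine Finset.sum_le_sum fun a ha => ?_
    have := hmem a ha
    have : (0 : ℝ) < a := by linarith
    gcongr
    exact (mem_Icc.mp ha).2
  have hsub : ∑ a ∈ I with Nat.Coprime a Q, 1 / (a : ℝ) ≤ ∑ a ∈ I, 1 / (a : ℝ) :=
    Finset.sum_le_sum_of_subset_of_nonneg (Finset.filter_subset _ _) fun _ _ _ => by positivity
  have h3 : X / a₁ / Q * #{a ∈ I | Nat.Coprime a Q}
      ≤ X / Q * ((1 + δ) * ∑ a ∈ I with Nat.Coprime a Q, 1 / (a : ℝ)) := by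
    rw [show X / a₁ / Q * (#{a ∈ I | Nat.Coprime a Q} : ℝ)
      = X / Q * (#{a ∈ I | Nat.Coprime a Q} * (1 / a₁)) by ring]
    refine mul_le_mul_of_nonneg_left ?_ (by positivity)
    rw [← nsmul_eq_mul, ← Finset.sum_const, Finset.mul_sum]
    refine Finset.sum_le_sum fun a ha => ?_
    have := hmem a (mem_filter.mp ha).1
    have ha0 : (0 : ℝ) < a := by linarith
    rw [mul_one_div, div_le_div_iff₀ ha₁' ha0]
    linarith
  have h4 : X / Q * ((1 - δ) * ∑ a ∈ I with Nat.Coprime a Q, 1 / (a : ℝ))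
      ≤ X / a₂ / Q * #{a ∈ I | Nat.Coprime a Q} := by
    rw [show X / a₂ / Q * (#{a ∈ I | Nat.Coprime a Q} : ℝ)
      = X / Q * (#{a ∈ I | Nat.Coprime a Q} * (1 / a₂)) by ring]
    refine mul_le_mul_of_nonneg_left ?_ (by positivity)
    rw [← nsmul_eq_mul, ← Finset.sum_const, Finset.mul_sum]
    refine Finset.sum_le_sum fun a ha => ?_
    have := hmem a (mem_filter.mp ha).1
    have ha0 : (0 : ℝ) < a := by linarith
    rw [mul_one_div, div_le_div_iff₀ ha0 ha₂']
    rcases le_total δ 1 with hd | hd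
    · nlinarith [mul_nonneg (sub_nonneg.mpr hd) (sub_nonneg.mpr hδ), mul_nonneg hδ0 hδ0]
    · nlinarith
  have h5 : X / Q * (δ * ∑ a ∈ I with Nat.Coprime a Q, 1 / (a : ℝ))
      ≤ X / Q * (δ * ∑ a ∈ I, 1 / (a : ℝ)) := by gcongr
  set S := ∑ a ∈ I with Nat.Coprime a Q, 1 / (a : ℝ)
  have e1 : X / Q * ((1 + δ) * S) = X / Q * S + X / Q * (δ * S) := by ring
  have e2 : X / Q * ((1 - δ) * S) = X / Q * S - X / Q * (δ * S) := by ring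
  rw [e1] at h3
  rw [e2] at h4
  rw [abs_le] at *
  constructor <;> linarith [hup.1, hup.2, hlo.1, hlo.2]

/-- A level set of `a ↦ ⌊K log a⌋` in `[1, s]`. -/
noncomputable def logFiber (K s j : ℕ) : Finset ℕ :=
  (Icc 1 s).filter fun a : ℕ => ⌊(K : ℝ) * Real.log a⌋₊ = j

lemma floor_log_mono {K a b : ℕ} (ha : 0 < a) (h : a ≤ b) :
    ⌊(K : ℝ) * Real.log a⌋₊ ≤ ⌊(K : ℝ) * Real.log b⌋₊ := by
  have ha' : (0 : ℝ) < a := by exact_mod_cast ha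
  have h' : (a : ℝ) ≤ b := by exact_mod_cast h
  exact Nat.floor_mono (mul_le_mul_of_nonneg_left (Real.log_le_log ha' h') (by positivity))

lemma logFiber_eq_Icc {K s j : ℕ} (hK : 0 < K) (h : (logFiber K s j).Nonempty) :
    ∃ a₁ a₂ : ℕ, 0 < a₁ ∧ a₁ ≤ a₂ ∧ (a₂ : ℝ) ≤ a₁ * (1 + 2 / K) ∧
      logFiber K s j = Icc a₁ a₂ := by
  have hmin := Finset.min'_mem _ h
  have hmax := Finset.max'_mem _ h
  have hle := Finset.min'_le _ _ hmax
  have hK' : (0 : ℝ) < K := by exact_mod_cast hK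
  have hK1 : (1 : ℝ) ≤ K := by exact_mod_cast hK
  refine ⟨(logFiber K s j).min' h, (logFiber K s j).max' h, ?_, hle, ?_, ?_⟩
  · exact (mem_Icc.mp (mem_filter.mp hmin).1).1
  · generalize (logFiber K s j).min' h = x at *
    generalize (logFiber K s j).max' h = y at *
    rw [logFiber, mem_filter, mem_Icc] at hmin hmax
    have hx : (0 : ℝ) < x := by exact_mod_cast hmin.1.1
    have hy : (0 : ℝ) < y := by exact_mod_cast hmax.1.1
    have h1 := Nat.floor_le (a := (K : ℝ) * Real.log x)
      (mul_nonneg hK'.le (Real.log_natCast_nonneg x))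
    have h2 := Nat.lt_floor_add_one ((K : ℝ) * Real.log y)
    rw [hmin.2] at h1
    rw [hmax.2] at h2
    have h3 : Real.log y - Real.log x ≤ 1 / K := by
      rw [le_div_iff₀ hK']; nlinarith
    have h4 : (y : ℝ) ≤ x * Real.exp (1 / K) := by
      rw [← Real.log_le_log_iff hy (by positivity), Real.log_mul hx.ne' (Real.exp_ne_zero _),
        Real.log_exp]
      linarith
    have h5 : |(1 / K : ℝ)| ≤ 1 := by
      rw [abs_of_pos (by positivity)]
      exact (div_le_one hK').mpr hK1
    have h6 := (abs_le.mp (Real.abs_exp_sub_one_le h5)).2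
    rw [abs_of_pos (by positivity)] at h6
    have h7 : Real.exp (1 / K) ≤ 1 + 2 / K := by
      have : (2 : ℝ) * (1 / K) = 2 / K := by ring
      linarith
    exact h4.trans (mul_le_mul_of_nonneg_left h7 hx.le)
  · ext a
    rw [mem_Icc]
    constructor
    · exact fun ha => ⟨Finset.min'_le _ _ ha, Finset.le_max' _ _ ha⟩
    · rintro ⟨h1, h2⟩
      generalize (logFiber K s j).min' h = x at *
      generalize (logFiber K s j).max' h = y at *
      rw [logFiber, mem_filter, mem_Icc] at hmin hmax ⊢
      have ha : 0 < a := by omega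
      refine ⟨⟨ha, by omega⟩, le_antisymm ?_ ?_⟩
      · exact (floor_log_mono ha h2).trans_eq hmax.2
      · exact hmin.2.symm.le.trans (floor_log_mono (by omega) h1)

lemma sum_logFiber (K s : ℕ) (f : ℕ → ℝ) :
    ∑ j ∈ range (⌊(K : ℝ) * Real.log s⌋₊ + 1), ∑ a ∈ logFiber K s j, f a = ∑ a ∈ Icc 1 s, f a := by
  refine Finset.sum_fiberwise_of_maps_to (fun a ha => ?_) f
  rw [mem_Icc] at ha
  rw [mem_range]
  exact Nat.lt_succ_of_le (floor_log_mono ha.1 ha.2)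

lemma abs_sum_fibers_sub_le {Q : ℕ} [NeZero Q] (c : (ZMod Q)ˣ) {V : ℝ}
    (hV0 : 0 ≤ V) (hV : ∀ h k : ZMod Q, ‖kloosterman Q h k‖ ≤ Nat.gcd h.val Q * V)
    {K : ℕ} (hK : 0 < K) (s : ℕ) {X : ℝ} (hX : 0 ≤ X) :
    |(∑ a ∈ Icc 1 s, (#((Icc 1 ⌊X / a⌋₊).filter fun b : ℕ => (a : ZMod Q) * b = c) : ℝ))
        - X / Q * ∑ a ∈ Icc 1 s with Nat.Coprime a Q, 1 / (a : ℝ)|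
      ≤ X / Q * (2 / K * ∑ a ∈ Icc 1 s, 1 / (a : ℝ))
        + s * (2 ^ #Q.primeFactors + 1) / Q + (K * Real.log s + 1) * boxError Q V := by
  have hB : 0 ≤ boxError Q V := mul_nonneg hV0 (sq_nonneg _)
  set J := range (⌊(K : ℝ) * Real.log s⌋₊ + 1) with hJ
  have hfib : ∀ j ∈ J,
      |(∑ a ∈ logFiber K s j,
          (#((Icc 1 ⌊X / a⌋₊).filter fun b : ℕ => (a : ZMod Q) * b = c) : ℝ))
        - X / Q * ∑ a ∈ logFiber K s j, if Nat.Coprime a Q then 1 / (a : ℝ) else 0|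
      ≤ X / Q * (2 / K * ∑ a ∈ logFiber K s j, 1 / (a : ℝ))
        + (∑ a ∈ logFiber K s j, (1 : ℝ)) * (2 ^ #Q.primeFactors + 1) / Q + boxError Q V := by
    intro j _
    rcases (logFiber K s j).eq_empty_or_nonempty with h | h
    · simp [h, hB]
    · obtain ⟨a₁, a₂, h1, h2, h3, h4⟩ := logFiber_eq_Icc hK h
      have := abs_sum_interval_sub_le c hV0 hV h1 h2 h3 hX
      rw [h4, ← Finset.sum_filter, Finset.sum_const, nsmul_eq_mul, mul_one]
      exact this
  have hsum := (Finset.abs_sum_le_sum_abs _ _).trans (Finset.sum_le_sum hfib)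
  rw [Finset.sum_sub_distrib, ← Finset.mul_sum, Finset.sum_add_distrib, Finset.sum_add_distrib,
    ← Finset.mul_sum, ← Finset.mul_sum, ← Finset.sum_div, ← Finset.sum_mul, Finset.sum_const,
    nsmul_eq_mul, hJ, sum_logFiber, sum_logFiber, sum_logFiber, sum_logFiber, Finset.card_range,
    Finset.sum_const, Nat.card_Icc, nsmul_eq_mul, ← Finset.sum_filter] at hsum
  refine hsum.trans ?_
  have h1 := Nat.floor_le (a := (K : ℝ) * Real.log s)
    (mul_nonneg (by positivity) (Real.log_natCast_nonneg s))
  have h2 : ((⌊(K : ℝ) * Real.log s⌋₊ + 1 : ℕ) : ℝ) * boxError Q V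
      ≤ (K * Real.log s + 1) * boxError Q V := by
    refine mul_le_mul_of_nonneg_right ?_ hB
    push_cast; linarith
  simp only [Nat.add_sub_cancel, mul_one]
  linarith

lemma abs_boxCount_square_sub_le {Q : ℕ} [NeZero Q] (c : (ZMod Q)ˣ) {V : ℝ}
    (hV0 : 0 ≤ V) (hV : ∀ h k : ZMod Q, ‖kloosterman Q h k‖ ≤ Nat.gcd h.val Q * V) (s : ℕ) :
    |(boxCount Q c (Icc 1 s) (Icc 1 s) : ℝ) - (s : ℝ) ^ 2 * Nat.totient Q / (Q : ℝ) ^ 2|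
      ≤ s * (2 * 2 ^ #Q.primeFactors + 1) / Q + boxError Q V := by
  have hQ : (0 : ℝ) < Q := by exact_mod_cast Nat.pos_of_ne_zero (NeZero.ne Q)
  have h1 := abs_boxCount_sub_le c hV0 hV 1 s (y := s) (by positivity)
  have h2 := abs_card_coprime_sub_le (NeZero.ne Q) s
  rw [Nat.floor_natCast, Nat.card_Icc, Nat.add_sub_cancel] at h1
  have h3 : |(s : ℝ) / Q * (#{a ∈ Icc 1 s | Nat.Coprime a Q} - s * (Nat.totient Q : ℝ) / Q)|
      ≤ s / Q * 2 ^ #Q.primeFactors := by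
    rw [abs_mul, abs_of_nonneg (by positivity)]
    exact mul_le_mul_of_nonneg_left h2 (by positivity)
  have e1 : (s : ℝ) / Q * (#{a ∈ Icc 1 s | Nat.Coprime a Q} - s * (Nat.totient Q : ℝ) / Q)
      = s / Q * #{a ∈ Icc 1 s | Nat.Coprime a Q} - (s : ℝ) ^ 2 * Nat.totient Q / (Q : ℝ) ^ 2 := by
    field_simp
  have e2 : (s : ℝ) * (2 * 2 ^ #Q.primeFactors + 1) / Q
      = s * (2 ^ #Q.primeFactors + 1) / Q + s / Q * 2 ^ #Q.primeFactors := by ring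
  rw [e1] at h3
  rw [e2]
  rw [abs_le] at *
  constructor <;> linarith [h1.1, h1.2, h3.1, h3.2]

/-- The main term of the divisor sum in a reduced residue class. -/
noncomputable def divisorMain (Q : ℕ) (X : ℝ) : ℝ :=
  X * (Nat.totient Q / (Q : ℝ) ^ 2)
    * (Real.log X + 2 * Real.eulerMascheroniConstant - 1 + 2 * logSum Q)

lemma logSum_nonneg (Q : ℕ) : 0 ≤ logSum Q := by
  refine Finset.sum_nonneg fun p hp => ?_
  have : (2 : ℝ) ≤ p := by exact_mod_cast (Nat.prime_of_mem_primeFactors hp).two_le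
  exact div_nonneg (Real.log_natCast_nonneg p) (by linarith)

lemma logSum_le_card (Q : ℕ) : logSum Q ≤ #Q.primeFactors := by
  rw [logSum, Finset.card_eq_sum_ones]
  push_cast
  refine Finset.sum_le_sum fun p hp => ?_
  have h2 : (2 : ℝ) ≤ p := by exact_mod_cast (Nat.prime_of_mem_primeFactors hp).two_le
  rw [div_le_one (by linarith)]
  exact Real.log_le_sub_one_of_pos (by linarith)

lemma totient_div_sq_le {Q : ℕ} (hQ : Q ≠ 0) : (Nat.totient Q / (Q : ℝ) ^ 2) ≤ 1 / Q := by
  have hQ : (0 : ℝ) < Q := by exact_mod_cast Nat.pos_of_ne_zero hQ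
  have : (Nat.totient Q : ℝ) ≤ Q := by exact_mod_cast Nat.totient_le Q
  rw [div_le_div_iff₀ (by positivity) hQ]
  nlinarith

lemma abs_divisorMain_le_of_lt_one {Q : ℕ} (hQ : Q ≠ 0) {X : ℝ} (hX : 0 < X) (hX1 : X < 1) :
    |divisorMain Q X| ≤ 30 * (2 ^ #Q.primeFactors * √X / Q) := by
  have hQ' : (0 : ℝ) < Q := by exact_mod_cast Nat.pos_of_ne_zero hQ
  have hs : 0 < √X := Real.sqrt_pos.mpr hX
  have hss := Real.mul_self_sqrt hX.le
  have hs1 : √X ≤ 1 := Real.sqrt_le_one.mpr hX1.le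
  have hlog : Real.log X = 2 * Real.log √X := by rw [Real.log_sqrt hX.le]; ring
  have h1 : -Real.log √X ≤ 1 / √X - 1 := by
    rw [← Real.log_inv, ← one_div]; exact Real.log_le_sub_one_of_pos (by positivity)
  have h2 : Real.log √X ≤ 0 := Real.log_nonpos hs.le hs1
  have hγ := Real.one_half_lt_eulerMascheroniConstant
  have hγ' := Real.eulerMascheroniConstant_lt_two_thirds
  have h3 := logSum_nonneg Q
  have h4 := logSum_le_card Q
  have h5 : (#Q.primeFactors : ℝ) < 2 ^ #Q.primeFactors := by exact_mod_cast Nat.lt_two_pow_self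
  have h6 : (1 : ℝ) ≤ 2 ^ #Q.primeFactors := one_le_pow₀ (by norm_num)
  set P : ℝ := 2 ^ #Q.primeFactors
  have h7 : √X * |Real.log X + 2 * Real.eulerMascheroniConstant - 1 + 2 * logSum Q| ≤ 30 * P := by
    have h8 : |Real.log X + 2 * Real.eulerMascheroniConstant - 1 + 2 * logSum Q|
        ≤ 2 / √X + 1 + 2 * P := by
      have : 2 / √X = 2 * (1 / √X) := by ring
      rw [abs_le]
      constructor <;> linarith
    calc _ ≤ √X * (2 / √X + 1 + 2 * P) := mul_le_mul_of_nonneg_left h8 hs.le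
      _ = 2 + √X * (1 + 2 * P) := by field_simp; ring
      _ ≤ 2 + 1 * (1 + 2 * P) := by
        have := mul_le_mul_of_nonneg_right hs1 (show 0 ≤ 1 + 2 * P by linarith)
        linarith
      _ ≤ 30 * P := by linarith
  rw [divisorMain, abs_mul, abs_of_nonneg (by positivity)]
  calc _ ≤ X * (1 / Q) * |Real.log X + 2 * Real.eulerMascheroniConstant - 1 + 2 * logSum Q| := by
        refine mul_le_mul_of_nonneg_right ?_ (abs_nonneg _)
        exact mul_le_mul_of_nonneg_left (totient_div_sq_le hQ) hX.le
    _ = √X / Q * (√X * |Real.log X + 2 * Real.eulerMascheroniConstant - 1 + 2 * logSum Q|) := by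
        rw [← hss, Real.sqrt_mul_self hs.le]; ring
    _ ≤ √X / Q * (30 * P) := mul_le_mul_of_nonneg_left h7 (by positivity)
    _ = _ := by ring

set_option maxHeartbeats 800000 in
lemma abs_divisorSum_sub_le_of_one_le {Q : ℕ} [NeZero Q] (c : (ZMod Q)ˣ) {V : ℝ}
    (hV0 : 0 ≤ V) (hV : ∀ h k : ZMod Q, ‖kloosterman Q h k‖ ≤ Nat.gcd h.val Q * V)
    {K : ℕ} (hK : 0 < K) {X : ℝ} (hX : 1 ≤ X) :
    |divisorSum Q c X - divisorMain Q X|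
      ≤ 30 * (2 ^ #Q.primeFactors * √X / Q) + 4 * X / (K * Q) * (1 + Real.log X)
        + (K * Real.log X + 3) * boxError Q V := by
  have hQ : (0 : ℝ) < Q := by exact_mod_cast Nat.pos_of_ne_zero (NeZero.ne Q)
  have hK' : (0 : ℝ) < K := by exact_mod_cast hK
  have hB : 0 ≤ boxError Q V := mul_nonneg hV0 (sq_nonneg _)
  have hX0 : 0 ≤ X := by linarith
  have hss := Real.mul_self_sqrt hX0
  have hs1 : 1 ≤ √X := Real.one_le_sqrt.mpr hX
  have hsle := Nat.floor_le (Real.sqrt_nonneg X)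
  have hslt := Nat.lt_floor_add_one √X
  have hspos : 0 < ⌊√X⌋₊ := Nat.floor_pos.mpr hs1
  have h1 := abs_sum_fibers_sub_le c hV0 hV hK ⌊√X⌋₊ hX0
  have h2 := abs_boxCount_square_sub_le c hV0 hV ⌊√X⌋₊
  have h3 := abs_sum_coprime_inv_sub_le (NeZero.ne Q) hspos
  have hlogX : Real.log X = 2 * Real.log √X := by rw [Real.log_sqrt hX0]; ring
  rw [divisorSum_eq c hX0, divisorMain]
  set s := ⌊√X⌋₊
  set x := √X
  have hs1' : (1 : ℝ) ≤ s := by exact_mod_cast hspos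
  have hsx : x ≤ 2 * s := by linarith
  have hlog1 : Real.log s ≤ Real.log x := Real.log_le_log (by linarith) hsle
  have hlog2 : Real.log x - Real.log s ≤ 2 / x := by
    rw [← Real.log_div (by positivity) (by positivity)]
    refine (Real.log_le_sub_one_of_pos (by positivity)).trans ?_
    rw [div_sub_one (by positivity), div_le_div_iff₀ (by positivity) (by positivity)]
    nlinarith
  have hlogs : 0 ≤ Real.log s := Real.log_natCast_nonneg s
  have hH : ∑ a ∈ Icc 1 s, 1 / (a : ℝ) ≤ 1 + Real.log s := by
    have := harmonic_le_one_add_log s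
    rw [harmonic_eq_sum_Icc] at this
    push_cast at this
    simpa [one_div] using this
  set P : ℝ := 2 ^ #Q.primeFactors with hP
  have hP1 : (1 : ℝ) ≤ P := one_le_pow₀ (by norm_num)
  set r : ℝ := (Nat.totient Q : ℝ) / Q with hr
  have hr0 : 0 ≤ r := by positivity
  have hr1 : r ≤ 1 := by
    rw [hr, div_le_one hQ]; exact_mod_cast Nat.totient_le Q
  have hr' : (Nat.totient Q : ℝ) / (Q : ℝ) ^ 2 = r / Q := by rw [hr]; field_simp
  set T := ∑ a ∈ Icc 1 s with Nat.Coprime a Q, 1 / (a : ℝ)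
  set S := ∑ a ∈ Icc 1 s, (#((Icc 1 ⌊X / a⌋₊).filter fun b : ℕ => (a : ZMod Q) * b = c) : ℝ)
  set g := Real.eulerMascheroniConstant
  -- the error in the harmonic sum
  have h4 : |T - r * (Real.log x + g + logSum Q)| ≤ 8 * P / x + 2 / x := by
    have e : 4 * P / s ≤ 8 * P / x := by
      rw [div_le_div_iff₀ (by linarith) (by linarith)]; nlinarith
    have h5 : r * (Real.log x - Real.log s) ≤ 1 * (2 / x) :=
      mul_le_mul hr1 hlog2 (by linarith) (by norm_num)
    have h6 : 0 ≤ r * (Real.log x - Real.log s) := mul_nonneg hr0 (by linarith)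
    have e2 : r * (Real.log x + g + logSum Q) = r * (Real.log s + g + logSum Q)
      + r * (Real.log x - Real.log s) := by ring
    rw [e2]
    rw [abs_le] at *
    constructor <;> linarith [h3.1, h3.2]
  have h5 : |X / Q * (T - r * (Real.log x + g + logSum Q))| ≤ x / Q * (8 * P + 2) := by
    rw [abs_mul, abs_of_nonneg (by positivity)]
    calc _ ≤ X / Q * (8 * P / x + 2 / x) := mul_le_mul_of_nonneg_left h4 (by positivity)
      _ = x / Q * (8 * P + 2) := by rw [← hss]; field_simp
  have h6 : |(s : ℝ) ^ 2 * r / Q - X * r / Q| ≤ 2 * x / Q := by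
    rw [← sub_div, ← sub_mul, abs_div, abs_mul, abs_of_nonneg hr0, abs_of_pos hQ]
    refine div_le_div_of_nonneg_right ?_ hQ.le
    have : |(s : ℝ) ^ 2 - X| ≤ 2 * x := by
      rw [abs_le, ← hss]; constructor <;> nlinarith
    calc _ ≤ 2 * x * 1 := mul_le_mul this hr1 hr0 (by linarith)
      _ = 2 * x := mul_one _
  have e1 : (s : ℝ) ^ 2 * Nat.totient Q / (Q : ℝ) ^ 2 = (s : ℝ) ^ 2 * r / Q := by
    rw [mul_div_assoc, hr']; ring
  rw [e1] at h2
  have h7 : X / Q * (2 / K * ∑ a ∈ Icc 1 s, 1 / (a : ℝ)) ≤ 2 * X / (K * Q) * (1 + Real.log X) := by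
    calc _ ≤ X / Q * (2 / K * (1 + Real.log X)) := by
          refine mul_le_mul_of_nonneg_left ?_ (by positivity)
          refine mul_le_mul_of_nonneg_left ?_ (by positivity)
          linarith
      _ = _ := by field_simp
  have h8 : (K * Real.log s + 1) * boxError Q V ≤ (K * Real.log X / 2 + 1) * boxError Q V := by
    refine mul_le_mul_of_nonneg_right ?_ hB
    have := mul_le_mul_of_nonneg_left hlog1 hK'.le
    rw [hlogX]; linarith
  have h9 : (s : ℝ) * (P + 1) / Q ≤ 2 * (P * x / Q) := by
    rw [← mul_div_assoc]
    refine div_le_div_of_nonneg_right ?_ hQ.le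
    nlinarith
  have h10 : (s : ℝ) * (2 * P + 1) / Q ≤ 3 * (P * x / Q) := by
    rw [← mul_div_assoc]
    refine div_le_div_of_nonneg_right ?_ hQ.le
    nlinarith
  have h11 : x / Q * (8 * P + 2) ≤ 10 * (P * x / Q) := by
    rw [← mul_div_assoc, div_mul_eq_mul_div]
    refine div_le_div_of_nonneg_right ?_ hQ.le
    nlinarith
  have h12 : 2 * x / Q ≤ 2 * (P * x / Q) := by
    rw [← mul_div_assoc]
    refine div_le_div_of_nonneg_right ?_ hQ.le
    nlinarith
  have h13 : 0 ≤ P * x / Q := by positivity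
  have e2 : X * (Nat.totient Q / (Q : ℝ) ^ 2) * (Real.log X + 2 * g - 1 + 2 * logSum Q)
      = 2 * (X / Q * T) - 2 * (X / Q * (T - r * (Real.log x + g + logSum Q))) - X * r / Q := by
    rw [hr', hlogX]; ring
  have e3 : 4 * X / (K * Q) * (1 + Real.log X) = 2 * (2 * X / (K * Q) * (1 + Real.log X)) := by ring
  have e4 : (K * Real.log X + 3) * boxError Q V
      = 2 * ((K * Real.log X / 2 + 1) * boxError Q V) + boxError Q V := by ring
  rw [e2, e3, e4]
  generalize X / Q * (T - r * (Real.log x + g + logSum Q)) = u at *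
  generalize X / Q * T = v at *
  generalize X / Q * (2 / K * ∑ a ∈ Icc 1 s, 1 / (a : ℝ)) = w at *
  rw [abs_le] at *
  constructor <;> linarith [h1.1, h1.2, h2.1, h2.2, h5.1, h5.2, h6.1, h6.2]

/-- The divisor function in a reduced residue class, with an error term controlled by a bound `V`
for the complete Kloosterman sums. -/
lemma abs_divisorSum_sub_le {Q : ℕ} [NeZero Q] (c : (ZMod Q)ˣ) {V : ℝ}
    (hV0 : 0 ≤ V) (hV : ∀ h k : ZMod Q, ‖kloosterman Q h k‖ ≤ Nat.gcd h.val Q * V)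
    {K : ℕ} (hK : 0 < K) {X : ℝ} (hX : 0 < X) {l : ℝ} (hl : 0 ≤ l) (hXl : Real.log X ≤ l) :
    |divisorSum Q c X - divisorMain Q X|
      ≤ 30 * (2 ^ #Q.primeFactors * √X / Q) + 4 * X / (K * Q) * (1 + l)
        + (K * l + 3) * boxError Q V := by
  have hB : 0 ≤ boxError Q V := mul_nonneg hV0 (sq_nonneg _)
  rcases lt_or_ge X 1 with h | h
  · have h1 := abs_divisorMain_le_of_lt_one (NeZero.ne Q) hX h
    have h2 : divisorSum Q c X = 0 := by
      simp [divisorSum, Nat.floor_eq_zero.mpr h]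
    rw [h2, zero_sub, abs_neg]
    have h3 : 0 ≤ 4 * X / (K * Q) * (1 + l) := by positivity
    have h4 : 0 ≤ (K * l + 3) * boxError Q V := by positivity
    linarith
  · refine (abs_divisorSum_sub_le_of_one_le c hV0 hV hK h).trans ?_
    have h3 : 4 * X / (K * Q) * (1 + Real.log X) ≤ 4 * X / (K * Q) * (1 + l) :=
      mul_le_mul_of_nonneg_left (by linarith) (by positivity)
    have h4 : (K * Real.log X + 3) * boxError Q V ≤ (K * l + 3) * boxError Q V := by
      refine mul_le_mul_of_nonneg_right ?_ hB
      have := mul_le_mul_of_nonneg_left hXl (Nat.cast_nonneg (α := ℝ) K)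
      linarith
    linarith

lemma exists_pow_card_le (c n : ℕ) (hc : 0 < c) (hn : 0 < n) :
    ∃ C : ℕ, 0 < C ∧ ∀ (t : ℕ) (F : Finset ℕ), (∀ p ∈ F, 0 < p) → ∏ p ∈ F, p ≤ t ^ n →
      c ^ #F ≤ C * t := by
  refine ⟨c ^ (c ^ n), by positivity, fun t F hF h => ?_⟩
  have hsplit : #F = #(F.filter (· < c ^ n)) + #(F.filter (¬ · < c ^ n)) :=
    (Finset.card_filter_add_card_filter_not _).symm
  rw [hsplit, pow_add]
  refine Nat.mul_le_mul (Nat.pow_le_pow_right hc ?_) ?_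
  · calc #(F.filter (· < c ^ n)) ≤ #(range (c ^ n)) :=
        Finset.card_le_card fun x hx => mem_range.mpr (mem_filter.mp hx).2
      _ = _ := card_range _
  · refine le_of_pow_le_pow_left₀ hn.ne' (Nat.zero_le _) ?_
    calc (c ^ #(F.filter (¬ · < c ^ n))) ^ n = ∏ _p ∈ F.filter (¬ · < c ^ n), c ^ n := by
          rw [Finset.prod_const, ← pow_mul, ← pow_mul, mul_comm]
      _ ≤ ∏ p ∈ F.filter (¬ · < c ^ n), p :=
          Finset.prod_le_prod' fun p hp => not_lt.mp (mem_filter.mp hp).2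
      _ ≤ ∏ p ∈ F, p :=
          Finset.prod_le_prod_of_subset_of_one_le' (Finset.filter_subset _ _) fun p hp _ => hF p hp
      _ ≤ t ^ n := h

lemma card_divisors_mul_le (m n : ℕ) :
    #(Nat.divisors (m * n)) ≤ #(Nat.divisors m) * #(Nat.divisors n) := by
  rw [Nat.divisors_mul]
  exact Finset.card_mul_le

lemma card_divisors_prod_le {F : Finset ℕ} (hF : ∀ p ∈ F, p.Prime) :
    #(Nat.divisors (∏ p ∈ F, p)) ≤ 2 ^ #F := by
  induction F using Finset.induction_on with
  | empty => simp
  | insert a s ha ih =>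
    rw [Finset.prod_insert ha, Finset.card_insert_of_notMem ha, pow_succ']
    refine (card_divisors_mul_le _ _).trans (Nat.mul_le_mul ?_ (ih fun p hp =>
      hF p (mem_insert_of_mem hp)))
    rw [(hF a (mem_insert_self a s)).divisors, Finset.card_pair (hF a (mem_insert_self a s)).one_lt.ne]

lemma primeFactors_prod_primes {F : Finset ℕ} (hF : ∀ p ∈ F, p.Prime) :
    (∏ p ∈ F, p).primeFactors = F := Nat.primeFactors_prod hF

lemma prod_le_two_pow_mul_totient {F : Finset ℕ} (hF : ∀ p ∈ F, p.Prime) :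
    ∏ p ∈ F, p ≤ 2 ^ #F * Nat.totient (∏ p ∈ F, p) := by
  induction F using Finset.induction_on with
  | empty => simp
  | insert a s ha ih =>
    have hF' : ∀ p ∈ s, p.Prime := fun p hp => hF p (mem_insert_of_mem hp)
    have hpa := hF a (mem_insert_self a s)
    rw [Finset.prod_insert ha, Finset.card_insert_of_notMem ha, Nat.totient_mul, pow_succ',
      Nat.totient_prime hpa]
    · have h2 := hpa.two_le
      have h3 : a ≤ 2 * (a - 1) := by omega
      calc a * ∏ p ∈ s, p ≤ (2 * (a - 1)) * (2 ^ #s * Nat.totient (∏ p ∈ s, p)) :=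
            Nat.mul_le_mul h3 (ih hF')
        _ = _ := by ring
    · refine Nat.Coprime.prod_right fun p hp => ?_
      exact (Nat.coprime_primes hpa (hF' p hp)).mpr fun h => ha (h ▸ hp)

lemma exists_norm_kloosterman_le {q e : ℕ} (hq : 0 < q) (he : 0 < e) :
    ∃ D : ℕ, 0 < D ∧ ∀ (t : ℕ) (F : Finset ℕ), (∀ p ∈ F, p.Prime ∧ Nat.Coprime q p) →
      ∏ p ∈ F, p ≤ t ^ (200 * e) → ∀ (Q : ℕ) [NeZero Q], Q = q * ∏ p ∈ F, p → ∀ h k : ZMod Q,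
      ‖kloosterman Q h k‖ ≤ Nat.gcd h.val Q * ((D * t ^ (150 * e + 1) : ℕ) : ℝ) := by
  obtain ⟨C, hC, hpow⟩ := exists_pow_card_le 6 (200 * e) (by norm_num) (by omega)
  refine ⟨C * q ^ 2, by positivity, fun t F hF hf Q _ hQ h k => ?_⟩
  have h1 := totient_mul_norm_kloosterman_pow_four_le h k
  have h2 := card_momentSet_le hq F hF Q hQ
  have h3 := prod_le_two_pow_mul_totient fun p hp => (hF p hp).1
  have h4 := hpow t F (fun p hp => (hF p hp).1.pos) hf
  set f := ∏ p ∈ F, p with hfdef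
  have hcop : Nat.Coprime q f := Nat.Coprime.prod_right fun p hp => (hF p hp).2
  have hφ : Q ≤ q * 2 ^ #F * Nat.totient Q := by
    rw [hQ, Nat.totient_mul hcop]
    calc q * f ≤ q * (2 ^ #F * Nat.totient f) := Nat.mul_le_mul_left _ h3
      _ ≤ q * (2 ^ #F * Nat.totient f) * Nat.totient q :=
        Nat.le_mul_of_pos_right _ (Nat.totient_pos.mpr hq)
      _ = _ := by ring
  have hQpos : 0 < Q := Nat.pos_of_ne_zero (NeZero.ne Q)
  have hφpos : (0 : ℝ) < Nat.totient Q := by exact_mod_cast Nat.totient_pos.mpr hQpos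
  set g := Nat.gcd h.val Q with hg
  have hgpos : 0 < g := Nat.gcd_pos_of_pos_right _ hQpos
  have hfour : ‖kloosterman Q h k‖ ^ 4 ≤ ((g * (C * q ^ 2 * t ^ (150 * e + 1)) : ℕ) : ℝ) ^ 4 := by
    refine le_of_mul_le_mul_left (h1.trans ?_) hφpos
    have : g * (Q ^ 2 * #(momentSet (ZMod Q)))
        ≤ Nat.totient Q * (g * (C * q ^ 2 * t ^ (150 * e + 1))) ^ 4 := by
      calc g * (Q ^ 2 * #(momentSet (ZMod Q)))
          ≤ g * (Q * (q * 2 ^ #F * Nat.totient Q) * (q ^ 4 * 3 ^ #F * f ^ 2)) := by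
            rw [pow_two Q]
            exact Nat.mul_le_mul_left _ (Nat.mul_le_mul (Nat.mul_le_mul_left _ hφ) h2)
        _ = Nat.totient Q * (g * (6 ^ #F * (q ^ 6 * f ^ 3))) := by
            rw [hQ, show (6 : ℕ) = 2 * 3 by norm_num, mul_pow]; ring
        _ ≤ Nat.totient Q * (g * ((C * t) * (q ^ 6 * (t ^ (200 * e)) ^ 3))) := by gcongr
        _ ≤ Nat.totient Q * (g ^ 4 * ((C * t) ^ 4 * (q ^ 8 * (t ^ (150 * e)) ^ 4))) := by
            have e1 : (t ^ (200 * e)) ^ 3 = (t ^ (150 * e)) ^ 4 := by rw [← pow_mul, ← pow_mul]; congr 1; ring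
            rw [e1]
            refine Nat.mul_le_mul_left _ (Nat.mul_le_mul (Nat.le_self_pow (by norm_num) _)
              (Nat.mul_le_mul (Nat.le_self_pow (by norm_num) _) (Nat.mul_le_mul_right _ ?_)))
            exact Nat.pow_le_pow_right hq (by norm_num)
        _ = _ := by
            rw [pow_succ t (150 * e)]; ring
    exact_mod_cast this
  have := le_of_pow_le_pow_left₀ (by norm_num) (by positivity) hfour
  push_cast at this ⊢
  exact this

lemma log_le_of_le_mul_pow {x : ℝ} {a t n : ℕ} (ht : 0 < t) (h : x ≤ a * (t : ℝ) ^ n) (hx : 0 < x) :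
    Real.log x ≤ (a + n) * t := by
  have ht' : (1 : ℝ) ≤ t := by exact_mod_cast ht
  have ha : (0 : ℝ) < a := by
    by_contra hcon
    have : (0 : ℝ) < (t : ℝ) ^ n := by positivity
    nlinarith
  calc Real.log x ≤ Real.log (a * (t : ℝ) ^ n) := Real.log_le_log hx h
    _ = Real.log a + n * Real.log t := by
      rw [Real.log_mul ha.ne' (by positivity), Real.log_pow]
    _ ≤ a + n * t := by
      have := Real.log_le_self ha.le
      have := Real.log_le_self (x := (t : ℝ)) (by linarith)
      gcongr
    _ ≤ _ := by nlinarith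

lemma exists_abs_divisorSum_sub_le {q e : ℕ} (hq : 0 < q) (he : 0 < e) (a : ℕ) :
    ∃ D : ℕ, 0 < D ∧ ∀ (t : ℕ) (F : Finset ℕ), 0 < t → (∀ p ∈ F, p.Prime ∧ Nat.Coprime q p) →
      ∏ p ∈ F, p ≤ t ^ (200 * e) → ∀ (Q : ℕ), Q = q * ∏ p ∈ F, p → ∀ (c : (ZMod Q)ˣ) (X : ℝ), 0 < X →
      X ≤ a * (t : ℝ) ^ (351 * e) →
      |divisorSum Q c X - divisorMain Q X|
        ≤ D * (X * t ^ 2 / (t ^ 100 * ∏ p ∈ F, (p : ℝ)) + (t : ℝ) ^ (150 * e + 110)) := by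
  obtain ⟨D, hD, hV⟩ := exists_norm_kloosterman_le hq he
  obtain ⟨C₂, hC₂, hpow₂⟩ := exists_pow_card_le 2 (200 * e) (by norm_num) (by omega)
  set A : ℕ := a + 351 * e with hA
  set d : ℕ := #q.divisors
  set B : ℕ := (A + 3) * (D * (d * C₂ * (1 + (q + 200 * e))) ^ 2)
  refine ⟨30 * (2 ^ #q.primeFactors * C₂) + 4 * (1 + A) + B, by positivity,
    fun t F ht hF hf Q hQ c X hX hXle => ?_⟩
  have hprime : ∀ p ∈ F, p.Prime := fun p hp => (hF p hp).1
  have hpos : 0 < ∏ p ∈ F, p := Finset.prod_pos fun p hp => (hprime p hp).pos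
  have hQpos : 0 < Q := by rw [hQ]; positivity
  have : NeZero Q := ⟨hQpos.ne'⟩
  have ht1 : (1 : ℝ) ≤ t := by exact_mod_cast ht
  have h1 := abs_divisorSum_sub_le c (by positivity) (hV t F hF hf Q hQ) (K := t ^ 100)
    (by positivity) hX (l := (a + (351 * e : ℕ)) * t) (by positivity) (log_le_of_le_mul_pow ht hXle hX)
  refine h1.trans ?_
  have h2 := hpow₂ t F (fun p hp => (hprime p hp).pos) hf
  set f := ∏ p ∈ F, p with hfdef
  have hfcast : ∏ p ∈ F, (p : ℝ) = f := by rw [hfdef]; push_cast; rfl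
  rw [hfcast]
  have hf1 : (1 : ℝ) ≤ f := by exact_mod_cast hpos
  have hq1 : (1 : ℝ) ≤ q := by exact_mod_cast hq
  have hQf : (f : ℝ) ≤ Q := by
    rw [hQ]; exact_mod_cast Nat.le_mul_of_pos_left _ hq
  have hQpos' : (0 : ℝ) < Q := by linarith
  have hω : (2 : ℝ) ^ #Q.primeFactors ≤ 2 ^ #q.primeFactors * (C₂ * t) := by
    have : #Q.primeFactors ≤ #q.primeFactors + #F := by
      rw [hQ, Nat.primeFactors_mul hq.ne' hpos.ne', hfdef, primeFactors_prod_primes hprime]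
      exact Finset.card_union_le _ _
    have h3 : 2 ^ #Q.primeFactors ≤ 2 ^ #q.primeFactors * (C₂ * t) :=
      (Nat.pow_le_pow_right (by norm_num) this).trans (by
        rw [pow_add]; exact Nat.mul_le_mul_left _ h2)
    exact_mod_cast h3
  have hdiv : (#(Nat.divisors Q) : ℝ) ≤ d * C₂ * t := by
    have : #(Nat.divisors Q) ≤ d * (C₂ * t) := by
      rw [hQ]
      exact (card_divisors_mul_le _ _).trans
        (Nat.mul_le_mul_left _ ((card_divisors_prod_le hprime).trans h2))
    rw [mul_assoc]
    exact_mod_cast this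
  have hlogQ : 1 + Real.log Q ≤ (1 + (q + 200 * e)) * t := by
    have : (Q : ℝ) ≤ q * (t : ℝ) ^ (200 * e) := by
      rw [hQ]; exact_mod_cast Nat.mul_le_mul_left _ hf
    have := log_le_of_le_mul_pow ht this hQpos'
    push_cast at this
    linarith
  have hlogQ0 : 0 ≤ 1 + Real.log Q := by
    have := Real.log_natCast_nonneg Q
    linarith
  have hbox : boxError Q ((D * t ^ (150 * e + 1) : ℕ) : ℝ)
      ≤ (D * (d * C₂ * (1 + (q + 200 * e))) ^ 2) * (t : ℝ) ^ (150 * e + 5) := by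
    rw [boxError]
    push_cast
    calc _ ≤ D * (t : ℝ) ^ (150 * e + 1) * ((d * C₂ * t) * ((1 + (q + 200 * e)) * t)) ^ 2 := by gcongr
      _ = (D * (d * C₂ * (1 + (q + 200 * e))) ^ 2) * ((t : ℝ) ^ (150 * e + 1) * t ^ 4) := by ring
      _ = _ := by rw [← pow_add]
  have hbox0 : 0 ≤ boxError Q ((D * t ^ (150 * e + 1) : ℕ) : ℝ) := mul_nonneg (by positivity) (sq_nonneg _)
  have hsqrt : √X ≤ X / t ^ 100 + (t : ℝ) ^ 100 := by
    have hT : (0 : ℝ) < (t : ℝ) ^ 100 := by positivity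
    rw [div_add' _ _ _ hT.ne', le_div_iff₀ hT]
    have := Real.sq_sqrt hX.le
    nlinarith [sq_nonneg (√X - (t : ℝ) ^ 100), Real.sqrt_nonneg X, sq_nonneg ((t : ℝ) ^ 100)]
  set Y : ℝ := X * t ^ 2 / (t ^ 100 * f) with hY
  have hY0 : 0 ≤ Y := by positivity
  have b1 : (2 : ℝ) ^ #Q.primeFactors * √X / Q
      ≤ (2 ^ #q.primeFactors * C₂) * (Y + (t : ℝ) ^ (150 * e + 110)) := by
    calc (2 : ℝ) ^ #Q.primeFactors * √X / Q
        ≤ 2 ^ #q.primeFactors * (C₂ * t) * (X / t ^ 100 + (t : ℝ) ^ 100) / f := by gcongr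
      _ = (2 ^ #q.primeFactors * C₂) * (X * t ^ 1 / (t ^ 100 * f) + (t : ℝ) ^ 101 / f) := by
        field_simp
      _ ≤ _ := by
        have e1 : X * (t : ℝ) ^ 1 / (t ^ 100 * f) ≤ Y := by
          rw [hY]
          gcongr; norm_num
        have e2 : (t : ℝ) ^ 101 / f ≤ (t : ℝ) ^ (150 * e + 110) :=
          (div_le_self (by positivity) hf1).trans (pow_le_pow_right₀ ht1 (by omega))
        gcongr
  have b2 : 4 * X / (((t ^ 100 : ℕ) : ℝ) * Q) * (1 + (a + (351 * e : ℕ)) * t)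
      ≤ (4 * (1 + A)) * (Y + (t : ℝ) ^ (150 * e + 110)) := by
    have e0 : (1 : ℝ) + (a + (351 * e : ℕ)) * t ≤ (1 + A) * t ^ 2 := by
      rw [hA]; push_cast
      have ht2 : (t : ℝ) ≤ t ^ 2 := le_self_pow₀ ht1 (by norm_num)
      have := mul_le_mul_of_nonneg_left ht2 (show (0 : ℝ) ≤ a + 351 * e by positivity)
      linarith
    calc _ ≤ 4 * X / ((t : ℝ) ^ 100 * f) * ((1 + A) * t ^ 2) := by
          push_cast at e0 ⊢
          gcongr
      _ = (4 * (1 + A)) * Y := by rw [hY]; ring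
      _ ≤ _ := by
        refine mul_le_mul_of_nonneg_left ?_ (by positivity)
        have : (0 : ℝ) ≤ (t : ℝ) ^ (150 * e + 110) := by positivity
        linarith
  have b3 : (((t ^ 100 : ℕ) : ℝ) * ((a + (351 * e : ℕ)) * t) + 3) * boxError Q ((D * t ^ (150 * e + 1) : ℕ) : ℝ)
      ≤ B * (Y + (t : ℝ) ^ (150 * e + 110)) := by
    have e0 : ((t ^ 100 : ℕ) : ℝ) * ((a + (351 * e : ℕ)) * t) + 3 ≤ (A + 3) * (t : ℝ) ^ 101 := by
      have : (1 : ℝ) ≤ (t : ℝ) ^ 101 := one_le_pow₀ ht1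
      rw [hA, pow_succ]; push_cast
      rw [pow_succ] at this
      linarith
    calc _ ≤ ((A + 3) * (t : ℝ) ^ 101)
          * ((D * (d * C₂ * (1 + (q + 200 * e))) ^ 2) * (t : ℝ) ^ (150 * e + 5)) :=
          mul_le_mul e0 hbox hbox0 (by positivity)
      _ = B * ((t : ℝ) ^ 101 * (t : ℝ) ^ (150 * e + 5)) := by
          simp only [B]; push_cast; ring
      _ = B * (t : ℝ) ^ (150 * e + 106) := by rw [← pow_add]; congr 2; ring
      _ ≤ _ := by
        refine mul_le_mul_of_nonneg_left ?_ (by positivity)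
        have : (t : ℝ) ^ (150 * e + 106) ≤ (t : ℝ) ^ (150 * e + 110) := pow_le_pow_right₀ ht1 (by omega)
        linarith
  have e : ((30 * (2 ^ #q.primeFactors * C₂) + 4 * (1 + A) + B : ℕ) : ℝ) * (Y + (t : ℝ) ^ (150 * e + 110))
      = 30 * ((2 ^ #q.primeFactors * C₂) * (Y + (t : ℝ) ^ (150 * e + 110)))
        + (4 * (1 + A)) * (Y + (t : ℝ) ^ (150 * e + 110)) + B * (Y + (t : ℝ) ^ (150 * e + 110)) := by
    push_cast; ring
  rw [e]
  linarith

lemma card_filter_range_mul {m n : ℕ} (hm : 0 < m) (hn : 0 < n) (h : Nat.Coprime m n)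
    (P R : ℕ → Prop) [DecidablePred P] [DecidablePred R] (hP : ∀ x, P (x % m) ↔ P x)
    (hR : ∀ x, R (x % n) ↔ R x) :
    #((range (m * n)).filter fun x => P x ∧ R x)
      = #((range m).filter P) * #((range n).filter R) := by
  rw [← Finset.card_product]
  have hmn : m ≠ 0 := hm.ne'
  refine Finset.card_bij' (fun x _ => (x % m, x % n)) (fun y _ => Nat.chineseRemainder h y.1 y.2)
    ?_ ?_ ?_ ?_
  · intro x hx
    rw [mem_filter] at hx
    rw [mem_product, mem_filter, mem_filter, mem_range, mem_range]
    exact ⟨⟨Nat.mod_lt _ hm, (hP x).mpr hx.2.1⟩, Nat.mod_lt _ hn, (hR x).mpr hx.2.2⟩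
  · rintro ⟨a, b⟩ hy
    rw [mem_product, mem_filter, mem_filter, mem_range, mem_range] at hy
    obtain ⟨⟨h1, h2⟩, h3, h4⟩ := hy
    have hc := (Nat.chineseRemainder h a b).2
    rw [mem_filter, mem_range]
    refine ⟨Nat.chineseRemainder_lt_mul h a b hm.ne' hn.ne', ?_, ?_⟩
    · rw [← hP, hc.1, Nat.mod_eq_of_lt h1]; exact h2
    · rw [← hR, hc.2, Nat.mod_eq_of_lt h3]; exact h4
  · intro x hx
    rw [mem_filter, mem_range] at hx
    have hc := (Nat.chineseRemainder h (x % m) (x % n)).2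
    have h1 := Nat.chineseRemainder_lt_mul h (x % m) (x % n) hm.ne' hn.ne'
    refine Nat.ModEq.eq_of_lt_of_lt ?_ h1 hx.1
    exact (Nat.modEq_and_modEq_iff_modEq_mul h).mp
      ⟨hc.1.trans (Nat.mod_modEq x m), hc.2.trans (Nat.mod_modEq x n)⟩
  · rintro ⟨a, b⟩ hy
    rw [mem_product, mem_filter, mem_filter, mem_range, mem_range] at hy
    obtain ⟨⟨h1, h2⟩, h3, h4⟩ := hy
    have hc := (Nat.chineseRemainder h a b).2
    ext
    · exact Eq.trans (show _ % m = a % m from hc.1) (Nat.mod_eq_of_lt h1)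
    · exact Eq.trans (show _ % n = b % n from hc.2) (Nat.mod_eq_of_lt h3)

lemma card_range_filter_mem {p : ℕ} (hp : 0 < p) (B : Finset (ZMod p)) :
    #((range p).filter fun x : ℕ => (x : ZMod p) ∈ B) = #B := by
  have : NeZero p := ⟨hp.ne'⟩
  refine Finset.card_bij' (fun x _ => (x : ZMod p)) (fun y _ => y.val) ?_ ?_ ?_ ?_
  · exact fun x hx => (mem_filter.mp hx).2
  · intro y hy
    rw [mem_filter, mem_range, ZMod.natCast_zmod_val]
    exact ⟨ZMod.val_lt y, hy⟩
  · exact fun x hx => ZMod.val_cast_of_lt (mem_range.mp (mem_filter.mp hx).1)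
  · exact fun y _ => ZMod.natCast_zmod_val y

/-- Residues modulo `q ∏ F` which are `1` modulo `q` and lie in `B p` for all `p ∈ F`. -/
def rootSet (q : ℕ) (B : (p : ℕ) → Finset (ZMod p)) (F : Finset ℕ) : Finset ℕ :=
  (range (q * ∏ p ∈ F, p)).filter fun x : ℕ => (x : ZMod q) = 1 ∧ ∀ p ∈ F, (x : ZMod p) ∈ B p

lemma natCast_mod_of_dvd {x m n : ℕ} (h : m ∣ n) : ((x % n : ℕ) : ZMod m) = x := by
  rw [ZMod.natCast_eq_natCast_iff]
  exact (Nat.mod_modEq x n).of_dvd h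

lemma card_rootSet {q : ℕ} (hq : 0 < q) (B : (p : ℕ) → Finset (ZMod p)) (F : Finset ℕ)
    (hF : ∀ p ∈ F, p.Prime ∧ Nat.Coprime q p) :
    #(rootSet q B F) = ∏ p ∈ F, #(B p) := by
  induction F using Finset.induction_on with
  | empty =>
    have := card_range_filter_mem hq {(1 : ZMod q)}
    simpa [rootSet] using this
  | insert a s ha ih =>
    have hs : ∀ p ∈ s, p.Prime ∧ Nat.Coprime q p := fun p hp => hF p (mem_insert_of_mem hp)
    have hpa := hF a (mem_insert_self a s)
    have hpos : 0 < q * ∏ p ∈ s, p :=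
      Nat.mul_pos hq (Finset.prod_pos fun p hp => (hs p hp).1.pos)
    have hcop : Nat.Coprime a (q * ∏ p ∈ s, p) := by
      refine Nat.Coprime.mul_right hpa.2.symm (Nat.Coprime.prod_right fun p hp => ?_)
      exact (Nat.coprime_primes hpa.1 (hs p hp).1).mpr fun h => ha (h ▸ hp)
    rw [Finset.prod_insert ha, ← ih hs, ← card_range_filter_mem hpa.1.pos (B a), rootSet, rootSet,
      ← card_filter_range_mul hpa.1.pos hpos hcop]
    · congr 1
      rw [Finset.prod_insert ha]
      ext x
      simp only [mem_filter, mem_range, Finset.forall_mem_insert]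
      rw [show q * (a * ∏ p ∈ s, p) = a * (q * ∏ p ∈ s, p) by ring]
      tauto
    · intro x
      rw [natCast_mod_of_dvd dvd_rfl]
    · intro x
      rw [natCast_mod_of_dvd (dvd_mul_right q _)]
      refine and_congr Iff.rfl (forall₂_congr fun p hp => ?_)
      rw [natCast_mod_of_dvd ((Finset.dvd_prod_of_mem _ hp).mul_left q)]

lemma mod_mem_rootSet {q : ℕ} (hq : 0 < q) (B : (p : ℕ) → Finset (ZMod p)) {F : Finset ℕ}
    (hF : ∀ p ∈ F, p.Prime) (x : ℕ) :
    x % (q * ∏ p ∈ F, p) ∈ rootSet q B F ↔ (x : ZMod q) = 1 ∧ ∀ p ∈ F, (x : ZMod p) ∈ B p := by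
  have hpos : 0 < q * ∏ p ∈ F, p := Nat.mul_pos hq (Finset.prod_pos fun p hp => (hF p hp).pos)
  rw [rootSet, mem_filter, mem_range, natCast_mod_of_dvd (dvd_mul_right q _)]
  simp only [Nat.mod_lt _ hpos, true_and]
  refine and_congr Iff.rfl (forall₂_congr fun p hp => ?_)
  rw [natCast_mod_of_dvd ((Finset.dvd_prod_of_mem _ hp).mul_left q)]

lemma card_divisors_prime_mul {p m : ℕ} (hp : p.Prime) (hm : 0 < m) :
    (#(p * m).divisors : ℝ) = 2 * #m.divisors - if p ∣ m then (#(m / p).divisors : ℝ) else 0 := by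
  obtain ⟨a, b, hb, rfl⟩ := Nat.exists_eq_pow_mul_and_not_dvd hm.ne' p hp.ne_one
  have hcop : ∀ k, #(p ^ k * b).divisors = (k + 1) * #b.divisors := by
    intro k
    rw [Nat.Coprime.card_divisors_mul (Nat.Coprime.pow_left k ((hp.coprime_iff_not_dvd).mpr hb)),
      Nat.divisors_prime_pow hp, Finset.card_map, Finset.card_range]
  rw [← mul_assoc, ← pow_succ', hcop, hcop]
  rcases a with _ | a
  · simp [hb]
  · have h1 : p ∣ p ^ (a + 1) * b := (dvd_pow_self p (by omega)).mul_right b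
    have h2 : p ^ (a + 1) * b / p = p ^ a * b := by
      rw [pow_succ', mul_assoc, Nat.mul_div_cancel_left _ hp.pos]
    rw [if_pos h1, h2, hcop]
    push_cast; ring

/-- The number of divisors of `n / g`, or `0` if `g` does not divide `n`. -/
noncomputable def quotTau (g n : ℕ) : ℝ := if g ∣ n then (#(n / g).divisors : ℝ) else 0

lemma quotTau_prime {p g n : ℕ} (hp : p.Prime) (hg : 0 < g) (hn : 0 < n) (hpn : p ∣ n)
    (hpg : Nat.Coprime p g) : quotTau g n = 2 * quotTau (p * g) n - quotTau (p * p * g) n := by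
  by_cases h : g ∣ n
  · obtain ⟨m, rfl⟩ := h
    have hm : p ∣ m := hpg.dvd_of_dvd_mul_left hpn
    obtain ⟨k, rfl⟩ := hm
    have hk : 0 < k := Nat.pos_of_ne_zero (by rintro rfl; simp at hn)
    have e1 : quotTau g (g * (p * k)) = #(p * k).divisors := by
      rw [quotTau, if_pos (dvd_mul_right _ _), Nat.mul_div_cancel_left _ hg]
    have e2 : quotTau (p * g) (g * (p * k)) = #k.divisors := by
      rw [quotTau, if_pos ⟨k, by ring⟩, show g * (p * k) = p * g * k by ring,
        Nat.mul_div_cancel_left _ (Nat.mul_pos hp.pos hg)]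
    have e3 : quotTau (p * p * g) (g * (p * k)) = if p ∣ k then (#(k / p).divisors : ℝ) else 0 := by
      have hpg0 : 0 < p * g := Nat.mul_pos hp.pos hg
      rw [quotTau, show g * (p * k) = p * g * k by ring, show p * p * g = p * g * p by ring,
        Nat.mul_div_mul_left _ _ hpg0]
      simp only [Nat.mul_dvd_mul_iff_left hpg0]
    rw [e1, e2, e3, card_divisors_prime_mul hp hk]
  · have h2 : ¬ p * g ∣ n := fun h' => h ((dvd_mul_left g p).trans h')
    have h3 : ¬ p * p * g ∣ n := fun h' => h ((dvd_mul_left g _).trans h')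
    rw [quotTau, quotTau, quotTau, if_neg h, if_neg h2, if_neg h3]; ring

lemma card_divisors_eq_sum_powerset {n : ℕ} (hn : 0 < n) (E : Finset ℕ)
    (hE : ∀ p ∈ E, p.Prime ∧ p ∣ n) :
    (#n.divisors : ℝ) = ∑ κ ∈ E.powerset, (∏ _p ∈ κ, (-1 : ℝ)) * (∏ _p ∈ E \ κ, (2 : ℝ))
      * quotTau ((∏ p ∈ E, p) * ∏ p ∈ κ, p) n := by
  induction E using Finset.induction_on with
  | empty => simp [quotTau]
  | insert a s ha ih =>
    have hs : ∀ p ∈ s, p.Prime ∧ p ∣ n := fun p hp => hE p (mem_insert_of_mem hp)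
    have hpa := hE a (mem_insert_self a s)
    have hcop : ∀ t ⊆ s, Nat.Coprime a (∏ p ∈ t, p) := fun t ht =>
      Nat.Coprime.prod_right fun p hp =>
        (Nat.coprime_primes hpa.1 (hs p (ht hp)).1).mpr fun h => ha (h ▸ ht hp)
    rw [ih hs, Finset.sum_powerset_insert ha, ← Finset.sum_add_distrib]
    refine Finset.sum_congr rfl fun κ hκ => ?_
    rw [mem_powerset] at hκ
    have haκ : a ∉ κ := fun h => ha (hκ h)
    have hpos : ∀ t ⊆ s, 0 < ∏ p ∈ t, p := fun t ht =>
      Finset.prod_pos fun p hp => (hs p (ht hp)).1.pos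
    rw [quotTau_prime hpa.1 (Nat.mul_pos (hpos s subset_rfl) (hpos κ hκ)) hn hpa.2
        ((hcop s subset_rfl).mul_right (hcop κ hκ)),
      Finset.insert_sdiff_of_notMem _ haκ, Finset.prod_insert (by simp [ha]),
      Finset.insert_sdiff_insert, Finset.sdiff_insert_of_notMem ha,
      Finset.prod_insert haκ, Finset.prod_insert haκ, Finset.prod_insert ha]
    rw [show a * (∏ p ∈ s, p) * ∏ p ∈ κ, p = a * ((∏ p ∈ s, p) * ∏ p ∈ κ, p) by ring,
      show a * (∏ p ∈ s, p) * (a * ∏ p ∈ κ, p) = a * a * ((∏ p ∈ s, p) * ∏ p ∈ κ, p) by ring]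
    ring

/-- The divisor sum over `n ≤ X` with `n = 1` in `ZMod q` that hit, for every `p ∈ C`, either `0` or
an element of `B p`. -/
noncomputable def hitSum (q : ℕ) (B : (p : ℕ) → Finset (ZMod p)) (C : Finset ℕ) (X : ℝ) : ℝ :=
  ∑ n ∈ (Icc 1 ⌊X⌋₊).filter (fun n : ℕ => (n : ZMod q) = 1 ∧
    ∀ p ∈ C, p ∣ n ∨ (n : ZMod p) ∈ B p), (#n.divisors : ℝ)

/-- The sum of `quotTau g` over a residue class. -/
noncomputable def classSum (g Q c : ℕ) (X : ℝ) : ℝ :=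
  ∑ n ∈ (Icc 1 ⌊X⌋₊).filter (fun n : ℕ => n % Q = c), quotTau g n

lemma indicator_hit {C : Finset ℕ} {B : (p : ℕ) → Finset (ZMod p)}
    (hB : ∀ p ∈ C, (0 : ZMod p) ∉ B p) (n : ℕ) :
    (if ∀ p ∈ C, p ∣ n ∨ (n : ZMod p) ∈ B p then (1 : ℝ) else 0)
      = ∑ E ∈ C.powerset, (if ∀ p ∈ E, p ∣ n then (1 : ℝ) else 0)
        * (if ∀ p ∈ C \ E, (n : ZMod p) ∈ B p then (1 : ℝ) else 0) := by
  have hprod : ∀ (s : Finset ℕ) (P : ℕ → Prop) [DecidablePred P],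
      (if ∀ p ∈ s, P p then (1 : ℝ) else 0) = ∏ p ∈ s, if P p then (1 : ℝ) else 0 := by
    intro s P _
    rw [Finset.prod_ite_zero]; simp
  simp only [hprod]
  rw [← Finset.prod_add]
  refine Finset.prod_congr rfl fun p hp => ?_
  by_cases h : p ∣ n
  · have h2 : (n : ZMod p) = 0 := (ZMod.natCast_eq_zero_iff n p).mpr h
    simp [h, h2, hB p hp]
  · simp [h]

lemma indicator_dvd_mul_card_divisors {n : ℕ} (hn : 0 < n) {E : Finset ℕ} (hE : ∀ p ∈ E, p.Prime) :
    (if ∀ p ∈ E, p ∣ n then (1 : ℝ) else 0) * #n.divisors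
      = ∑ κ ∈ E.powerset, (∏ _p ∈ κ, (-1 : ℝ)) * (∏ _p ∈ E \ κ, (2 : ℝ))
        * quotTau ((∏ p ∈ E, p) * ∏ p ∈ κ, p) n := by
  split_ifs with h
  · rw [one_mul]
    exact card_divisors_eq_sum_powerset hn E fun p hp => ⟨hE p hp, h p hp⟩
  · rw [zero_mul, eq_comm]
    refine Finset.sum_eq_zero fun κ _ => ?_
    rw [quotTau, if_neg, mul_zero]
    intro hdvd
    exact h fun p hp => (Finset.dvd_prod_of_mem _ hp).trans ((dvd_mul_right _ _).trans hdvd)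

lemma hitSum_eq {q : ℕ} (hq : 0 < q) {B : (p : ℕ) → Finset (ZMod p)} {C : Finset ℕ}
    (hC : ∀ p ∈ C, p.Prime) (hB : ∀ p ∈ C, (0 : ZMod p) ∉ B p) (X : ℝ) :
    hitSum q B C X = ∑ E ∈ C.powerset, ∑ κ ∈ E.powerset,
      (∏ _p ∈ κ, (-1 : ℝ)) * (∏ _p ∈ E \ κ, (2 : ℝ)) * ∑ c ∈ rootSet q B (C \ E),
        classSum ((∏ p ∈ E, p) * ∏ p ∈ κ, p) (q * ∏ p ∈ C \ E, p) c X := by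
  have hterm : ∀ n ∈ Icc 1 ⌊X⌋₊,
      (if (n : ZMod q) = 1 ∧ ∀ p ∈ C, p ∣ n ∨ (n : ZMod p) ∈ B p then (#n.divisors : ℝ) else 0)
      = ∑ E ∈ C.powerset, ∑ κ ∈ E.powerset,
      (∏ _p ∈ κ, (-1 : ℝ)) * (∏ _p ∈ E \ κ, (2 : ℝ)) * ∑ c ∈ rootSet q B (C \ E),
        if n % (q * ∏ p ∈ C \ E, p) = c then quotTau ((∏ p ∈ E, p) * ∏ p ∈ κ, p) n else 0 := by
    intro n hn
    have hn0 : 0 < n := (mem_Icc.mp hn).1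
    have e1 : (if (n : ZMod q) = 1 ∧ ∀ p ∈ C, p ∣ n ∨ (n : ZMod p) ∈ B p
        then (#n.divisors : ℝ) else 0) = (if (n : ZMod q) = 1 then (1 : ℝ) else 0)
          * (if ∀ p ∈ C, p ∣ n ∨ (n : ZMod p) ∈ B p then (1 : ℝ) else 0) * #n.divisors := by
      split_ifs <;> simp_all
    rw [e1, indicator_hit hB, Finset.mul_sum, Finset.sum_mul]
    refine Finset.sum_congr rfl fun E hE => ?_
    rw [mem_powerset] at hE
    have e2 : (if (n : ZMod q) = 1 then (1 : ℝ) else 0)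
        * (if ∀ p ∈ C \ E, (n : ZMod p) ∈ B p then (1 : ℝ) else 0)
        = ∑ c ∈ rootSet q B (C \ E), if n % (q * ∏ p ∈ C \ E, p) = c then (1 : ℝ) else 0 := by
      rw [Finset.sum_ite_eq]
      simp only [mod_mem_rootSet hq B (fun p hp => hC p (mem_sdiff.mp hp).1)]
      split_ifs <;> simp_all
    calc _ = ((if ∀ p ∈ E, p ∣ n then (1 : ℝ) else 0) * #n.divisors)
          * ((if (n : ZMod q) = 1 then (1 : ℝ) else 0)
            * (if ∀ p ∈ C \ E, (n : ZMod p) ∈ B p then (1 : ℝ) else 0)) := by ring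
      _ = _ := by
        rw [indicator_dvd_mul_card_divisors hn0 fun p hp => hC p (hE hp), e2, Finset.sum_mul]
        refine Finset.sum_congr rfl fun κ _ => ?_
        rw [mul_assoc, Finset.mul_sum]
        congr 1
        refine Finset.sum_congr rfl fun c _ => ?_
        split_ifs <;> simp
  rw [hitSum, Finset.sum_filter, Finset.sum_congr rfl hterm, Finset.sum_comm]
  refine Finset.sum_congr rfl fun E _ => ?_
  rw [Finset.sum_comm]
  refine Finset.sum_congr rfl fun κ _ => ?_
  rw [← Finset.mul_sum, Finset.sum_comm]
  congr 1
  refine Finset.sum_congr rfl fun c _ => ?_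
  rw [classSum, Finset.sum_filter]

lemma classSum_eq_divisorSum {g Q c : ℕ} (hg : 0 < g) (hcQ : Nat.Coprime c Q)
    (hgQ : Nat.Coprime g Q) (hc : c < Q) {X : ℝ} (hX : 0 ≤ X) :
    ∃ u : (ZMod Q)ˣ, classSum g Q c X = divisorSum Q u (X / g) := by
  refine ⟨ZMod.unitOfCoprime c hcQ * (ZMod.unitOfCoprime g hgQ)⁻¹, ?_⟩
  have hmod : ∀ n : ℕ, n % Q = c ↔ (n : ZMod Q) = c := by
    intro n
    rw [ZMod.natCast_eq_natCast_iff, Nat.ModEq, Nat.mod_eq_of_lt hc]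
  have hunit : ∀ m : ℕ, (m : ZMod Q) = ((ZMod.unitOfCoprime c hcQ *
      (ZMod.unitOfCoprime g hgQ)⁻¹ : (ZMod Q)ˣ) : ZMod Q) ↔ ((g * m : ℕ) : ZMod Q) = c := by
    intro m
    rw [Units.val_mul, ZMod.coe_unitOfCoprime, Units.eq_mul_inv_iff_mul_eq,
      ZMod.coe_unitOfCoprime, Nat.cast_mul, mul_comm]
  have hfl : ∀ m : ℕ, m ≤ ⌊X / g⌋₊ ↔ g * m ≤ ⌊X⌋₊ := by
    intro m
    have : (0 : ℝ) < g := by exact_mod_cast hg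
    rw [Nat.le_floor_iff (by positivity), Nat.le_floor_iff hX, le_div_iff₀ this]
    push_cast; rw [mul_comm]
  have hsub : ∑ n ∈ (Icc 1 ⌊X⌋₊).filter (fun n : ℕ => n % Q = c), quotTau g n
      = ∑ n ∈ ((Icc 1 ⌊X⌋₊).filter (fun n : ℕ => n % Q = c)).filter (g ∣ ·),
        (#(n / g).divisors : ℝ) := by
    rw [Finset.sum_filter (fun n => g ∣ n)]; rfl
  rw [classSum, hsub, divisorSum]
  refine Finset.sum_bij' (fun n _ => n / g) (fun m _ => g * m) ?_ ?_ ?_ ?_ ?_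
  · intro n hn
    simp only [mem_filter, mem_Icc] at hn ⊢
    obtain ⟨⟨⟨h1, h2⟩, h3⟩, m, rfl⟩ := hn
    rw [Nat.mul_div_cancel_left _ hg]
    exact ⟨⟨Nat.pos_of_mul_pos_left h1, (hfl m).mpr h2⟩, (hunit m).mpr ((hmod _).mp h3)⟩
  · intro m hm
    simp only [mem_filter, mem_Icc] at hm ⊢
    exact ⟨⟨⟨Nat.mul_pos hg hm.1.1, (hfl m).mp hm.1.2⟩, (hmod _).mpr ((hunit m).mp hm.2)⟩,
      dvd_mul_right g m⟩
  · intro n hn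
    exact Nat.mul_div_cancel' (mem_filter.mp hn).2
  · intro m _
    exact Nat.mul_div_cancel_left _ hg
  · intro n _; rfl

lemma coprime_of_mem_rootSet {q c : ℕ} {B : (p : ℕ) → Finset (ZMod p)} {F : Finset ℕ}
    (hF : ∀ p ∈ F, p.Prime) (hB : ∀ p ∈ F, (0 : ZMod p) ∉ B p) (hc : c ∈ rootSet q B F) :
    c < q * ∏ p ∈ F, p ∧ Nat.Coprime c (q * ∏ p ∈ F, p) := by
  rw [rootSet, mem_filter, mem_range] at hc
  obtain ⟨h1, h2, h3⟩ := hc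
  refine ⟨h1, Nat.Coprime.mul_right ?_ (Nat.Coprime.prod_right fun p hp => ?_)⟩
  · rw [← ZMod.isUnit_iff_coprime, h2]; exact isUnit_one
  · rw [Nat.coprime_comm, (hF p hp).coprime_iff_not_dvd, ← ZMod.natCast_eq_zero_iff]
    intro h0
    exact hB p hp (h0 ▸ h3 p hp)

lemma totient_div_sq_prod {q : ℕ} {F : Finset ℕ} (hF : ∀ p ∈ F, p.Prime ∧ Nat.Coprime q p) :
    (Nat.totient (q * ∏ p ∈ F, p) : ℝ) / ((q * ∏ p ∈ F, p : ℕ) : ℝ) ^ 2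
      = Nat.totient q / (q : ℝ) ^ 2 * ∏ p ∈ F, (((p : ℝ) - 1) / (p : ℝ) ^ 2) := by
  have h1 : Nat.Coprime q (∏ p ∈ F, p) := Nat.Coprime.prod_right fun p hp => (hF p hp).2
  have h2 : (Nat.totient (∏ p ∈ F, p) : ℝ) = ∏ p ∈ F, ((p : ℝ) - 1) := by
    have hF' : ∀ p ∈ F, p.Prime := fun p hp => (hF p hp).1
    clear hF h1
    induction F using Finset.induction_on with
    | empty => simp
    | insert a s ha ih =>
      have hs : ∀ p ∈ s, p.Prime := fun p hp => hF' p (mem_insert_of_mem hp)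
      have hpa := hF' a (mem_insert_self a s)
      rw [Finset.prod_insert ha, Finset.prod_insert ha, Nat.totient_mul, Nat.totient_prime hpa]
      · push_cast [hpa.one_le]
        rw [ih hs]
      · refine Nat.Coprime.prod_right fun p hp => ?_
        exact (Nat.coprime_primes hpa (hs p hp)).mpr fun h => ha (h ▸ hp)
  rw [Nat.totient_mul h1]
  push_cast
  rw [h2, Finset.prod_div_distrib, Finset.prod_pow, mul_pow, mul_div_mul_comm]

lemma logSum_mul_prod {q : ℕ} (hq : 0 < q) {F : Finset ℕ}
    (hF : ∀ p ∈ F, p.Prime ∧ Nat.Coprime q p) :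
    logSum (q * ∏ p ∈ F, p) = logSum q + ∑ p ∈ F, Real.log p / ((p : ℝ) - 1) := by
  have hF' : ∀ p ∈ F, p.Prime := fun p hp => (hF p hp).1
  have hpos : 0 < ∏ p ∈ F, p := Finset.prod_pos fun p hp => (hF' p hp).pos
  rw [logSum, logSum, Nat.primeFactors_mul hq.ne' hpos.ne', primeFactors_prod_primes hF',
    Finset.sum_union]
  rw [Finset.disjoint_left]
  intro p hp hpF
  have := (hF p hpF).2
  rw [Nat.coprime_comm, (hF' p hpF).coprime_iff_not_dvd] at this
  exact this (Nat.dvd_of_mem_primeFactors hp)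

/-- The local density of multiples of `p` in the sum of the divisor function. -/
noncomputable def density6 (p : ℕ) : ℝ := (6 * p - 5) / (p : ℝ) ^ 2

/-- The logarithmic shift attached to `p`. -/
noncomputable def logShift (p : ℕ) : ℝ := (2 * p - 10) / (6 * p - 5) * Real.log p

/-- The main term of `hitSum`. -/
noncomputable def hitMain (q : ℕ) (C : Finset ℕ) (X : ℝ) : ℝ :=
  X * (Nat.totient q / (q : ℝ) ^ 2) * ((∏ p ∈ C, density6 p)
    * (Real.log X + 2 * Real.eulerMascheroniConstant - 1 + 2 * logSum q - ∑ p ∈ C, logShift p))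

lemma log_prod_primes {F : Finset ℕ} (hF : ∀ p ∈ F, p.Prime) :
    Real.log (∏ p ∈ F, (p : ℝ)) = ∑ p ∈ F, Real.log p :=
  Real.log_prod fun p hp => by exact_mod_cast (hF p hp).ne_zero

lemma divisorMain_eq {q : ℕ} (hq : 0 < q) {C E κ : Finset ℕ}
    (hC : ∀ p ∈ C, p.Prime ∧ Nat.Coprime q p) (hE : E ⊆ C) (hκ : κ ⊆ E) {X : ℝ} (hX : 0 < X) :
    (∏ _p ∈ κ, (-1 : ℝ)) * (∏ _p ∈ E \ κ, (2 : ℝ)) * (4 ^ #(C \ E)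
      * divisorMain (q * ∏ p ∈ C \ E, p) (X / (((∏ p ∈ E, p) * ∏ p ∈ κ, p : ℕ) : ℝ)))
    = X * (Nat.totient q / (q : ℝ) ^ 2) * ((∏ p ∈ C \ E, (4 * ((p : ℝ) - 1) / (p : ℝ) ^ 2))
      * ((∏ p ∈ κ, (-1 / (p : ℝ) ^ 2)) * (∏ p ∈ E \ κ, (2 / (p : ℝ)))
        * (((Real.log X + 2 * Real.eulerMascheroniConstant - 1 + 2 * logSum q)
              + ∑ p ∈ C \ E, 2 * Real.log p / ((p : ℝ) - 1))
            + ∑ p ∈ κ, (-2 * Real.log p) + ∑ p ∈ E \ κ, (-Real.log p)))) := by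
  have hF : ∀ p ∈ C \ E, p.Prime ∧ Nat.Coprime q p := fun p hp => hC p (mem_sdiff.mp hp).1
  have hEp : ∀ p ∈ E, p.Prime := fun p hp => (hC p (hE hp)).1
  have hκp : ∀ p ∈ κ, p.Prime := fun p hp => hEp p (hκ hp)
  have hEpos : (0 : ℝ) < ∏ p ∈ E, (p : ℝ) :=
    Finset.prod_pos fun p hp => by exact_mod_cast (hEp p hp).pos
  have hκpos : (0 : ℝ) < ∏ p ∈ κ, (p : ℝ) :=
    Finset.prod_pos fun p hp => by exact_mod_cast (hκp p hp).pos
  have hEκ : ∀ f : ℕ → ℝ, ∑ p ∈ E, f p = ∑ p ∈ κ, f p + ∑ p ∈ E \ κ, f p := fun f => by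
    rw [add_comm, Finset.sum_sdiff hκ]
  have hEκ' : ∀ f : ℕ → ℝ, ∏ p ∈ E, f p = (∏ p ∈ κ, f p) * ∏ p ∈ E \ κ, f p := fun f => by
    rw [mul_comm, Finset.prod_sdiff hκ]
  rw [divisorMain, totient_div_sq_prod hF, logSum_mul_prod hq hF]
  push_cast
  rw [Real.log_div hX.ne' (by positivity), Real.log_mul hEpos.ne' hκpos.ne',
    log_prod_primes hEp, log_prod_primes hκp, hEκ (fun p => Real.log p)]
  have e1 : ∏ p ∈ C \ E, (4 * ((p : ℝ) - 1) / (p : ℝ) ^ 2)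
      = 4 ^ #(C \ E) * ∏ p ∈ C \ E, (((p : ℝ) - 1) / (p : ℝ) ^ 2) := by
    rw [← Finset.prod_const, ← Finset.prod_mul_distrib]
    exact Finset.prod_congr rfl fun p _ => by ring
  have e2 : ∑ p ∈ C \ E, 2 * Real.log p / ((p : ℝ) - 1)
      = 2 * ∑ p ∈ C \ E, Real.log p / ((p : ℝ) - 1) := by
    rw [Finset.mul_sum]; exact Finset.sum_congr rfl fun p _ => by ring
  have e3 : ∑ p ∈ κ, (-2 * Real.log p) = -2 * ∑ p ∈ κ, Real.log p := by rw [Finset.mul_sum]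
  have e4 : ∑ p ∈ E \ κ, (-Real.log p) = - ∑ p ∈ E \ κ, Real.log p := Finset.sum_neg_distrib _
  have e5 : (∏ p ∈ κ, (-1 / (p : ℝ) ^ 2)) * (∏ p ∈ E \ κ, (2 / (p : ℝ)))
      = (∏ _p ∈ κ, (-1 : ℝ)) * (∏ _p ∈ E \ κ, (2 : ℝ))
        / ((∏ p ∈ E, (p : ℝ)) * ∏ p ∈ κ, (p : ℝ)) := by
    rw [Finset.prod_div_distrib, Finset.prod_div_distrib, hEκ' (fun p => (p : ℝ)),
      Finset.prod_pow, div_mul_div_comm]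
    congr 1; ring
  rw [e1, e2, e3, e4, e5]
  ring

lemma sum_divisorMain_eq {q : ℕ} (hq : 0 < q) {C : Finset ℕ}
    (hC : ∀ p ∈ C, p.Prime ∧ Nat.Coprime q p) {X : ℝ} (hX : 0 < X) :
    ∑ E ∈ C.powerset, ∑ κ ∈ E.powerset,
      (∏ _p ∈ κ, (-1 : ℝ)) * (∏ _p ∈ E \ κ, (2 : ℝ)) * (4 ^ #(C \ E)
      * divisorMain (q * ∏ p ∈ C \ E, p) (X / (((∏ p ∈ E, p) * ∏ p ∈ κ, p : ℕ) : ℝ)))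
    = hitMain q C X := by
  have h2 : ∀ p ∈ C, (2 : ℝ) ≤ p := fun p hp => by exact_mod_cast (hC p hp).1.two_le
  set L := Real.log X + 2 * Real.eulerMascheroniConstant - 1 + 2 * logSum q with hL
  have hinner : ∀ E ∈ C.powerset, ∑ κ ∈ E.powerset,
      (∏ _p ∈ κ, (-1 : ℝ)) * (∏ _p ∈ E \ κ, (2 : ℝ)) * (4 ^ #(C \ E)
      * divisorMain (q * ∏ p ∈ C \ E, p) (X / (((∏ p ∈ E, p) * ∏ p ∈ κ, p : ℕ) : ℝ)))
      = X * (Nat.totient q / (q : ℝ) ^ 2) * ((∏ p ∈ E, ((2 * p - 1) / (p : ℝ) ^ 2))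
        * (∏ p ∈ C \ E, (4 * ((p : ℝ) - 1) / (p : ℝ) ^ 2))
        * (L + ∑ p ∈ E, ((2 - 2 * p) / (2 * p - 1) * Real.log p)
          + ∑ p ∈ C \ E, 2 * Real.log p / ((p : ℝ) - 1))) := by
    intro E hE
    rw [mem_powerset] at hE
    rw [Finset.sum_congr rfl fun κ hκ => divisorMain_eq hq hC hE (mem_powerset.mp hκ) hX,
      ← Finset.mul_sum, ← Finset.mul_sum, sum_powerset_prod_mul_add]
    · rw [← hL]
      have e1 : ∏ p ∈ E, (-1 / (p : ℝ) ^ 2 + 2 / (p : ℝ)) = ∏ p ∈ E, ((2 * p - 1) / (p : ℝ) ^ 2) :=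
        Finset.prod_congr rfl fun p hp => by
          have := h2 p (hE hp)
          field_simp; ring
      have e2 : ∑ p ∈ E, (-1 / (p : ℝ) ^ 2 * (-2 * Real.log p) + 2 / (p : ℝ) * (-Real.log p))
            / (-1 / (p : ℝ) ^ 2 + 2 / (p : ℝ))
          = ∑ p ∈ E, ((2 - 2 * p) / (2 * p - 1) * Real.log p) :=
        Finset.sum_congr rfl fun p hp => by
          have := h2 p (hE hp)
          have h3 : (2 * p - 1 : ℝ) ≠ 0 := by linarith
          have h4 : (-1 / (p : ℝ) ^ 2 + 2 / (p : ℝ)) = (2 * p - 1) / (p : ℝ) ^ 2 := by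
            field_simp; ring
          rw [h4]
          field_simp; ring
      rw [e1, e2]; ring
    · intro p hp
      have := h2 p (hE hp)
      have h4 : (-1 / (p : ℝ) ^ 2 + 2 / (p : ℝ)) = (2 * p - 1) / (p : ℝ) ^ 2 := by
        field_simp; ring
      rw [h4]
      have : (0 : ℝ) < 2 * p - 1 := by linarith
      positivity
  rw [Finset.sum_congr rfl hinner, ← Finset.mul_sum, sum_powerset_prod_mul_add, hitMain, ← hL]
  · congr 2
    · refine Finset.prod_congr rfl fun p hp => ?_
      rw [density6, ← add_div]; congr 1; ring
    · rw [sub_eq_add_neg, ← Finset.sum_neg_distrib]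
      congr 1
      refine Finset.sum_congr rfl fun p hp => ?_
      have := h2 p hp
      have h3 : (2 * p - 1 : ℝ) ≠ 0 := by linarith
      have h4 : (p - 1 : ℝ) ≠ 0 := by linarith
      have h5 : (6 * p - 5 : ℝ) ≠ 0 := by linarith
      have h6 : (2 * p - 1) / (p : ℝ) ^ 2 + 4 * ((p : ℝ) - 1) / (p : ℝ) ^ 2
          = (6 * p - 5) / (p : ℝ) ^ 2 := by rw [← add_div]; congr 1; ring
      rw [h6, logShift]
      field_simp; ring
  · intro p hp
    have := h2 p hp
    rw [← add_div]
    have : (0 : ℝ) < 2 * p - 1 + 4 * (p - 1) := by linarith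
    positivity

lemma sum_powerset_seven (C : Finset ℕ) :
    ∑ E ∈ C.powerset, ∑ κ ∈ E.powerset, (∏ _p ∈ E \ κ, (2 : ℝ)) * 4 ^ #(C \ E) = 7 ^ #C := by
  have h : ∀ E ∈ C.powerset, ∑ κ ∈ E.powerset, (∏ _p ∈ E \ κ, (2 : ℝ)) * 4 ^ #(C \ E)
      = (∏ _p ∈ E, (3 : ℝ)) * ∏ _p ∈ C \ E, (4 : ℝ) := by
    intro E _
    have := Finset.prod_add (fun _ => (1 : ℝ)) (fun _ => (2 : ℝ)) E
    rw [← Finset.sum_mul, Finset.prod_const 4, show (3 : ℝ) = 1 + 2 by norm_num, this]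
    simp
  rw [Finset.sum_congr rfl h, ← Finset.prod_add]
  norm_num

lemma exists_abs_hitSum_sub_le {q e : ℕ} (hq : 0 < q) (he : 0 < e) (a : ℕ) :
    ∃ D : ℕ, 0 < D ∧ ∀ (t : ℕ) (C : Finset ℕ) (B : (p : ℕ) → Finset (ZMod p)) (X : ℝ), 0 < t →
      (∀ p ∈ C, p.Prime ∧ Nat.Coprime q p) → ∏ p ∈ C, p ≤ t ^ (200 * e) →
      (∀ p ∈ C, (0 : ZMod p) ∉ B p ∧ #(B p) = 4) → 0 < X → X ≤ a * (t : ℝ) ^ (351 * e) →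
      |hitSum q B C X - hitMain q C X|
        ≤ D * (7 ^ #C * (X * t ^ 2 / (t ^ 100 * ∏ p ∈ C, (p : ℝ)) + (t : ℝ) ^ (150 * e + 110))) := by
  obtain ⟨D, hD, hdiv⟩ := exists_abs_divisorSum_sub_le hq he a
  refine ⟨D, hD, fun t C B X ht hC hCt hB hX hXle => ?_⟩
  have hCp : ∀ p ∈ C, p.Prime := fun p hp => (hC p hp).1
  rw [hitSum_eq hq hCp (fun p hp => (hB p hp).1), ← sum_divisorMain_eq hq hC hX,
    ← Finset.sum_sub_distrib]
  set Y : ℝ := X * t ^ 2 / (t ^ 100 * ∏ p ∈ C, (p : ℝ)) + (t : ℝ) ^ (150 * e + 110) with hY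
  have hmain : ∀ E ∈ C.powerset, ∀ κ ∈ E.powerset,
      |(∏ _p ∈ κ, (-1 : ℝ)) * (∏ _p ∈ E \ κ, (2 : ℝ)) * ∑ c ∈ rootSet q B (C \ E),
        classSum ((∏ p ∈ E, p) * ∏ p ∈ κ, p) (q * ∏ p ∈ C \ E, p) c X
        - (∏ _p ∈ κ, (-1 : ℝ)) * (∏ _p ∈ E \ κ, (2 : ℝ)) * (4 ^ #(C \ E)
      * divisorMain (q * ∏ p ∈ C \ E, p) (X / (((∏ p ∈ E, p) * ∏ p ∈ κ, p : ℕ) : ℝ)))|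
      ≤ ((∏ _p ∈ E \ κ, (2 : ℝ)) * 4 ^ #(C \ E)) * (D * Y) := by
    intro E hE κ hκ
    rw [mem_powerset] at hE hκ
    have hF : ∀ p ∈ C \ E, p.Prime ∧ Nat.Coprime q p := fun p hp => hC p (mem_sdiff.mp hp).1
    have hpos : ∀ s ⊆ C, 0 < ∏ p ∈ s, p := fun s hs =>
      Finset.prod_pos fun p hp => (hCp p (hs hp)).pos
    set g := (∏ p ∈ E, p) * ∏ p ∈ κ, p with hg
    set Q := q * ∏ p ∈ C \ E, p with hQ
    have hgpos : 0 < g := Nat.mul_pos (hpos E hE) (hpos κ (hκ.trans hE))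
    have hcopE : ∀ s ⊆ E, Nat.Coprime (∏ p ∈ s, p) Q := by
      intro s hs
      refine Nat.Coprime.prod_left fun p hp => Nat.Coprime.mul_right (hC p (hE (hs hp))).2.symm
        (Nat.Coprime.prod_right fun r hr => ?_)
      rw [mem_sdiff] at hr
      refine (Nat.coprime_primes (hCp p (hE (hs hp))) (hCp r hr.1)).mpr ?_
      rintro rfl
      exact hr.2 (hs hp)
    have hgQ : Nat.Coprime g Q := (hcopE E subset_rfl).mul_left (hcopE κ hκ)
    have hg1 : (1 : ℝ) ≤ g := by exact_mod_cast hgpos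
    have hgX : X / g ≤ X := div_le_self hX.le hg1
    have hprodle : ∏ p ∈ C \ E, p ≤ t ^ (200 * e) :=
      (Finset.prod_le_prod_of_subset_of_one_le' Finset.sdiff_subset
        fun p hp _ => (hCp p hp).pos).trans hCt
    have hCE : ∏ p ∈ C, (p : ℝ) ≤ g * ∏ p ∈ C \ E, (p : ℝ) := by
      have h1 : ∏ p ∈ C, p = (∏ p ∈ E, p) * ∏ p ∈ C \ E, p := by
        rw [mul_comm, Finset.prod_sdiff hE]
      have h2 : ∏ p ∈ C, p ≤ g * ∏ p ∈ C \ E, p := by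
        rw [h1, hg]
        exact Nat.mul_le_mul_right _ (Nat.le_mul_of_pos_right _ (hpos κ (hκ.trans hE)))
      have h3 : ((∏ p ∈ C, p : ℕ) : ℝ) ≤ ((g * ∏ p ∈ C \ E, p : ℕ) : ℝ) := Nat.cast_le.mpr h2
      rwa [Nat.cast_mul, Nat.cast_prod, Nat.cast_prod] at h3
    have hCpos : (0 : ℝ) < ∏ p ∈ C, (p : ℝ) :=
      Finset.prod_pos fun p hp => by exact_mod_cast (hCp p hp).pos
    have hc : ∀ c ∈ rootSet q B (C \ E), |classSum g Q c X - divisorMain Q (X / g)| ≤ D * Y := by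
      intro c hc
      obtain ⟨h1, h2⟩ := coprime_of_mem_rootSet (fun p hp => (hF p hp).1)
        (fun p hp => (hB p (mem_sdiff.mp hp).1).1) hc
      obtain ⟨u, hu⟩ := classSum_eq_divisorSum hgpos h2 hgQ h1 hX.le
      rw [hu]
      refine (hdiv t (C \ E) ht hF hprodle Q hQ u (X / g) (by positivity)
        (hgX.trans hXle)).trans ?_
      refine mul_le_mul_of_nonneg_left (add_le_add_left ?_ _) (by positivity)
      have ht' : (0 : ℝ) < t := by exact_mod_cast ht
      rw [div_mul_eq_mul_div, div_div]
      refine div_le_div_of_nonneg_left (by positivity) (by positivity) ?_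
      calc (t : ℝ) ^ 100 * ∏ p ∈ C, (p : ℝ) ≤ t ^ 100 * (g * ∏ p ∈ C \ E, (p : ℝ)) := by
            exact mul_le_mul_of_nonneg_left hCE (by positivity)
        _ = _ := by ring
    have hcard : (#(rootSet q B (C \ E)) : ℝ) = 4 ^ #(C \ E) := by
      rw [card_rootSet hq B _ hF, Finset.prod_congr rfl fun p hp => (hB p (mem_sdiff.mp hp).1).2]
      simp
    have hsum : |∑ c ∈ rootSet q B (C \ E), classSum g Q c X
        - 4 ^ #(C \ E) * divisorMain Q (X / g)| ≤ 4 ^ #(C \ E) * (D * Y) := by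
      rw [← hcard, ← nsmul_eq_mul, ← Finset.sum_const, ← Finset.sum_sub_distrib]
      refine (Finset.abs_sum_le_sum_abs _ _).trans ((Finset.sum_le_sum hc).trans_eq ?_)
      rw [Finset.sum_const, nsmul_eq_mul]
    rw [← mul_sub, abs_mul, abs_mul, Finset.abs_prod, Finset.abs_prod]
    simp only [abs_neg, abs_one, Finset.prod_const_one, one_mul, Nat.abs_ofNat]
    rw [mul_assoc]
    exact mul_le_mul_of_nonneg_left hsum (Finset.prod_nonneg fun _ _ => by norm_num)
  calc _ ≤ ∑ E ∈ C.powerset, ∑ κ ∈ E.powerset,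
        ((∏ _p ∈ E \ κ, (2 : ℝ)) * 4 ^ #(C \ E)) * (D * Y) := by
        refine (Finset.abs_sum_le_sum_abs _ _).trans (Finset.sum_le_sum fun E hE => ?_)
        rw [← Finset.sum_sub_distrib]
        exact (Finset.abs_sum_le_sum_abs _ _).trans (Finset.sum_le_sum fun κ hκ => hmain E hE κ hκ)
    _ = 7 ^ #C * (D * Y) := by
        simp only [← Finset.sum_mul]
        rw [← sum_powerset_seven C]
        simp only [← Finset.sum_mul]
    _ = _ := by ring

/-- The sieve weights diagonalising the quadratic form attached to the density `h / (1 + h)`. -/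
noncomputable def sieveWeight (h : ℕ → ℝ) (P : Finset ℕ) (z : Finset ℕ → ℝ) (A : Finset ℕ) : ℝ :=
  (∏ p ∈ A, (-(1 + h p))) * ∑ u ∈ (P \ A).powerset, (∏ p ∈ u, h p) * z (A ∪ u)

/-- The quadratic form with multiplicative density `k` evaluated at the sieve weights. -/
noncomputable def sieveForm (h k : ℕ → ℝ) (P : Finset ℕ) (z : Finset ℕ → ℝ) : ℝ :=
  ∑ A ∈ P.powerset, ∑ B ∈ P.powerset,
    sieveWeight h P z A * sieveWeight h P z B * ∏ p ∈ A ∪ B, k p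

lemma sieveWeight_insert_of_subset {h : ℕ → ℝ} {P A : Finset ℕ} {z : Finset ℕ → ℝ} {p : ℕ}
    (hp : p ∉ P) (hA : A ⊆ P) :
    sieveWeight h (insert p P) z A = sieveWeight h P (fun v => z v + h p * z (insert p v)) A := by
  have hpA : p ∉ A := fun h' => hp (hA h')
  have hp' : p ∉ P \ A := fun h' => hp (mem_sdiff.mp h').1
  rw [sieveWeight, sieveWeight, insert_sdiff_of_notMem _ hpA, sum_powerset_insert hp',
    ← sum_add_distrib]
  congr 1
  refine sum_congr rfl fun u hu => ?_
  rw [prod_insert (fun h' => hp' (mem_powerset.mp hu h')), union_insert]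
  ring

lemma sieveWeight_insert_insert {h : ℕ → ℝ} {P A : Finset ℕ} {z : Finset ℕ → ℝ} {p : ℕ}
    (hp : p ∉ P) (hA : A ⊆ P) :
    sieveWeight h (insert p P) z (insert p A)
      = -(1 + h p) * sieveWeight h P (fun v => z (insert p v)) A := by
  have hpA : p ∉ A := fun h' => hp (hA h')
  rw [sieveWeight, sieveWeight, insert_sdiff_insert, sdiff_insert_of_notMem hp, prod_insert hpA]
  simp only [insert_union]
  ring

lemma sieveWeight_add_mul (h : ℕ → ℝ) (P A : Finset ℕ) (x y : Finset ℕ → ℝ) (c : ℝ) :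
    sieveWeight h P (fun v => x v + c * y v) A = sieveWeight h P x A + c * sieveWeight h P y A := by
  simp only [sieveWeight, mul_add, sum_add_distrib, mul_sum]
  congr 1
  exact sum_congr rfl fun u _ => by ring

lemma sieveForm_insert {h k : ℕ → ℝ} {P : Finset ℕ} {z : Finset ℕ → ℝ} {p : ℕ} (hp : p ∉ P) :
    sieveForm h k (insert p P) z
      = (1 - k p) * sieveForm h k P (fun v => z v + h p * z (insert p v))
        + k p * sieveForm h k P (fun v => z v + (-1) * z (insert p v)) := by
  simp only [sieveForm]
  rw [sum_powerset_insert hp, mul_sum, mul_sum, ← sum_add_distrib, ← sum_add_distrib]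
  refine sum_congr rfl fun A hA => ?_
  rw [mem_powerset] at hA
  have hpA : p ∉ A := fun h' => hp (hA h')
  rw [sum_powerset_insert hp, sum_powerset_insert hp, mul_sum, mul_sum, ← sum_add_distrib,
    ← sum_add_distrib, ← sum_add_distrib, ← sum_add_distrib]
  refine sum_congr rfl fun B hB => ?_
  rw [mem_powerset] at hB
  have hpB : p ∉ B := fun h' => hp (hB h')
  have hpAB : p ∉ A ∪ B := by simp [hpA, hpB]
  rw [union_insert, insert_union, insert_union, union_insert, insert_idem, prod_insert hpAB,
    sieveWeight_insert_of_subset hp hA, sieveWeight_insert_of_subset hp hB,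
    sieveWeight_insert_insert hp hA, sieveWeight_insert_insert hp hB]
  simp only [sieveWeight_add_mul]
  ring

/-- Diagonalisation of the quadratic form. -/
lemma sieveForm_eq (h k : ℕ → ℝ) (P : Finset ℕ) (z : Finset ℕ → ℝ) :
    sieveForm h k P z = ∑ r ∈ P.powerset,
      (∏ p ∈ r, (h p ^ 2 * (1 - k p) + k p - (h p * (1 - k p) - k p) ^ 2))
        * (∑ m ∈ (P \ r).powerset, (∏ p ∈ m, (h p * (1 - k p) - k p)) * z (r ∪ m)) ^ 2 := by
  induction P using Finset.induction_on generalizing z with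
  | empty => simp [sieveForm, sieveWeight]; ring
  | insert p P hp ih =>
    rw [sieveForm_insert hp, ih, ih, sum_powerset_insert hp, mul_sum, mul_sum, ← sum_add_distrib,
      ← sum_add_distrib]
    refine sum_congr rfl fun r hr => ?_
    rw [mem_powerset] at hr
    have hpr : p ∉ r := fun h' => hp (hr h')
    have hp' : p ∉ P \ r := fun h' => hp (mem_sdiff.mp h').1
    have hadd : ∀ c : ℝ, ∑ m ∈ (P \ r).powerset, (∏ p ∈ m, (h p * (1 - k p) - k p))
          * (z (r ∪ m) + c * z (insert p (r ∪ m)))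
        = (∑ m ∈ (P \ r).powerset, (∏ p ∈ m, (h p * (1 - k p) - k p)) * z (r ∪ m))
          + c * ∑ m ∈ (P \ r).powerset,
            (∏ p ∈ m, (h p * (1 - k p) - k p)) * z (insert p (r ∪ m)) := by
      intro c
      rw [mul_sum, ← sum_add_distrib]
      exact sum_congr rfl fun m _ => by ring
    have hins : ∑ m ∈ (P \ r).powerset,
          (∏ q ∈ insert p m, (h q * (1 - k q) - k q)) * z (r ∪ insert p m)
        = (h p * (1 - k p) - k p) * ∑ m ∈ (P \ r).powerset,
            (∏ p ∈ m, (h p * (1 - k p) - k p)) * z (insert p (r ∪ m)) := by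
      rw [mul_sum]
      refine sum_congr rfl fun m hm => ?_
      rw [prod_insert (fun h' => hp' (mem_powerset.mp hm h')), union_insert]
      ring
    rw [hadd, hadd, insert_sdiff_of_notMem _ hpr, sum_powerset_insert hp', hins,
      insert_sdiff_insert, sdiff_insert_of_notMem hp, prod_insert hpr]
    simp only [insert_union]
    ring

/-- The diagonal case, `k = h / (1 + h)`. -/
lemma sieveForm_diag {h k : ℕ → ℝ} {P : Finset ℕ} (hk : ∀ p ∈ P, k p * (1 + h p) = h p)
    (z : Finset ℕ → ℝ) :
    sieveForm h k P z = ∑ r ∈ P.powerset, (∏ p ∈ r, h p) * z r ^ 2 := by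
  rw [sieveForm_eq]
  refine sum_congr rfl fun r hr => ?_
  rw [mem_powerset] at hr
  congr 1
  · refine prod_congr rfl fun p hp => ?_
    have := hk p (hr hp)
    rw [show h p * (1 - k p) - k p = 0 by linarith]
    linear_combination (1 - h p) * this
  · rw [sum_eq_single_of_mem ∅ (empty_mem_powerset _)]
    · simp
    · intro m hm hne
      obtain ⟨p, hp⟩ := nonempty_iff_ne_empty.mpr hne
      rw [prod_eq_zero hp, zero_mul]
      have := hk p (mem_sdiff.mp (mem_powerset.mp hm hp)).1
      linarith

lemma sieveForm_sub_erase {h k : ℕ → ℝ} {P : Finset ℕ} (hk : ∀ p ∈ P, k p * (1 + h p) = h p)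
    (z : Finset ℕ → ℝ) {p : ℕ} (hp : p ∈ P) :
    ∑ A ∈ P.powerset, ∑ B ∈ P.powerset, (if p ∈ A ∪ B then
      sieveWeight h P z A * sieveWeight h P z B * ∏ p ∈ A ∪ B, k p else 0)
    = -∑ r ∈ (P.erase p).powerset, (∏ p ∈ r, h p) * (h p *
        (2 * z r * z (insert p r) - (1 - h p) * z (insert p r) ^ 2)) := by
  have hpP : p ∉ P.erase p := notMem_erase p P
  have h1 : ∑ A ∈ P.powerset, ∑ B ∈ P.powerset, (if p ∈ A ∪ B then
      sieveWeight h P z A * sieveWeight h P z B * ∏ p ∈ A ∪ B, k p else 0)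
      = sieveForm h k P z - sieveForm h (fun q => if q = p then 0 else k q) P z := by
    simp only [sieveForm]
    rw [← sum_sub_distrib]
    refine sum_congr rfl fun A _ => ?_
    rw [← sum_sub_distrib]
    refine sum_congr rfl fun B _ => ?_
    split_ifs with h'
    · rw [prod_eq_zero (f := fun q => if q = p then 0 else k q) h' (by simp)]
      ring
    · rw [eq_comm, sub_eq_zero]
      congr 1
      refine prod_congr rfl fun q hq => ?_
      rw [if_neg]
      rintro rfl
      exact h' hq
  have hk' : ∀ q ∈ P.erase p, (fun q => if q = p then 0 else k q) q * (1 + h q) = h q := by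
    intro q hq
    simp only [if_neg (ne_of_mem_erase hq)]
    exact hk q (mem_of_mem_erase hq)
  have h2 : sieveForm h (fun q => if q = p then 0 else k q) P z
      = ∑ r ∈ (P.erase p).powerset, (∏ p ∈ r, h p) * (z r + h p * z (insert p r)) ^ 2 := by
    conv_lhs => rw [← insert_erase hp]
    rw [sieveForm_insert hpP, sieveForm_diag hk']
    simp
  rw [h1, h2, sieveForm_diag hk]
  conv_lhs => rw [← insert_erase hp]
  rw [sum_powerset_insert hpP]
  simp only [erase_insert_eq_erase, erase_idem]
  rw [← sum_add_distrib, ← sum_sub_distrib, ← sum_neg_distrib]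
  refine sum_congr rfl fun r hr => ?_
  rw [prod_insert (fun h' => hpP (mem_powerset.mp hr h'))]
  ring

lemma log_factorial_eq_sum_primes (n : ℕ) :
    Real.log n.factorial
      = ∑ p ∈ (Icc 1 n).filter Nat.Prime, (n.factorial.factorization p : ℝ) * Real.log p := by
  rw [Real.log_nat_eq_sum_factorization, Finsupp.sum]
  refine sum_subset (fun p hp => ?_) fun p hp hp' => ?_
  · rw [Nat.support_factorization, Nat.mem_primeFactors] at hp
    exact mem_filter.mpr ⟨mem_Icc.mpr ⟨hp.1.pos, (hp.1.dvd_factorial).mp hp.2.1⟩, hp.1⟩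
  · rw [Finsupp.notMem_support_iff.mp hp']
    simp

lemma sum_log_div_sub_one_ge {n : ℕ} (hn : 0 < n) :
    Real.log n - 1 ≤ ∑ p ∈ (Icc 1 n).filter Nat.Prime, Real.log p / ((p : ℝ) - 1) := by
  have hn' : (0 : ℝ) < n := by exact_mod_cast hn
  have h1 : (n : ℝ) * Real.log n - n ≤ Real.log n.factorial := by
    have := Stirling.le_log_factorial_stirling hn.ne'
    have h2 : 0 ≤ Real.log n := Real.log_natCast_nonneg n
    have h3 : 0 ≤ Real.log (2 * Real.pi) :=
      Real.log_nonneg (by have := Real.pi_gt_three; linarith)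
    linarith
  have h2 : Real.log n.factorial
      ≤ n * ∑ p ∈ (Icc 1 n).filter Nat.Prime, Real.log p / ((p : ℝ) - 1) := by
    rw [log_factorial_eq_sum_primes, mul_sum]
    refine sum_le_sum fun p hp => ?_
    have hpp := (mem_filter.mp hp).2
    have hp1 : (1 : ℝ) < p := by exact_mod_cast hpp.one_lt
    have h3 : ((p : ℝ) - 1) * n.factorial.factorization p ≤ n := by
      have h4 := Nat.sub_one_mul_factorization_factorial (n := n) hpp
      have h5 : (p - 1) * n.factorial.factorization p ≤ n := h4.trans_le (Nat.sub_le _ _)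
      have h6 : (((p - 1 : ℕ) : ℝ)) * n.factorial.factorization p ≤ n := by exact_mod_cast h5
      rwa [Nat.cast_sub hpp.one_lt.le, Nat.cast_one] at h6
    have hl : 0 ≤ Real.log p := Real.log_natCast_nonneg p
    rw [← mul_div_assoc, mul_div_right_comm]
    refine mul_le_mul_of_nonneg_right ?_ hl
    rw [le_div_iff₀ (by linarith)]
    linarith
  have h3 : (n : ℝ) * (Real.log n - 1)
      ≤ n * ∑ p ∈ (Icc 1 n).filter Nat.Prime, Real.log p / ((p : ℝ) - 1) := by linarith
  exact le_of_mul_le_mul_left h3 hn'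

lemma sum_log_div_le {n : ℕ} (hn : 0 < n) :
    ∑ p ∈ (Icc 1 n).filter Nat.Prime, Real.log p / (p : ℝ) ≤ Real.log n + Real.log 4 := by
  have hn' : (0 : ℝ) < n := by exact_mod_cast hn
  have h1 : Real.log n.factorial ≤ (n : ℝ) * Real.log n := by
    rw [← Real.log_pow]
    exact Real.log_le_log (by exact_mod_cast n.factorial_pos)
      (by exact_mod_cast Nat.factorial_le_pow n)
  have h2 : ∑ p ∈ (Icc 1 n).filter Nat.Prime, ((n : ℝ) / p - 1) * Real.log p
      ≤ Real.log n.factorial := by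
    rw [log_factorial_eq_sum_primes]
    refine sum_le_sum fun p hp => ?_
    have hpp := (mem_filter.mp hp).2
    refine mul_le_mul_of_nonneg_right ?_ (Real.log_natCast_nonneg p)
    have h3 : n / p ≤ n.factorial.factorization p := by
      rw [Nat.factorization_factorial hpp (b := Nat.log p n + 2) (by omega)]
      calc n / p = n / p ^ 1 := by rw [pow_one]
        _ ≤ _ := single_le_sum (f := fun i => n / p ^ i) (fun _ _ => Nat.zero_le _)
          (mem_Ico.mpr ⟨le_rfl, by omega⟩)
    have h4 : ((n / p : ℕ) : ℝ) ≤ n.factorial.factorization p := by exact_mod_cast h3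
    have h5 := Nat.lt_div_mul_add hpp.pos (a := n)
    have hp0 : (0 : ℝ) < p := by exact_mod_cast hpp.pos
    have h6 : (n : ℝ) < (n / p : ℕ) * p + p := by exact_mod_cast h5
    have h7 : (n : ℝ) / p - 1 ≤ (n / p : ℕ) := by
      rw [sub_le_iff_le_add, div_le_iff₀ hp0]; linarith
    linarith
  have h3 : ∑ p ∈ (Icc 1 n).filter Nat.Prime, Real.log p ≤ Real.log 4 * n := by
    have := Chebyshev.theta_le_log4_mul_x (x := (n : ℝ)) hn'.le
    rw [Chebyshev.theta_eq_sum_Icc, Nat.floor_natCast] at this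
    refine (sum_le_sum_of_subset_of_nonneg ?_ fun p _ _ => Real.log_natCast_nonneg p).trans this
    exact filter_subset_filter _ (Icc_subset_Icc_left (Nat.zero_le 1))
  have h4 : ∑ p ∈ (Icc 1 n).filter Nat.Prime, ((n : ℝ) / p - 1) * Real.log p
      = n * ∑ p ∈ (Icc 1 n).filter Nat.Prime, Real.log p / (p : ℝ)
        - ∑ p ∈ (Icc 1 n).filter Nat.Prime, Real.log p := by
    rw [mul_sum, ← sum_sub_distrib]
    exact sum_congr rfl fun p _ => by ring
  refine le_of_mul_le_mul_left ?_ hn'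
  linarith

lemma exists_sum_log_div_sq_le :
    ∃ K : ℝ, 0 ≤ K ∧ ∀ I : Finset ℕ, ∑ n ∈ I, Real.log n / (n : ℝ) ^ 2 ≤ K := by
  have hs : Summable fun n : ℕ => Real.log n / (n : ℝ) ^ 2 := by
    refine Summable.of_nonneg_of_le (fun n => div_nonneg (Real.log_natCast_nonneg n) (by positivity))
      (fun n => ?_) ((Real.summable_nat_rpow_inv (p := 3 / 2)).mpr (by norm_num) |>.mul_left 2)
    rcases Nat.eq_zero_or_pos n with rfl | hn
    · simp
    · have hn' : (0 : ℝ) < n := by exact_mod_cast hn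
      have := Real.log_le_rpow_div (x := (n : ℝ)) (ε := 1 / 2) hn'.le (by norm_num)
      rw [div_le_iff₀ (by positivity)]
      refine this.trans (le_of_eq ?_)
      rw [← Real.rpow_neg hn'.le, ← Real.rpow_natCast, mul_assoc, ← Real.rpow_add hn']
      norm_num
      ring
  exact ⟨∑' n : ℕ, Real.log n / (n : ℝ) ^ 2, tsum_nonneg fun n =>
      div_nonneg (Real.log_natCast_nonneg n) (by positivity),
    fun I => hs.sum_le_tsum I fun n _ => div_nonneg (Real.log_natCast_nonneg n) (by positivity)⟩

/-- The primes `p` with `w < p ≤ R`. -/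
def sievePrimes (w R : ℕ) : Finset ℕ := (Ioc w R).filter Nat.Prime

lemma mem_sievePrimes {w R p : ℕ} : p ∈ sievePrimes w R ↔ (w < p ∧ p ≤ R) ∧ p.Prime := by
  simp [sievePrimes]

/-- Mertens' estimate for a function close to `a / p`. -/
lemma exists_abs_sum_mul_log_sub_le (w : ℕ) (f : ℕ → ℝ) {a b : ℝ}
    (hf : ∀ p, w < p → p.Prime → |f p - a / p| ≤ b / (p : ℝ) ^ 2) :
    ∃ K : ℝ, 0 ≤ K ∧ ∀ R : ℕ, ∀ y : ℝ, 0 ≤ y → y ≤ Real.log R →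
      |∑ p ∈ (sievePrimes w R).filter (fun p : ℕ => Real.log p ≤ y), f p * Real.log p - a * y| ≤ K := by
  obtain ⟨K, hK, hsum⟩ := exists_sum_log_div_sq_le
  set E : ℝ := ∑ p ∈ (Icc 1 w).filter Nat.Prime, Real.log p / p with hE
  have hE0 : 0 ≤ E := sum_nonneg fun p _ => div_nonneg (Real.log_natCast_nonneg p) (by positivity)
  have hl4 : 0 ≤ Real.log 4 := Real.log_nonneg (by norm_num)
  have hl2 : 0 ≤ Real.log 2 := Real.log_nonneg (by norm_num)
  refine ⟨|b| * K + |a| * (E + 1 + 2 * K + Real.log 2 + Real.log 4), by positivity,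
    fun R y hy hyR => ?_⟩
  set n := ⌊Real.exp y⌋₊ with hn
  have he1 : 1 ≤ Real.exp y := Real.one_le_exp hy
  have hn0 : 0 < n := Nat.floor_pos.mpr he1
  have hn' : (0 : ℝ) < n := by exact_mod_cast hn0
  have hny : Real.log n ≤ y := by
    rw [← Real.log_exp y]
    exact Real.log_le_log hn' (Nat.floor_le (Real.exp_pos y).le)
  have hyn : y ≤ Real.log n + Real.log 2 := by
    rw [← Real.log_mul hn'.ne' (by norm_num), Real.le_log_iff_exp_le (by positivity)]
    have h1 := Nat.lt_floor_add_one (Real.exp y)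
    have h2 : (1 : ℝ) ≤ n := by exact_mod_cast hn0
    rw [← hn] at h1
    linarith
  have hRpos : 0 < R ∨ R = 0 := (Nat.eq_zero_or_pos R).symm
  set S := (sievePrimes w R).filter (fun p : ℕ => Real.log p ≤ y) with hS
  have hmem : ∀ p, p ∈ S ↔ (w < p ∧ p ≤ n) ∧ p.Prime := by
    intro p
    rw [hS, mem_filter, mem_sievePrimes]
    constructor
    · rintro ⟨⟨⟨h1, h2⟩, h3⟩, h4⟩
      refine ⟨⟨h1, Nat.le_floor ?_⟩, h3⟩
      exact (Real.log_le_iff_le_exp (by exact_mod_cast h3.pos)).mp h4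
    · rintro ⟨⟨h1, h2⟩, h3⟩
      have hp0 : (0 : ℝ) < p := by exact_mod_cast h3.pos
      have h4 : Real.log p ≤ Real.log n := Real.log_le_log hp0 (by exact_mod_cast h2)
      refine ⟨⟨⟨h1, ?_⟩, h3⟩, h4.trans hny⟩
      rcases hRpos with hR | hR
      · have h5 : Real.log p ≤ Real.log R := h4.trans (hny.trans hyR)
        have := (Real.log_le_log_iff hp0 (by exact_mod_cast hR)).mp h5
        exact_mod_cast this
      · have h5 : Real.log p ≤ Real.log R := h4.trans (hny.trans hyR)
        rw [hR, Nat.cast_zero, Real.log_zero] at h5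
        have : 0 < Real.log p := Real.log_pos (by exact_mod_cast h3.one_lt)
        linarith
  have h1 : |∑ p ∈ S, f p * Real.log p - a * ∑ p ∈ S, Real.log p / p| ≤ |b| * K := by
    rw [mul_sum, ← sum_sub_distrib]
    refine (abs_sum_le_sum_abs _ _).trans ?_
    calc ∑ p ∈ S, |f p * Real.log p - a * (Real.log p / p)|
        ≤ ∑ p ∈ S, |b| * (Real.log p / (p : ℝ) ^ 2) := by
          refine sum_le_sum fun p hp => ?_
          obtain ⟨⟨h1, _⟩, h3⟩ := (hmem p).mp hp
          have hl : 0 ≤ Real.log p := Real.log_natCast_nonneg p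
          rw [show f p * Real.log p - a * (Real.log p / p) = (f p - a / p) * Real.log p by ring,
            abs_mul, abs_of_nonneg hl]
          calc |f p - a / p| * Real.log p ≤ b / (p : ℝ) ^ 2 * Real.log p :=
                mul_le_mul_of_nonneg_right (hf p h1 h3) hl
            _ = b * (Real.log p / (p : ℝ) ^ 2) := by ring
            _ ≤ _ := mul_le_mul_of_nonneg_right (le_abs_self b)
              (div_nonneg hl (by positivity))
      _ ≤ _ := by
          rw [← mul_sum]
          exact mul_le_mul_of_nonneg_left (hsum S) (abs_nonneg b)
  have h2 : |∑ p ∈ S, Real.log p / p - y| ≤ E + 1 + 2 * K + Real.log 2 + Real.log 4 := by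
    have hup : ∑ p ∈ S, Real.log p / (p : ℝ) ≤ Real.log n + Real.log 4 := by
      refine (sum_le_sum_of_subset_of_nonneg (fun p hp => ?_) fun p _ _ =>
        div_nonneg (Real.log_natCast_nonneg p) (by positivity)).trans (sum_log_div_le hn0)
      obtain ⟨⟨_, h2⟩, h3⟩ := (hmem p).mp hp
      exact mem_filter.mpr ⟨mem_Icc.mpr ⟨h3.pos, h2⟩, h3⟩
    have hlow : Real.log n - 1 ≤ ∑ p ∈ S, Real.log p / (p : ℝ) + E + 2 * K := by
      calc Real.log n - 1 ≤ _ := sum_log_div_sub_one_ge hn0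
        _ ≤ ∑ p ∈ (Icc 1 n).filter Nat.Prime,
            (Real.log p / (p : ℝ) + 2 * (Real.log p / (p : ℝ) ^ 2)) := by
          refine sum_le_sum fun p hp => ?_
          have hpp := (mem_filter.mp hp).2
          have hp2 : (2 : ℝ) ≤ p := by exact_mod_cast hpp.two_le
          have hl : 0 ≤ Real.log p := Real.log_natCast_nonneg p
          rw [show Real.log p / (p : ℝ) + 2 * (Real.log p / (p : ℝ) ^ 2)
            = Real.log p * ((p + 2) / (p : ℝ) ^ 2) by field_simp, div_eq_mul_one_div]
          refine mul_le_mul_of_nonneg_left ?_ hl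
          rw [div_le_div_iff₀ (by linarith) (by positivity)]
          nlinarith
        _ = ∑ p ∈ (Icc 1 n).filter Nat.Prime, Real.log p / (p : ℝ)
            + 2 * ∑ p ∈ (Icc 1 n).filter Nat.Prime, Real.log p / (p : ℝ) ^ 2 := by
          rw [sum_add_distrib, mul_sum]
        _ ≤ (∑ p ∈ S, Real.log p / (p : ℝ) + E) + 2 * K := by
          refine add_le_add ?_ (mul_le_mul_of_nonneg_left (hsum _) (by norm_num))
          rw [hE]
          have hnn : ∀ p : ℕ, 0 ≤ Real.log p / (p : ℝ) := fun p =>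
            div_nonneg (Real.log_natCast_nonneg p) (by positivity)
          rw [← sum_union_inter]
          refine le_trans (sum_le_sum_of_subset_of_nonneg (fun p hp => ?_) fun p _ _ => hnn p)
            (le_add_of_nonneg_right (sum_nonneg fun p _ => hnn p))
          rw [mem_filter, mem_Icc] at hp
          rw [mem_union, hmem, mem_filter, mem_Icc]
          rcases lt_or_ge w p with h | h
          · exact Or.inl ⟨⟨h, hp.1.2⟩, hp.2⟩
          · exact Or.inr ⟨⟨hp.1.1, h⟩, hp.2⟩
    rw [abs_le]
    constructor <;> linarith
  calc |∑ p ∈ S, f p * Real.log p - a * y|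
      = |(∑ p ∈ S, f p * Real.log p - a * ∑ p ∈ S, Real.log p / p)
          + a * (∑ p ∈ S, Real.log p / p - y)| := by congr 1; ring
    _ ≤ _ := (abs_add_le _ _).trans (add_le_add h1 (by
        rw [abs_mul]; exact mul_le_mul_of_nonneg_left h2 (abs_nonneg a)))

lemma sum_filter_sub_pow_succ {ι : Type*} (I : Finset ι) (w x : ι → ℝ) (n : ℕ) (y : ℝ) :
    ∑ i ∈ I.filter (fun i => x i ≤ y), w i * (y - x i) ^ (n + 1)
      = ∑ i ∈ I, w i * max (y - x i) 0 ^ (n + 1) := by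
  rw [sum_filter]
  refine sum_congr rfl fun i _ => ?_
  split_ifs with h
  · rw [max_eq_left (by linarith)]
  · rw [max_eq_right (by linarith)]; simp

lemma hasDerivWithinAt_max_sub_pow (x y : ℝ) (n : ℕ) :
    HasDerivWithinAt (fun y => max (y - x) 0 ^ (n + 1))
      (if x ≤ y then (n + 1) * (y - x) ^ n else 0) (Set.Ici y) y := by
  split_ifs with h
  · have h1 : HasDerivAt (fun y => (y - x) ^ (n + 1)) ((n + 1) * (y - x) ^ n) y := by
      have := ((hasDerivAt_id y).sub_const x).fun_pow (n + 1)
      refine this.congr_deriv ?_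
      simp
    refine h1.hasDerivWithinAt.congr (fun z hz => ?_) ?_
    · rw [max_eq_left (by have : y ≤ z := hz; linarith)]
    · rw [max_eq_left (by linarith)]
  · push Not at h
    have h1 : (fun y => max (y - x) 0 ^ (n + 1)) =ᶠ[nhds y] fun _ => 0 := by
      filter_upwards [Iio_mem_nhds h] with z hz
      rw [max_eq_right (by have : z < x := hz; linarith)]
      simp
    exact ((hasDerivAt_const y (0 : ℝ)).congr_of_eventuallyEq h1).hasDerivWithinAt

/-- Partial summation against powers: an upper bound for the counting function gives an upper bound
for its Riesz means. -/
lemma sum_mul_sub_pow_le {ι : Type*} (I : Finset ι) (w x : ι → ℝ) {κ C b : ℝ} (n : ℕ)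
    (hx : ∀ i ∈ I, 0 ≤ x i) (hb : 0 ≤ b)
    (hB : ∀ y, 0 ≤ y → y ≤ b → ∑ i ∈ I.filter (fun i => x i ≤ y), w i ≤ κ * y + C) :
    ∑ i ∈ I.filter (fun i => x i ≤ b), w i * (b - x i) ^ n
      ≤ κ * b ^ (n + 1) / (n + 1) + C * b ^ n := by
  suffices h : ∀ y ∈ Set.Icc 0 b, ∑ i ∈ I.filter (fun i => x i ≤ y), w i * (y - x i) ^ n
      ≤ κ * y ^ (n + 1) / (n + 1) + C * y ^ n from h b ⟨hb, le_rfl⟩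
  induction n with
  | zero => intro y hy; simpa using hB y hy.1 hy.2
  | succ n ih =>
    intro y hy
    refine image_le_of_deriv_right_le_deriv_boundary
      (f := fun y => ∑ i ∈ I.filter (fun i => x i ≤ y), w i * (y - x i) ^ (n + 1))
      (f' := fun y => (n + 1) * ∑ i ∈ I.filter (fun i => x i ≤ y), w i * (y - x i) ^ n)
      (B := fun y => κ * y ^ (n + 1 + 1) / ((n + 1 : ℕ) + 1) + C * y ^ (n + 1))
      (B' := fun y => (n + 1) * (κ * y ^ (n + 1) / (n + 1) + C * y ^ n)) ?_ ?_ ?_ ?_ ?_ ?_ hy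
    · simp only [sum_filter_sub_pow_succ]
      fun_prop
    · intro y hy
      simp only [sum_filter_sub_pow_succ]
      have h1 := HasDerivWithinAt.fun_sum (u := I) (x := y) (s := Set.Ici y)
        fun i _ => (hasDerivWithinAt_max_sub_pow (x i) y n).const_mul (w i)
      refine h1.congr_deriv ?_
      rw [mul_sum, sum_filter]
      refine sum_congr rfl fun i _ => ?_
      split_ifs <;> ring
    · simp only [sum_filter_sub_pow_succ]
      refine le_of_eq ?_
      rw [sum_eq_zero fun i hi => ?_]
      · simp
      · rw [max_eq_right (by linarith [hx i hi])]; simp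
    · fun_prop
    · intro y hy
      have h1 : HasDerivAt (fun y : ℝ => κ * y ^ (n + 1 + 1) / ((n + 1 : ℕ) + 1) + C * y ^ (n + 1))
          ((n + 1) * (κ * y ^ (n + 1) / (n + 1) + C * y ^ n)) y := by
        have h2 := ((hasDerivAt_pow (n + 1 + 1) y).const_mul κ).div_const ((n + 1 : ℕ) + 1 : ℝ)
        have h3 := (hasDerivAt_pow (n + 1) y).const_mul C
        refine (h2.fun_add h3).congr_deriv ?_
        push_cast
        have : (n : ℝ) + 1 ≠ 0 := by positivity
        have : (n : ℝ) + 1 + 1 ≠ 0 := by positivity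
        field_simp
      exact h1.hasDerivWithinAt
    · intro y hy
      exact mul_le_mul_of_nonneg_left (ih y ⟨hy.1, hy.2.le⟩) (by positivity)

lemma le_sum_mul_sub_pow {ι : Type*} (I : Finset ι) (w x : ι → ℝ) {κ C b : ℝ} (n : ℕ)
    (hx : ∀ i ∈ I, 0 ≤ x i) (hb : 0 ≤ b)
    (hB : ∀ y, 0 ≤ y → y ≤ b → κ * y - C ≤ ∑ i ∈ I.filter (fun i => x i ≤ y), w i) :
    κ * b ^ (n + 1) / (n + 1) - C * b ^ n
      ≤ ∑ i ∈ I.filter (fun i => x i ≤ b), w i * (b - x i) ^ n := by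
  have := sum_mul_sub_pow_le I (fun i => -w i) x (κ := -κ) (C := C) n hx hb fun y h1 h2 => by
    have := hB y h1 h2
    rw [sum_neg_distrib]
    linarith
  simp only [neg_mul, sum_neg_distrib, neg_div] at this
  linarith

lemma abs_sum_mul_sub_pow_sub_le {ι : Type*} (I : Finset ι) (w x : ι → ℝ) {κ C b : ℝ} (n : ℕ)
    (hx : ∀ i ∈ I, 0 ≤ x i) (hb : 0 ≤ b)
    (hB : ∀ y, 0 ≤ y → y ≤ b → |∑ i ∈ I.filter (fun i => x i ≤ y), w i - κ * y| ≤ C) :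
    |∑ i ∈ I.filter (fun i => x i ≤ b), w i * (b - x i) ^ n - κ * b ^ (n + 1) / (n + 1)|
      ≤ C * b ^ n := by
  have h1 := sum_mul_sub_pow_le I w x (κ := κ) (C := C) n hx hb fun y h1 h2 => by
    linarith [(abs_le.mp (hB y h1 h2)).2]
  have h2 := le_sum_mul_sub_pow I w x (κ := κ) (C := C) n hx hb fun y h1 h2 => by
    linarith [(abs_le.mp (hB y h1 h2)).1]
  rw [abs_le]
  constructor <;> linarith

/-- The sum of `1 / n` over the `n ≤ x` all of whose prime factors lie in `S`. -/
noncomputable def factoredHarmonic (S : Finset ℕ) (x : ℕ) : ℝ :=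
  ∑ n ∈ (Icc 1 x).filter (fun n : ℕ => n.primeFactors ⊆ S), (1 : ℝ) / n

lemma factoredHarmonic_insert {S : Finset ℕ} {p : ℕ} (hp : p.Prime) (hpS : p ∉ S) (x : ℕ) :
    factoredHarmonic (insert p S) x
      = factoredHarmonic S x + 1 / p * factoredHarmonic (insert p S) (x / p) := by
  have hp0 : (p : ℝ) ≠ 0 := by exact_mod_cast hp.ne_zero
  rw [factoredHarmonic, ← sum_filter_not_add_sum_filter _ (fun n => p ∣ n), filter_filter,
    filter_filter]
  congr 1
  · rw [factoredHarmonic]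
    refine sum_congr (filter_congr fun n hn => ?_) fun _ _ => rfl
    have hn0 : n ≠ 0 := by have := (mem_Icc.mp hn).1; omega
    constructor
    · rintro ⟨h1, h2⟩ r hr
      refine (mem_insert.mp (h1 hr)).resolve_left ?_
      rintro rfl
      exact h2 (Nat.dvd_of_mem_primeFactors hr)
    · exact fun h => ⟨h.trans (subset_insert _ _),
        fun h' => hpS (h (Nat.mem_primeFactors.mpr ⟨hp, h', hn0⟩))⟩
  · rw [factoredHarmonic, mul_sum, eq_comm]
    refine sum_bij (fun n _ => p * n) ?_ ?_ ?_ ?_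
    · intro n hn
      rw [mem_filter, mem_Icc] at hn
      rw [mem_filter, mem_Icc]
      refine ⟨⟨Nat.mul_pos hp.pos hn.1.1, ?_⟩, ?_, dvd_mul_right p n⟩
      · rw [mul_comm]; exact (Nat.le_div_iff_mul_le hp.pos).mp hn.1.2
      · rw [Nat.primeFactors_mul hp.ne_zero (by omega), hp.primeFactors]
        exact union_subset (by simp) hn.2
    · intro a _ b _ h
      exact Nat.eq_of_mul_eq_mul_left hp.pos h
    · intro n hn
      rw [mem_filter, mem_Icc] at hn
      obtain ⟨m, rfl⟩ := hn.2.2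
      refine ⟨m, ?_, rfl⟩
      rw [mem_filter, mem_Icc]
      refine ⟨⟨Nat.pos_of_ne_zero (by rintro rfl; simp at hn), ?_⟩, ?_⟩
      · rw [Nat.le_div_iff_mul_le hp.pos, mul_comm]; exact hn.1.2
      · exact (Nat.primeFactors_mono (dvd_mul_left m p) (by omega)).trans hn.2.1
    · intro n _
      push_cast
      rw [div_mul_div_comm, one_mul]

lemma factoredHarmonic_mono (S : Finset ℕ) {x y : ℕ} (h : x ≤ y) :
    factoredHarmonic S x ≤ factoredHarmonic S y :=
  sum_le_sum_of_subset_of_nonneg (filter_subset_filter _ (Icc_subset_Icc_right h))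
    fun _ _ _ => by positivity

lemma factoredHarmonic_insert_le {S : Finset ℕ} {p : ℕ} (hp : p.Prime) (hpS : p ∉ S) (x : ℕ) :
    factoredHarmonic (insert p S) x ≤ p / ((p : ℝ) - 1) * factoredHarmonic S x := by
  have h1 := factoredHarmonic_insert hp hpS x
  have h2 := factoredHarmonic_mono (insert p S) (Nat.div_le_self x p)
  have hp1 : (1 : ℝ) < p := by exact_mod_cast hp.one_lt
  have h3 : factoredHarmonic (insert p S) x
      ≤ factoredHarmonic S x + 1 / p * factoredHarmonic (insert p S) x := by
    have := mul_le_mul_of_nonneg_left h2 (show (0 : ℝ) ≤ 1 / p by positivity)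
    linarith
  rw [div_mul_eq_mul_div, le_div_iff₀ (by linarith)]
  have h4 : factoredHarmonic (insert p S) x * p
      ≤ (factoredHarmonic S x + 1 / p * factoredHarmonic (insert p S) x) * p :=
    mul_le_mul_of_nonneg_right h3 (by linarith)
  have h5 : (factoredHarmonic S x + 1 / p * factoredHarmonic (insert p S) x) * p
      = factoredHarmonic S x * p + factoredHarmonic (insert p S) x := by
    field_simp
  linarith

lemma factoredHarmonic_insert_le' {S : Finset ℕ} {p : ℕ} (hp : p.Prime) (hpS : p ∉ S) (x : ℕ) :
    factoredHarmonic (insert p S) x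
      ≤ factoredHarmonic S x + 1 / ((p : ℝ) - 1) * factoredHarmonic S (x / p) := by
  rw [factoredHarmonic_insert hp hpS x]
  have hp1 : (1 : ℝ) < p := by exact_mod_cast hp.one_lt
  refine add_le_add_right ?_ _
  refine (mul_le_mul_of_nonneg_left (factoredHarmonic_insert_le hp hpS (x / p))
    (by positivity)).trans (le_of_eq ?_)
  have : (p : ℝ) - 1 ≠ 0 := by linarith
  field_simp

lemma factoredHarmonic_le {S : Finset ℕ} (hS : ∀ p ∈ S, p.Prime) (U : Finset ℕ) (x : ℕ) :
    factoredHarmonic S x ≤ (∏ p ∈ S ∩ U, (p / ((p : ℝ) - 1)))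
      * ∑ m ∈ (S \ U).powerset.filter (fun m => ∏ p ∈ m, p ≤ x), ∏ p ∈ m, (1 / ((p : ℝ) - 1)) := by
  induction S using Finset.induction_on generalizing x with
  | empty =>
    simp only [factoredHarmonic, subset_empty, Nat.primeFactors_eq_empty]
    rcases Nat.eq_zero_or_pos x with rfl | hx
    · simp only [Icc_eq_empty_of_lt Nat.zero_lt_one, filter_empty, sum_empty]
      rw [empty_sdiff, empty_inter, prod_empty, one_mul]
      refine sum_nonneg fun m hm => ?_
      rw [mem_filter, powerset_empty, mem_singleton] at hm
      rw [hm.1, prod_empty]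
      exact zero_le_one
    · have h1 : (Icc 1 x).filter (fun n => n = 0 ∨ n = 1) = {1} := by
        ext n; simp; omega
      rw [h1]
      have h2 : (∅ \ U : Finset ℕ).powerset.filter (fun m => ∏ p ∈ m, p ≤ x) = {∅} := by
        ext m; simp
        rintro rfl; simpa using Nat.succ_le_of_lt hx
      rw [h2]
      simp
  | insert p S hpS ih =>
    have hp := hS p (mem_insert_self p S)
    have hp1 : (1 : ℝ) < p := by exact_mod_cast hp.one_lt
    have ih' := ih fun q hq => hS q (mem_insert_of_mem hq)
    by_cases hU : p ∈ U
    · rw [insert_sdiff_of_mem _ hU, insert_inter_of_mem hU,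
        prod_insert (fun h => hpS (mem_inter.mp h).1), mul_assoc]
      exact (factoredHarmonic_insert_le hp hpS x).trans
        (mul_le_mul_of_nonneg_left (ih' x) (div_nonneg (by linarith) (by linarith)))
    · have hpSU : p ∉ S \ U := fun h => hpS (mem_sdiff.mp h).1
      rw [insert_sdiff_of_notMem _ hU, insert_inter_of_notMem hU, sum_filter,
        sum_powerset_insert hpSU, mul_add]
      have h1 : ∑ m ∈ (S \ U).powerset, (if ∏ q ∈ insert p m, q ≤ x then
            ∏ q ∈ insert p m, (1 / ((q : ℝ) - 1)) else 0)
          = 1 / ((p : ℝ) - 1) * ∑ m ∈ (S \ U).powerset.filter (fun m => ∏ p ∈ m, p ≤ x / p),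
            ∏ p ∈ m, (1 / ((p : ℝ) - 1)) := by
        rw [sum_filter, mul_sum]
        refine sum_congr rfl fun m hm => ?_
        have hpm : p ∉ m := fun h => hpSU (mem_powerset.mp hm h)
        rw [prod_insert hpm, prod_insert hpm]
        simp only [Nat.le_div_iff_mul_le hp.pos, mul_comm p]
        split_ifs <;> simp
      rw [h1, ← sum_filter, mul_left_comm]
      exact (factoredHarmonic_insert_le' hp hpS x).trans (add_le_add (ih' x)
        (mul_le_mul_of_nonneg_left (ih' (x / p)) (by rw [one_div, inv_nonneg]; linarith)))

/-- The primes up to `w`. -/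
def smallPrimes (w : ℕ) : Finset ℕ := (Icc 1 w).filter Nat.Prime

lemma mem_smallPrimes {w p : ℕ} : p ∈ smallPrimes w ↔ p ≤ w ∧ p.Prime := by
  rw [smallPrimes, mem_filter, mem_Icc]
  exact ⟨fun h => ⟨h.1.2, h.2⟩, fun h => ⟨⟨h.2.pos, h.1⟩, h.2⟩⟩

/-- The product of `1 - 1 / p` over the primes up to `w`. -/
noncomputable def smallDensity (w : ℕ) : ℝ := ∏ p ∈ smallPrimes w, (1 - 1 / (p : ℝ))

lemma one_sub_inv_pos {p : ℕ} (hp : p.Prime) : 0 < 1 - 1 / (p : ℝ) := by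
  have hp1 : (1 : ℝ) < p := by exact_mod_cast hp.one_lt
  rw [sub_pos, div_lt_one (by linarith)]
  exact hp1

lemma smallDensity_pos (w : ℕ) : 0 < smallDensity w :=
  prod_pos fun _ hp => one_sub_inv_pos (mem_smallPrimes.mp hp).2

lemma smallDensity_le_one (w : ℕ) : smallDensity w ≤ 1 :=
  prod_le_one (fun _ hp => (one_sub_inv_pos (mem_smallPrimes.mp hp).2).le)
    fun p _ => by simp

lemma primeFactors_factorial (w : ℕ) : w.factorial.primeFactors = smallPrimes w := by
  ext p
  rw [mem_smallPrimes, Nat.mem_primeFactors]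
  constructor
  · rintro ⟨h1, h2, _⟩
    exact ⟨h1.dvd_factorial.mp h2, h1⟩
  · rintro ⟨h1, h2⟩
    exact ⟨h2, h2.dvd_factorial.mpr h1, w.factorial_ne_zero⟩

/-- The logarithm of the product of the elements of a set. -/
noncomputable def setLog (m : Finset ℕ) : ℝ := ∑ p ∈ m, Real.log p

lemma setLog_nonneg (m : Finset ℕ) : 0 ≤ setLog m :=
  sum_nonneg fun p _ => Real.log_natCast_nonneg p

lemma setLog_union {r m : Finset ℕ} (h : Disjoint r m) : setLog (r ∪ m) = setLog r + setLog m :=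
  sum_union h

lemma setLog_insert {r : Finset ℕ} {p : ℕ} (h : p ∉ r) :
    setLog (insert p r) = Real.log p + setLog r :=
  sum_insert h

lemma setLog_mono {r m : Finset ℕ} (h : r ⊆ m) : setLog r ≤ setLog m :=
  sum_le_sum_of_subset_of_nonneg h fun p _ _ => Real.log_natCast_nonneg p

lemma setLog_eq_log {m : Finset ℕ} (hm : ∀ p ∈ m, p.Prime) :
    setLog m = Real.log ((∏ p ∈ m, p : ℕ) : ℝ) := by
  rw [Nat.cast_prod, log_prod_primes hm, setLog]

lemma setLog_le_iff {m : Finset ℕ} (hm : ∀ p ∈ m, p.Prime) (y : ℝ) :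
    setLog m ≤ y ↔ ∏ p ∈ m, p ≤ ⌊Real.exp y⌋₊ := by
  have h0 : 0 < ∏ p ∈ m, p := prod_pos fun p hp => (hm p hp).pos
  rw [setLog_eq_log hm, Real.log_le_iff_le_exp (by exact_mod_cast h0),
    Nat.le_floor_iff (Real.exp_pos y).le]

lemma setLog_le_log_iff {m : Finset ℕ} (hm : ∀ p ∈ m, p.Prime) {R : ℕ} (hR : 0 < R) :
    setLog m ≤ Real.log R ↔ ∏ p ∈ m, p ≤ R := by
  rw [setLog_le_iff hm, Real.exp_log (by exact_mod_cast hR), Nat.floor_natCast]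

lemma smallDensity_mul_le {w R : ℕ} {r : Finset ℕ} (hr : r ⊆ sievePrimes w R) (hR : 0 < R) {y : ℝ}
    (hyR : y ≤ Real.log R) :
    smallDensity w * (∏ p ∈ r, (1 - 1 / (p : ℝ))) * y
      ≤ ∑ m ∈ (sievePrimes w R \ r).powerset.filter (fun m => setLog m ≤ y),
        ∏ p ∈ m, (1 / ((p : ℝ) - 1)) := by
  set x := ⌊Real.exp y⌋₊ with hx
  have hxR : x ≤ R := by
    rw [← Nat.floor_natCast (R := ℝ) R]
    exact Nat.floor_le_floor ((Real.le_log_iff_exp_le (by exact_mod_cast hR)).mp hyR)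
  have hSU : Disjoint (smallPrimes w) (sievePrimes w R) := by
    rw [disjoint_left]
    intro p hp hp'
    have h1 := (mem_smallPrimes.mp hp).1
    have h2 := (mem_sievePrimes.mp hp').1.1
    omega
  have hprime : ∀ p ∈ smallPrimes w ∪ sievePrimes w R, p.Prime := by
    intro p hp
    rcases mem_union.mp hp with h | h
    · exact (mem_smallPrimes.mp h).2
    · exact (mem_sievePrimes.mp h).2
  have h1 := factoredHarmonic_le hprime (smallPrimes w ∪ r) x
  have h2 : y ≤ factoredHarmonic (smallPrimes w ∪ sievePrimes w R) x := by
    have h3 : (harmonic x : ℝ) = factoredHarmonic (smallPrimes w ∪ sievePrimes w R) x := by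
      rw [harmonic_eq_sum_Icc, factoredHarmonic, filter_true_of_mem]
      · push_cast
        exact sum_congr rfl fun n _ => by rw [one_div]
      · intro n hn p hp
        have hpn := Nat.le_of_mem_primeFactors hp
        have hnx := (mem_Icc.mp hn).2
        have hpp := Nat.prime_of_mem_primeFactors hp
        rw [mem_union, mem_smallPrimes, mem_sievePrimes]
        rcases Nat.lt_or_ge w p with h | h
        · exact Or.inr ⟨⟨h, by omega⟩, hpp⟩
        · exact Or.inl ⟨h, hpp⟩
    rw [← h3]
    refine le_trans ?_ (log_add_one_le_harmonic x)
    rw [Real.le_log_iff_exp_le (by positivity)]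
    exact_mod_cast (Nat.lt_floor_add_one (Real.exp y)).le
  have h3 : (smallPrimes w ∪ sievePrimes w R) \ (smallPrimes w ∪ r) = sievePrimes w R \ r := by
    ext p
    simp only [mem_sdiff, mem_union]
    have := fun h : p ∈ sievePrimes w R => disjoint_right.mp hSU h
    tauto
  have h4 : (smallPrimes w ∪ sievePrimes w R) ∩ (smallPrimes w ∪ r) = smallPrimes w ∪ r :=
    inter_eq_right.mpr (union_subset_union_right hr)
  have h5 : Disjoint (smallPrimes w) r := disjoint_of_subset_right hr hSU
  rw [h3, h4, prod_union h5] at h1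
  have h6 : ∀ s : Finset ℕ, (∀ p ∈ s, p.Prime) →
      (∏ p ∈ s, (1 - 1 / (p : ℝ))) * ∏ p ∈ s, ((p : ℝ) / (p - 1)) = 1 := by
    intro s hs
    rw [← prod_mul_distrib]
    refine prod_eq_one fun p hp => ?_
    have hp1 : (1 : ℝ) < p := by exact_mod_cast (hs p hp).one_lt
    have : (p : ℝ) - 1 ≠ 0 := by linarith
    field_simp
  have hsm := h6 (smallPrimes w) fun p hp => (mem_smallPrimes.mp hp).2
  have hrp := h6 r fun p hp => (mem_sievePrimes.mp (hr hp)).2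
  have hpos : 0 ≤ smallDensity w * (∏ p ∈ r, (1 - 1 / (p : ℝ))) :=
    mul_nonneg (smallDensity_pos w).le
      (prod_nonneg fun p hp => (one_sub_inv_pos (mem_sievePrimes.mp (hr hp)).2).le)
  refine (mul_le_mul_of_nonneg_left (h2.trans h1) hpos).trans (le_of_eq ?_)
  have h7 : (sievePrimes w R \ r).powerset.filter (fun m => setLog m ≤ y)
      = (sievePrimes w R \ r).powerset.filter (fun m => ∏ p ∈ m, p ≤ x) := by
    refine filter_congr fun m hm => setLog_le_iff (fun p hp => ?_) y
    exact (mem_sievePrimes.mp (mem_sdiff.mp (mem_powerset.mp hm hp)).1).2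
  rw [h7, smallDensity]
  rw [show ∀ a b c d e : ℝ, a * b * (c * d * e) = (a * c) * (b * d) * e by intros; ring, hsm, hrp]
  ring

lemma exists_sum_inv_le (w : ℕ) : ∃ K : ℝ, 0 ≤ K ∧ ∀ R : ℕ, ∀ Q ⊆ sievePrimes w R, ∀ y : ℝ, 0 ≤ y →
    ∑ m ∈ Q.powerset.filter (fun m => setLog m ≤ y), ∏ p ∈ m, (1 / (p : ℝ))
      ≤ smallDensity w * y + K := by
  have hg : 0 < Real.eulerMascheroniConstant :=
    lt_trans (by norm_num) Real.one_half_lt_eulerMascheroniConstant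
  refine ⟨smallDensity w * (Real.eulerMascheroniConstant + logSum w.factorial)
    + 4 * 2 ^ #w.factorial.primeFactors, ?_, fun R Q hQ y hy => ?_⟩
  · have := logSum_nonneg w.factorial
    have := (smallDensity_pos w).le
    positivity
  set x := ⌊Real.exp y⌋₊ with hx
  have hx0 : 0 < x := Nat.floor_pos.mpr (Real.one_le_exp hy)
  have hx1 : (1 : ℝ) ≤ x := by exact_mod_cast hx0
  have hQp : ∀ m ∈ Q.powerset, ∀ p ∈ m, w < p ∧ p.Prime := fun m hm p hp => by
    have := mem_sievePrimes.mp (hQ (mem_powerset.mp hm hp))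
    exact ⟨this.1.1, this.2⟩
  have h1 : ∑ m ∈ Q.powerset.filter (fun m => setLog m ≤ y), ∏ p ∈ m, (1 / (p : ℝ))
      ≤ ∑ a ∈ Icc 1 x with Nat.Coprime a w.factorial, 1 / (a : ℝ) := by
    have h2 : ∑ m ∈ Q.powerset.filter (fun m => setLog m ≤ y), ∏ p ∈ m, (1 / (p : ℝ))
        = ∑ a ∈ (Q.powerset.filter (fun m => setLog m ≤ y)).image (fun m => ∏ p ∈ m, p),
          1 / (a : ℝ) := by
      rw [sum_image]
      · refine sum_congr rfl fun m _ => ?_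
        rw [prod_div_distrib, prod_const_one, Nat.cast_prod]
      · intro a ha b hb hab
        have h := congrArg Nat.primeFactors hab
        dsimp only at h
        rwa [primeFactors_prod_primes fun p hp => (hQp a (mem_filter.mp ha).1 p hp).2,
          primeFactors_prod_primes fun p hp => (hQp b (mem_filter.mp hb).1 p hp).2] at h
    rw [h2]
    refine sum_le_sum_of_subset_of_nonneg (fun a ha => ?_) fun _ _ _ => by positivity
    obtain ⟨m, hm, rfl⟩ := mem_image.mp ha
    rw [mem_filter] at hm
    have hmp := hQp m hm.1
    rw [mem_filter, mem_Icc]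
    refine ⟨⟨Nat.succ_le_of_lt (prod_pos fun p hp => (hmp p hp).2.pos),
      (setLog_le_iff (fun p hp => (hmp p hp).2) y).mp hm.2⟩, ?_⟩
    refine Nat.Coprime.prod_left fun p hp => ?_
    rw [(hmp p hp).2.coprime_iff_not_dvd, (hmp p hp).2.dvd_factorial]
    exact not_le.mpr (hmp p hp).1
  have h2 := (abs_le.mp (abs_sum_coprime_inv_sub_le w.factorial_ne_zero hx0)).2
  rw [totient_div_eq_prod w.factorial_ne_zero] at h2
  have h3 : ∏ p ∈ w.factorial.primeFactors, (1 - 1 / (p : ℝ)) = smallDensity w := by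
    rw [smallDensity, primeFactors_factorial]
  rw [h3] at h2
  have h4 : (4 : ℝ) * 2 ^ #w.factorial.primeFactors / x ≤ 4 * 2 ^ #w.factorial.primeFactors :=
    div_le_self (by positivity) hx1
  have h5 : Real.log x ≤ y := by
    rw [Real.log_le_iff_le_exp (by linarith)]
    exact Nat.floor_le (Real.exp_pos y).le
  have h6 := mul_le_mul_of_nonneg_left h5 (smallDensity_pos w).le
  linarith

/-- `k / (1 - k)` for the density `k = density6 p`. -/
noncomputable def oddsSix (p : ℕ) : ℝ := (6 * p - 5) / (((p : ℝ) - 1) * (p - 5))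

/-- `k / (1 - k)` for the density `k = 5 / p`. -/
noncomputable def oddsFive (p : ℕ) : ℝ := 5 / ((p : ℝ) - 5)

/-- The smooth cutoff entering the sieve weights, up to scaling. -/
noncomputable def cutoff (R : ℕ) (v : Finset ℕ) : ℝ :=
  if setLog v ≤ Real.log R then Real.log R + 9 * (Real.log R - setLog v) else 0

/-- The sets `r` of primes in `(w, R]` whose product is at most `R`. -/
noncomputable def sieveSupport (w R : ℕ) : Finset (Finset ℕ) :=
  (sievePrimes w R).powerset.filter fun r => setLog r ≤ Real.log R

lemma mem_sieveSupport {w R : ℕ} {r : Finset ℕ} :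
    r ∈ sieveSupport w R ↔ r ⊆ sievePrimes w R ∧ setLog r ≤ Real.log R := by
  rw [sieveSupport, mem_filter, mem_powerset]

lemma empty_mem_sieveSupport (w R : ℕ) : ∅ ∈ sieveSupport w R :=
  mem_sieveSupport.mpr ⟨empty_subset _, by simpa [setLog] using Real.log_natCast_nonneg R⟩

lemma lt_cast_of_mem_sievePrimes {w R p : ℕ} (hp : p ∈ sievePrimes w R) : (w : ℝ) < p := by
  exact_mod_cast (mem_sievePrimes.mp hp).1.1

lemma oddsFive_pos {w R p : ℕ} (hw : 5 ≤ w) (hp : p ∈ sievePrimes w R) : 0 < oddsFive p := by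
  have h1 := lt_cast_of_mem_sievePrimes hp
  have h2 : (5 : ℝ) ≤ w := by exact_mod_cast hw
  exact div_pos (by norm_num) (by linarith)

/-- The lower bound for the quadratic form of density `5 / p`. -/
lemma le_sieveForm_five {w R : ℕ} (hw : 5 ≤ w) (hR : 0 < R) :
    smallDensity w ^ 2 * ∑ r ∈ sieveSupport w R, (∏ p ∈ r, oddsFive p)
        * (Real.log R * (Real.log R - setLog r) + 9 / 2 * (Real.log R - setLog r) ^ 2) ^ 2
      ≤ sieveForm oddsSix (fun p => 5 / (p : ℝ)) (sievePrimes w R) (cutoff R) := by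
  rw [sieveForm_eq, mul_sum]
  set L := Real.log R with hL
  have hL0 : 0 ≤ L := Real.log_natCast_nonneg R
  have hp5 : ∀ p ∈ sievePrimes w R, (5 : ℝ) < p := fun p hp =>
    lt_of_le_of_lt (by exact_mod_cast hw) (lt_cast_of_mem_sievePrimes hp)
  have hb : ∀ p ∈ sievePrimes w R,
      oddsSix p * (1 - 5 / (p : ℝ)) - 5 / (p : ℝ) = 1 / ((p : ℝ) - 1) := by
    intro p hp
    have h5 := hp5 p hp
    have h1 : (p : ℝ) - 1 ≠ 0 := by linarith
    have h2 : (p : ℝ) - 5 ≠ 0 := by linarith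
    have h3 : (p : ℝ) ≠ 0 := by linarith
    rw [oddsSix]
    field_simp
    ring
  have hd : ∀ p ∈ sievePrimes w R, oddsSix p ^ 2 * (1 - 5 / (p : ℝ)) + 5 / (p : ℝ)
      - (oddsSix p * (1 - 5 / (p : ℝ)) - 5 / (p : ℝ)) ^ 2
      = oddsFive p * ((p : ℝ) / (p - 1)) ^ 2 := by
    intro p hp
    have h5 := hp5 p hp
    have h1 : (p : ℝ) - 1 ≠ 0 := by linarith
    have h2 : (p : ℝ) - 5 ≠ 0 := by linarith
    have h3 : (p : ℝ) ≠ 0 := by linarith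
    rw [hb p hp, oddsSix, oddsFive]
    field_simp
    ring
  have hprod : ∀ r ∈ (sievePrimes w R).powerset,
      ∏ p ∈ r, (oddsSix p ^ 2 * (1 - 5 / (p : ℝ)) + 5 / (p : ℝ)
        - (oddsSix p * (1 - 5 / (p : ℝ)) - 5 / (p : ℝ)) ^ 2)
      = (∏ p ∈ r, oddsFive p) * (∏ p ∈ r, ((p : ℝ) / (p - 1))) ^ 2 := by
    intro r hr
    rw [← prod_pow, ← prod_mul_distrib]
    exact prod_congr rfl fun p hp => hd p (mem_powerset.mp hr hp)
  have hnn : ∀ r ∈ (sievePrimes w R).powerset, 0 ≤ ∏ p ∈ r, oddsFive p := fun r hr =>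
    prod_nonneg fun p hp => (oddsFive_pos hw (mem_powerset.mp hr hp)).le
  refine le_trans ?_ (sum_le_sum_of_subset_of_nonneg (filter_subset (fun r => setLog r ≤ L) _)
    fun r hr _ => ?_)
  swap
  · rw [hprod r hr]
    exact mul_nonneg (mul_nonneg (hnn r hr) (sq_nonneg _)) (sq_nonneg _)
  refine sum_le_sum fun r hr => ?_
  obtain ⟨hr1, hrL⟩ := mem_filter.mp hr
  have hrP := mem_powerset.mp hr1
  rw [hprod r hr1]
  set Y := L - setLog r with hY
  have hY0 : 0 ≤ Y := by linarith
  have hYL : Y ≤ L := by linarith [setLog_nonneg r]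
  set κ := smallDensity w * ∏ p ∈ r, (1 - 1 / (p : ℝ)) with hκ
  have hκ0 : 0 ≤ κ := mul_nonneg (smallDensity_pos w).le
    (prod_nonneg fun p hp => (one_sub_inv_pos (mem_sievePrimes.mp (hrP hp)).2).le)
  have hsum : κ * (L * Y + 9 / 2 * Y ^ 2) ≤ ∑ m ∈ (sievePrimes w R \ r).powerset,
      (∏ p ∈ m, (oddsSix p * (1 - 5 / (p : ℝ)) - 5 / (p : ℝ))) * cutoff R (r ∪ m) := by
    have h1 : ∑ m ∈ (sievePrimes w R \ r).powerset,
        (∏ p ∈ m, (oddsSix p * (1 - 5 / (p : ℝ)) - 5 / (p : ℝ))) * cutoff R (r ∪ m)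
        = ∑ m ∈ (sievePrimes w R \ r).powerset.filter (fun m => setLog m ≤ Y),
          (∏ p ∈ m, (1 / ((p : ℝ) - 1))) * (L + 9 * (Y - setLog m)) := by
      rw [sum_filter]
      refine sum_congr rfl fun m hm => ?_
      have hm' := mem_powerset.mp hm
      have hdisj : Disjoint r m := disjoint_of_subset_right hm' disjoint_sdiff
      rw [prod_congr rfl fun p hp => hb p (mem_sdiff.mp (hm' hp)).1, cutoff, setLog_union hdisj]
      have h2 : setLog r + setLog m ≤ Real.log R ↔ setLog m ≤ Y := by
        rw [hY, hL]; constructor <;> intro h <;> linarith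
      simp only [h2]
      split_ifs
      · rw [hY]; ring
      · simp
    have hmertens : ∀ y, 0 ≤ y → y ≤ Y → κ * y - 0 ≤
        ∑ m ∈ (sievePrimes w R \ r).powerset.filter (fun m => setLog m ≤ y),
          ∏ p ∈ m, (1 / ((p : ℝ) - 1)) := fun y _ h' => by
      rw [sub_zero]
      exact smallDensity_mul_le hrP hR (h'.trans hYL)
    have h2 := le_sum_mul_sub_pow _ (fun m : Finset ℕ => ∏ p ∈ m, (1 / ((p : ℝ) - 1))) setLog 0
      (fun m _ => setLog_nonneg m) hY0 hmertens
    have h3 := le_sum_mul_sub_pow _ (fun m : Finset ℕ => ∏ p ∈ m, (1 / ((p : ℝ) - 1))) setLog 1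
      (fun m _ => setLog_nonneg m) hY0 hmertens
    rw [h1]
    simp only [pow_zero, mul_one, pow_one] at h2 h3
    norm_num at h2 h3
    have h4 : ∑ m ∈ (sievePrimes w R \ r).powerset.filter (fun m => setLog m ≤ Y),
          (∏ p ∈ m, (1 / ((p : ℝ) - 1))) * (L + 9 * (Y - setLog m))
        = L * (∑ m ∈ (sievePrimes w R \ r).powerset.filter (fun m => setLog m ≤ Y),
          (∏ p ∈ m, (1 / ((p : ℝ) - 1))))
          + 9 * ∑ m ∈ (sievePrimes w R \ r).powerset.filter (fun m => setLog m ≤ Y),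
          (∏ p ∈ m, (1 / ((p : ℝ) - 1))) * (Y - setLog m) := by
      rw [mul_sum, mul_sum, ← sum_add_distrib]
      exact sum_congr rfl fun m _ => by ring
    rw [h4]
    simp only [one_div, prod_inv_distrib] at *
    have h5 := mul_le_mul_of_nonneg_left h2 hL0
    linarith
  have hG : 0 ≤ κ * (L * Y + 9 / 2 * Y ^ 2) := by positivity
  have hone : (∏ p ∈ r, (1 - 1 / (p : ℝ))) * ∏ p ∈ r, ((p : ℝ) / (p - 1)) = 1 := by
    rw [← prod_mul_distrib]
    refine prod_eq_one fun p hp => ?_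
    have h5 := hp5 p (hrP hp)
    have h1 : (p : ℝ) - 1 ≠ 0 := by linarith
    field_simp
  calc smallDensity w ^ 2 * ((∏ p ∈ r, oddsFive p) * (L * Y + 9 / 2 * Y ^ 2) ^ 2)
      = smallDensity w ^ 2 * ((∏ p ∈ r, oddsFive p) * (L * Y + 9 / 2 * Y ^ 2) ^ 2)
        * ((∏ p ∈ r, (1 - 1 / (p : ℝ))) * ∏ p ∈ r, ((p : ℝ) / (p - 1))) ^ 2 := by
        rw [hone]; ring
    _ = (∏ p ∈ r, oddsFive p) * (∏ p ∈ r, ((p : ℝ) / (p - 1))) ^ 2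
        * (κ * (L * Y + 9 / 2 * Y ^ 2)) ^ 2 := by rw [hκ]; ring
    _ ≤ _ := mul_le_mul_of_nonneg_left (pow_le_pow_left₀ hG hsum 2)
        (mul_nonneg (hnn r hr1) (sq_nonneg _))

lemma sum_powerset_sum_powerset_sdiff (P : Finset ℕ) (g : Finset ℕ → Finset ℕ → ℝ) :
    ∑ v ∈ P.powerset, ∑ d ∈ v.powerset, g d (v \ d)
      = ∑ d ∈ P.powerset, ∑ x ∈ (P \ d).powerset, g d x := by
  rw [sum_sigma', sum_sigma']
  refine sum_bij' (fun a _ => ⟨a.2, a.1 \ a.2⟩) (fun a _ => ⟨a.1 ∪ a.2, a.1⟩) ?_ ?_ ?_ ?_ ?_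
  · rintro ⟨v, d⟩ h
    simp only [mem_sigma, mem_powerset] at h ⊢
    exact ⟨h.2.trans h.1, sdiff_subset_sdiff h.1 subset_rfl⟩
  · rintro ⟨d, x⟩ h
    simp only [mem_sigma, mem_powerset] at h ⊢
    exact ⟨union_subset h.1 (h.2.trans sdiff_subset), subset_union_left⟩
  · rintro ⟨v, d⟩ h
    simp only [mem_sigma, mem_powerset] at h ⊢
    simp [union_eq_right.mpr h.2]
  · rintro ⟨d, x⟩ h
    simp only [mem_sigma, mem_powerset] at h ⊢
    have : Disjoint d x := disjoint_of_subset_right h.2 disjoint_sdiff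
    simp [union_sdiff_cancel_left this]
  · rintro ⟨v, d⟩ _
    rfl

lemma sum_powerset_sum_mem (P : Finset ℕ) (g : ℕ → Finset ℕ → ℝ) :
    ∑ r ∈ P.powerset, ∑ p ∈ r, g p (r.erase p) = ∑ r ∈ P.powerset, ∑ p ∈ P \ r, g p r := by
  rw [sum_sigma', sum_sigma']
  refine sum_bij' (fun a _ => ⟨a.1.erase a.2, a.2⟩) (fun a _ => ⟨insert a.2 a.1, a.2⟩) ?_ ?_ ?_ ?_ ?_
  · rintro ⟨v, p⟩ h
    simp only [mem_sigma, mem_powerset, mem_sdiff] at h ⊢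
    exact ⟨(erase_subset _ _).trans h.1, h.1 h.2, notMem_erase _ _⟩
  · rintro ⟨v, p⟩ h
    simp only [mem_sigma, mem_powerset, mem_sdiff] at h ⊢
    exact ⟨insert_subset h.2.1 h.1, mem_insert_self _ _⟩
  · rintro ⟨v, p⟩ h
    simp only [mem_sigma, mem_powerset] at h ⊢
    simp [insert_erase h.2]
  · rintro ⟨v, p⟩ h
    simp only [mem_sigma, mem_powerset, mem_sdiff] at h ⊢
    simp [erase_insert h.2.2]
  · rintro ⟨v, p⟩ _
    rfl

/-- The moments of the measure with weights `oddsFive` on the sieve support. -/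
noncomputable def supportMoment (w R n : ℕ) : ℝ :=
  ∑ r ∈ sieveSupport w R, (∏ p ∈ r, oddsFive p) * (Real.log R - setLog r) ^ n

lemma prod_oddsFive_nonneg {w R : ℕ} (hw : 5 ≤ w) {r : Finset ℕ} (hr : r ⊆ sievePrimes w R) :
    0 ≤ ∏ p ∈ r, oddsFive p :=
  prod_nonneg fun _ hp => (oddsFive_pos hw (hr hp)).le

lemma supportMoment_nonneg {w R : ℕ} (hw : 5 ≤ w) (n : ℕ) : 0 ≤ supportMoment w R n :=
  sum_nonneg fun _ hr => by
    rw [mem_sieveSupport] at hr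
    exact mul_nonneg (prod_oddsFive_nonneg hw hr.1) (pow_nonneg (by linarith [hr.2]) _)

lemma one_le_supportMoment_zero {w R : ℕ} (hw : 5 ≤ w) : 1 ≤ supportMoment w R 0 := by
  have := single_le_sum (f := fun r => (∏ p ∈ r, oddsFive p) * (Real.log R - setLog r) ^ 0)
    (s := sieveSupport w R) (fun r hr => by
      rw [mem_sieveSupport] at hr
      simpa using prod_oddsFive_nonneg hw hr.1) (empty_mem_sieveSupport w R)
  simpa [supportMoment] using this

lemma oddsFive_le {w R p : ℕ} (hw : 10 ≤ w) (hp : p ∈ sievePrimes w R) : oddsFive p ≤ 10 / p := by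
  have h1 := lt_cast_of_mem_sievePrimes hp
  have h2 : (10 : ℝ) ≤ w := by exact_mod_cast hw
  rw [oddsFive, div_le_div_iff₀ (by linarith) (by linarith)]
  linarith

lemma sum_support_sum_mem {w R : ℕ} (f : ℕ → Finset ℕ → ℝ) :
    ∑ r ∈ sieveSupport w R, ∑ p ∈ r, (∏ q ∈ r, oddsFive q) * f p r
      = ∑ r ∈ sieveSupport w R, (∏ q ∈ r, oddsFive q)
        * ∑ p ∈ (sievePrimes w R \ r).filter (fun p : ℕ => Real.log p ≤ Real.log R - setLog r),
          oddsFive p * f p (insert p r) := by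
  let g : ℕ → Finset ℕ → ℝ := fun p r' => if Real.log p + setLog r' ≤ Real.log R then
    oddsFive p * (∏ q ∈ r', oddsFive q) * f p (insert p r') else 0
  have h1 : ∑ r ∈ sieveSupport w R, ∑ p ∈ r, (∏ q ∈ r, oddsFive q) * f p r
      = ∑ r ∈ (sievePrimes w R).powerset, ∑ p ∈ r,
        g p (r.erase p) := by
    rw [sieveSupport, sum_filter]
    refine sum_congr rfl fun r _ => ?_
    rw [← sum_const_zero (s := r), ← sum_ite_irrel]
    · refine sum_congr rfl fun p hp => ?_
      have h2 := insert_erase hp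
      have h3 := setLog_insert (notMem_erase p r)
      rw [h2] at h3
      simp only [g]
      rw [← h3, h2, ← prod_insert (notMem_erase p r), h2]
  rw [h1, sum_powerset_sum_mem]
  simp only [g]
  rw [sieveSupport, sum_filter]
  refine sum_congr rfl fun r _ => ?_
  split_ifs with h
  · rw [sum_filter, mul_sum]
    refine sum_congr rfl fun p _ => ?_
    have : Real.log p + setLog r ≤ Real.log R ↔ Real.log p ≤ Real.log R - setLog r := by
      rw [le_sub_iff_add_le]
    simp only [this]
    split_ifs
    · ring
    · simp
  · refine sum_eq_zero fun p _ => ?_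
    rw [if_neg]
    have := Real.log_natCast_nonneg p
    linarith

/-- The moment recursion. -/
lemma exists_abs_supportMoment_succ_le {w : ℕ} (hw : 10 ≤ w) :
    ∃ K : ℝ, 0 ≤ K ∧ ∀ R n : ℕ,
      |Real.log R * supportMoment w R n - supportMoment w R (n + 1)
        - 5 / (n + 1) * supportMoment w R (n + 1)|
        ≤ K * Real.log R ^ n * supportMoment w R 0 := by
  obtain ⟨K₁, hK₁, hmertens⟩ := exists_abs_sum_mul_log_sub_le w oddsFive (a := 5) (b := 50)
    (fun p hp _ => by
      have h1 : (w : ℝ) < p := by exact_mod_cast hp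
      have h2 : (10 : ℝ) ≤ w := by exact_mod_cast hw
      have h3 : oddsFive p - 5 / p = 25 / ((p : ℝ) * (p - 5)) := by
        have : (p : ℝ) - 5 ≠ 0 := by linarith
        have : (p : ℝ) ≠ 0 := by linarith
        rw [oddsFive]; field_simp; ring
      rw [h3, abs_of_nonneg (div_nonneg (by norm_num)
        (mul_nonneg (by linarith) (by linarith))), div_le_div_iff₀
        (mul_pos (by linarith) (by linarith)) (by nlinarith)]
      nlinarith)
  obtain ⟨K₂, hK₂, hsq⟩ := exists_sum_log_div_sq_le
  refine ⟨K₁ + 100 * K₂, by positivity, fun R n => ?_⟩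
  have hw5 : 5 ≤ w := by omega
  set L := Real.log R with hL
  have hL0 : 0 ≤ L := Real.log_natCast_nonneg R
  have hYL : ∀ r ∈ sieveSupport w R, 0 ≤ L - setLog r ∧ L - setLog r ≤ L := fun r hr =>
    ⟨by linarith [(mem_sieveSupport.mp hr).2], by linarith [setLog_nonneg r]⟩
  have hnn : ∀ r ∈ sieveSupport w R, 0 ≤ ∏ p ∈ r, oddsFive p := fun r hr =>
    prod_oddsFive_nonneg hw5 (mem_sieveSupport.mp hr).1
  have hleft : L * supportMoment w R n - supportMoment w R (n + 1)
      = ∑ r ∈ sieveSupport w R, ∑ p ∈ r,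
        (∏ q ∈ r, oddsFive q) * (Real.log p * (L - setLog r) ^ n) := by
    rw [supportMoment, supportMoment, mul_sum, ← sum_sub_distrib]
    refine sum_congr rfl fun r _ => ?_
    rw [← mul_sum, ← sum_mul, show ∑ p ∈ r, Real.log p = setLog r from rfl, ← hL]
    ring
  have hbad : ∑ r ∈ sieveSupport w R, ∑ p ∈ r, (∏ q ∈ r, oddsFive q) * (oddsFive p * Real.log p)
      ≤ 100 * K₂ * supportMoment w R 0 := by
    rw [sum_support_sum_mem (fun p _ => oddsFive p * Real.log p), supportMoment, mul_sum]
    refine sum_le_sum fun r hr => ?_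
    rw [pow_zero, mul_one, mul_comm]
    refine mul_le_mul_of_nonneg_right ?_ (hnn r hr)
    calc _ ≤ ∑ p ∈ (sievePrimes w R \ r).filter (fun p : ℕ => Real.log p ≤ Real.log R - setLog r),
          100 * (Real.log p / (p : ℝ) ^ 2) := by
          refine sum_le_sum fun p hp => ?_
          have hpP := (mem_sdiff.mp (mem_filter.mp hp).1).1
          have h1 := oddsFive_le hw hpP
          have h2 := (oddsFive_pos hw5 hpP).le
          have h3 := Real.log_natCast_nonneg p
          have h4 : oddsFive p * oddsFive p ≤ 10 / p * (10 / p) := mul_le_mul h1 h1 h2 (h2.trans h1)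
          calc oddsFive p * (oddsFive p * Real.log p) = oddsFive p * oddsFive p * Real.log p := by ring
            _ ≤ 10 / p * (10 / p) * Real.log p := mul_le_mul_of_nonneg_right h4 h3
            _ = _ := by ring
      _ ≤ _ := by
          rw [← mul_sum]
          exact mul_le_mul_of_nonneg_left (hsq _) (by norm_num)
  have hmain : ∀ r ∈ sieveSupport w R,
      |∑ p ∈ (sievePrimes w R).filter (fun p : ℕ => Real.log p ≤ L - setLog r),
        oddsFive p * Real.log p * (L - setLog r - Real.log p) ^ n
        - 5 * (L - setLog r) ^ (n + 1) / (n + 1)| ≤ K₁ * L ^ n := by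
    intro r hr
    obtain ⟨h0, h1⟩ := hYL r hr
    refine (abs_sum_mul_sub_pow_sub_le _ (fun p : ℕ => oddsFive p * Real.log p)
      (fun p : ℕ => Real.log p) n (fun p _ => Real.log_natCast_nonneg p) h0
      (fun y hy hy' => hmertens R y hy (hy'.trans h1))).trans ?_
    exact mul_le_mul_of_nonneg_left (pow_le_pow_left₀ h0 h1 n) hK₁
  rw [hleft, sum_support_sum_mem (fun p r => Real.log p * (L - setLog r) ^ n)]
  have hsplit : ∀ r ∈ sieveSupport w R,
      ∑ p ∈ (sievePrimes w R \ r).filter (fun p : ℕ => Real.log p ≤ Real.log R - setLog r),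
          oddsFive p * (Real.log p * (L - setLog (insert p r)) ^ n)
      = ∑ p ∈ (sievePrimes w R).filter (fun p : ℕ => Real.log p ≤ L - setLog r),
          oddsFive p * Real.log p * (L - setLog r - Real.log p) ^ n
        - ∑ p ∈ r.filter (fun p : ℕ => Real.log p ≤ L - setLog r),
          oddsFive p * Real.log p * (L - setLog r - Real.log p) ^ n := by
    intro r hr
    have hrP := (mem_sieveSupport.mp hr).1
    rw [eq_sub_iff_add_eq, sum_filter, sum_filter, sum_filter, ← sum_sdiff hrP]
    congr 1
    refine sum_congr rfl fun p hp => ?_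
    rw [setLog_insert (mem_sdiff.mp hp).2, ← hL]
    split_ifs
    · ring
    · rfl
  have hfin : ∑ r ∈ sieveSupport w R, (∏ q ∈ r, oddsFive q)
        * ∑ p ∈ (sievePrimes w R \ r).filter (fun p : ℕ => Real.log p ≤ Real.log R - setLog r),
          oddsFive p * (Real.log p * (L - setLog (insert p r)) ^ n)
      - 5 / (n + 1) * supportMoment w R (n + 1)
      = ∑ r ∈ sieveSupport w R, (∏ q ∈ r, oddsFive q)
        * ((∑ p ∈ (sievePrimes w R).filter (fun p : ℕ => Real.log p ≤ L - setLog r),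
          oddsFive p * Real.log p * (L - setLog r - Real.log p) ^ n
          - 5 * (L - setLog r) ^ (n + 1) / (n + 1))
        - ∑ p ∈ r.filter (fun p : ℕ => Real.log p ≤ L - setLog r),
          oddsFive p * Real.log p * (L - setLog r - Real.log p) ^ n) := by
    rw [supportMoment, mul_sum, ← sum_sub_distrib]
    refine sum_congr rfl fun r hr => ?_
    rw [hsplit r hr, ← hL]
    ring
  rw [hfin]
  refine (abs_sum_le_sum_abs _ _).trans ?_
  calc _ ≤ ∑ r ∈ sieveSupport w R, ((∏ q ∈ r, oddsFive q) * (K₁ * L ^ n)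
        + L ^ n * ∑ p ∈ r, (∏ q ∈ r, oddsFive q) * (oddsFive p * Real.log p)) := by
        refine sum_le_sum fun r hr => ?_
        rw [abs_mul, abs_of_nonneg (hnn r hr), ← mul_sum, mul_left_comm (L ^ n), ← mul_add]
        refine mul_le_mul_of_nonneg_left ?_ (hnn r hr)
        refine (abs_sub _ _).trans (add_le_add (hmain r hr) ?_)
        obtain ⟨h0, h1⟩ := hYL r hr
        have hrP := (mem_sieveSupport.mp hr).1
        have hpos : ∀ p ∈ r, 0 ≤ oddsFive p * Real.log p := fun p hp =>
          mul_nonneg (oddsFive_pos hw5 (hrP hp)).le (Real.log_natCast_nonneg p)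
        have hnn' : 0 ≤ ∑ p ∈ r.filter (fun p : ℕ => Real.log p ≤ L - setLog r),
            oddsFive p * Real.log p * (L - setLog r - Real.log p) ^ n :=
          sum_nonneg fun p hp => by
            rw [mem_filter] at hp
            exact mul_nonneg (hpos p hp.1) (pow_nonneg (by linarith [hp.2]) n)
        rw [abs_of_nonneg hnn', mul_sum]
        · refine le_trans (sum_le_sum fun p hp => ?_)
            (sum_le_sum_of_subset_of_nonneg (filter_subset _ r) fun p hp _ => ?_)
          · rw [mem_filter] at hp
            rw [mul_comm]
            refine mul_le_mul_of_nonneg_right (pow_le_pow_left₀ (by linarith [hp.2]) ?_ n)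
              (hpos p hp.1)
            linarith [Real.log_natCast_nonneg p]
          · exact mul_nonneg (by positivity) (hpos p hp)
    _ = K₁ * L ^ n * supportMoment w R 0 + L ^ n * ∑ r ∈ sieveSupport w R, ∑ p ∈ r,
        (∏ q ∈ r, oddsFive q) * (oddsFive p * Real.log p) := by
        rw [sum_add_distrib, ← sum_mul, ← mul_sum, supportMoment]
        simp only [pow_zero, mul_one]
        ring
    _ ≤ K₁ * L ^ n * supportMoment w R 0 + L ^ n * (100 * K₂ * supportMoment w R 0) :=
        add_le_add_right (mul_le_mul_of_nonneg_left hbad (by positivity)) _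
    _ = _ := by ring

lemma oddsSix_le {w p : ℕ} (hw : 10 ≤ w) (hp : w < p) : oddsSix p ≤ 12 / p := by
  have h1 : (11 : ℝ) ≤ p := by exact_mod_cast (by omega : 11 ≤ p)
  rw [oddsSix, div_le_div_iff₀ (mul_pos (by linarith) (by linarith)) (by linarith)]
  nlinarith

lemma oddsSix_nonneg {w p : ℕ} (hw : 10 ≤ w) (hp : w < p) : 0 ≤ oddsSix p := by
  have h1 : (11 : ℝ) ≤ p := by exact_mod_cast (by omega : 11 ≤ p)
  exact div_nonneg (by linarith) (mul_nonneg (by linarith) (by linarith))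

/-- The contribution of adjoining one prime to a set of the sieve support. -/
lemma exists_sum_adjoin_le {w : ℕ} (hw : 10 ≤ w) : ∃ K : ℝ, 0 ≤ K ∧ ∀ (R : ℕ) (Y : ℝ), 0 ≤ Y →
    Y ≤ Real.log R →
    ∑ p ∈ (sievePrimes w R).filter (fun p : ℕ => Real.log p ≤ Y), 2 / ((p : ℝ) - 1) * Real.log p
      * ((Real.log R + 9 * Y) ^ 2 - 81 * Real.log p ^ 2
        + oddsSix p * (Real.log R + 9 * (Y - Real.log p)) ^ 2)
      ≤ 2 * (Real.log R + 9 * Y) ^ 2 * Y - 54 * Y ^ 3 + K * Real.log R ^ 2 := by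
  obtain ⟨K₁, hK₁, h₁⟩ := exists_abs_sum_mul_log_sub_le w (fun p => 2 / ((p : ℝ) - 1))
    (a := 2) (b := 4) (fun p hp _ => by
      have h1 : (11 : ℝ) ≤ p := by exact_mod_cast (by omega : 11 ≤ p)
      have h3 : 2 / ((p : ℝ) - 1) - 2 / p = 2 / ((p : ℝ) * (p - 1)) := by
        have : (p : ℝ) - 1 ≠ 0 := by linarith
        have : (p : ℝ) ≠ 0 := by linarith
        field_simp; ring
      rw [h3, abs_of_nonneg (div_nonneg (by norm_num)
        (mul_nonneg (by linarith) (by linarith))), div_le_div_iff₀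
        (mul_pos (by linarith) (by linarith)) (by nlinarith)]
      nlinarith)
  obtain ⟨K₂, hK₂, h₂⟩ := exists_abs_sum_mul_log_sub_le w (fun p => 2 / ((p : ℝ) - 1) * oddsSix p)
    (a := 0) (b := 48) (fun p hp _ => by
      have h1 : (11 : ℝ) ≤ p := by exact_mod_cast (by omega : 11 ≤ p)
      have h2 : 2 / ((p : ℝ) - 1) ≤ 4 / p := by
        rw [div_le_div_iff₀ (by linarith) (by linarith)]; linarith
      have h3 : 0 ≤ 2 / ((p : ℝ) - 1) := div_nonneg (by norm_num) (by linarith)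
      have h4 := oddsSix_nonneg hw hp
      rw [zero_div, sub_zero, abs_of_nonneg (mul_nonneg h3 h4)]
      calc _ ≤ 4 / (p : ℝ) * (12 / p) :=
            mul_le_mul h2 (oddsSix_le hw hp) h4 (h3.trans h2)
        _ = _ := by ring)
  refine ⟨262 * K₁ + 100 * K₂, by positivity, fun R Y hY hYL => ?_⟩
  set L := Real.log R with hL
  have hL0 : 0 ≤ L := hY.trans hYL
  set I := (sievePrimes w R).filter (fun p : ℕ => Real.log p ≤ Y) with hI
  have hmom : ∀ n : ℕ, |∑ p ∈ I, 2 / ((p : ℝ) - 1) * Real.log p * (Y - Real.log p) ^ n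
      - 2 * Y ^ (n + 1) / (n + 1)| ≤ K₁ * Y ^ n := fun n =>
    abs_sum_mul_sub_pow_sub_le _ (fun p : ℕ => 2 / ((p : ℝ) - 1) * Real.log p)
      (fun p : ℕ => Real.log p) n (fun p _ => Real.log_natCast_nonneg p) hY
      fun y h0 hy => h₁ R y h0 (hy.trans hYL)
  have e0 := (abs_le.mp (hmom 0)).2
  have e1 := (abs_le.mp (hmom 1)).2
  have e2 := (abs_le.mp (hmom 2)).1
  have e3 := (abs_le.mp (h₂ R Y hY hYL)).2
  norm_num at e0 e1 e2 e3
  rw [← hI] at e3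
  have hadd : ∑ p ∈ I, 2 / ((p : ℝ) - 1) * Real.log p * ((L + 9 * Y) ^ 2 - 81 * Real.log p ^ 2
        + oddsSix p * (L + 9 * (Y - Real.log p)) ^ 2)
      ≤ (L ^ 2 + 18 * L * Y) * ∑ p ∈ I, 2 / ((p : ℝ) - 1) * Real.log p
        + 162 * Y * ∑ p ∈ I, 2 / ((p : ℝ) - 1) * Real.log p * (Y - Real.log p)
        - 81 * ∑ p ∈ I, 2 / ((p : ℝ) - 1) * Real.log p * (Y - Real.log p) ^ 2
        + 100 * L ^ 2 * ∑ p ∈ I, 2 / ((p : ℝ) - 1) * oddsSix p * Real.log p := by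
    simp only [mul_sum]
    rw [← sum_add_distrib, ← sum_sub_distrib, ← sum_add_distrib]
    refine sum_le_sum fun p hp => ?_
    obtain ⟨hpP, hpY⟩ := mem_filter.mp hp
    have hwp := (mem_sievePrimes.mp hpP).1.1
    have h1 : (11 : ℝ) ≤ p := by exact_mod_cast (by omega : 11 ≤ p)
    have hlog := Real.log_natCast_nonneg p
    have h2 : (L + 9 * (Y - Real.log p)) ^ 2 ≤ 100 * L ^ 2 := by
      rw [show 100 * L ^ 2 = (10 * L) ^ 2 by ring]
      exact pow_le_pow_left₀ (by linarith) (by linarith) 2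
    have h3 : 0 ≤ 2 / ((p : ℝ) - 1) * oddsSix p * Real.log p :=
      mul_nonneg (mul_nonneg (div_nonneg (by norm_num) (by linarith)) (oddsSix_nonneg hw hwp)) hlog
    have h4 := mul_le_mul_of_nonneg_left h2 h3
    have h5 : 2 / ((p : ℝ) - 1) * Real.log p * ((L + 9 * Y) ^ 2 - 81 * Real.log p ^ 2
          + oddsSix p * (L + 9 * (Y - Real.log p)) ^ 2)
        = (L ^ 2 + 18 * L * Y) * (2 / ((p : ℝ) - 1) * Real.log p)
          + 162 * Y * (2 / ((p : ℝ) - 1) * Real.log p * (Y - Real.log p))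
          - 81 * (2 / ((p : ℝ) - 1) * Real.log p * (Y - Real.log p) ^ 2)
          + 2 / ((p : ℝ) - 1) * oddsSix p * Real.log p * (L + 9 * (Y - Real.log p)) ^ 2 := by ring
    rw [h5]
    linarith
  have g0 := mul_le_mul_of_nonneg_left e0 (by positivity : 0 ≤ L ^ 2 + 18 * L * Y)
  have g1 := mul_le_mul_of_nonneg_left e1 (by positivity : 0 ≤ 162 * Y)
  have g3 := mul_le_mul_of_nonneg_left e3 (by positivity : 0 ≤ 100 * L ^ 2)
  have k1 : K₁ * (L * Y) ≤ K₁ * L ^ 2 := mul_le_mul_of_nonneg_left (by nlinarith) hK₁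
  have k2 : K₁ * Y ^ 2 ≤ K₁ * L ^ 2 := mul_le_mul_of_nonneg_left (by nlinarith) hK₁
  refine hadd.trans ?_
  nlinarith

/-- Splitting a multiplicative weight into a summable part and the rest. -/
lemma sum_powerset_prod_mul_le {P : Finset ℕ} {h a b : ℕ → ℝ} (hab : ∀ p ∈ P, h p = a p + b p)
    (ha : ∀ p ∈ P, 0 ≤ a p) (hb : ∀ p ∈ P, 0 ≤ b p) {G : Finset ℕ → ℝ} (hG : ∀ v ⊆ P, 0 ≤ G v)
    (hmono : ∀ v ⊆ P, ∀ d ⊆ v, G v ≤ G d) :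
    ∑ v ∈ P.powerset, (∏ p ∈ v, h p) * G v
      ≤ (∏ p ∈ P, (1 + b p)) * ∑ d ∈ P.powerset, (∏ p ∈ d, a p) * G d := by
  have h1 : ∀ v ∈ P.powerset, (∏ p ∈ v, h p) * G v
      ≤ ∑ d ∈ v.powerset, (∏ p ∈ d, a p) * G d * ∏ p ∈ v \ d, b p := by
    intro v hv
    rw [mem_powerset] at hv
    rw [prod_congr rfl fun p hp => hab p (hv hp), prod_add, sum_mul]
    refine sum_le_sum fun d hd => ?_
    rw [mem_powerset] at hd
    rw [mul_right_comm]
    exact mul_le_mul_of_nonneg_right (mul_le_mul_of_nonneg_left (hmono v hv d hd)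
      (prod_nonneg fun p hp => ha p (hv (hd hp))))
      (prod_nonneg fun p hp => hb p (hv (mem_sdiff.mp hp).1))
  refine (sum_le_sum h1).trans ?_
  rw [sum_powerset_sum_powerset_sdiff P fun d x => (∏ p ∈ d, a p) * G d * ∏ p ∈ x, b p, mul_sum]
  refine sum_le_sum fun d hd => ?_
  rw [mem_powerset] at hd
  rw [← mul_sum, mul_comm, ← prod_one_add]
  refine mul_le_mul_of_nonneg_right ?_
    (mul_nonneg (prod_nonneg fun p hp => ha p (hd hp)) (hG d hd))
  rw [← prod_sdiff hd]
  refine le_mul_of_one_le_right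
    (prod_nonneg fun p hp => by linarith [hb p (mem_sdiff.mp hp).1]) (one_le_prod fun p hp => ?_)
  linarith [hb p (hd hp)]

lemma prod_one_add_le_exp {w R : ℕ} (hw : 10 ≤ w) :
    ∏ p ∈ sievePrimes w R, (1 + oddsSix p / p) ≤ Real.exp (12 / w) := by
  have h1 : ∀ p ∈ sievePrimes w R, oddsSix p / p ≤ 12 * ((p : ℝ) ^ 2)⁻¹ := by
    intro p hp
    have hwp := (mem_sievePrimes.mp hp).1.1
    have h0 : (0 : ℝ) < p := by exact_mod_cast (by omega : 0 < p)
    calc oddsSix p / p ≤ 12 / p / p := div_le_div_of_nonneg_right (oddsSix_le hw hwp) h0.le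
      _ = _ := by field_simp
  calc ∏ p ∈ sievePrimes w R, (1 + oddsSix p / p)
      ≤ ∏ p ∈ sievePrimes w R, Real.exp (12 * ((p : ℝ) ^ 2)⁻¹) := by
        refine prod_le_prod (fun p hp => ?_) fun p hp => ?_
        · have := oddsSix_nonneg hw (mem_sievePrimes.mp hp).1.1
          positivity
        · linarith [h1 p hp, Real.add_one_le_exp (12 * ((p : ℝ) ^ 2)⁻¹)]
    _ = Real.exp (∑ p ∈ sievePrimes w R, 12 * ((p : ℝ) ^ 2)⁻¹) := (Real.exp_sum _ _).symm
    _ ≤ _ := by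
        rw [Real.exp_le_exp, ← mul_sum, div_eq_mul_inv]
        refine mul_le_mul_of_nonneg_left ?_ (by norm_num)
        rcases le_total w R with h | h
        · calc _ ≤ ∑ p ∈ Ioc w R, ((p : ℝ) ^ 2)⁻¹ :=
                sum_le_sum_of_subset_of_nonneg (filter_subset _ _) fun _ _ _ => by positivity
            _ ≤ (w : ℝ)⁻¹ - (R : ℝ)⁻¹ := sum_Ioc_inv_sq_le_sub (by omega) h
            _ ≤ _ := by linarith [inv_nonneg.mpr (Nat.cast_nonneg (α := ℝ) R)]
        · rw [sievePrimes, Ioc_eq_empty (by omega)]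
          simp

/-- The quadratic form that arises from the logarithmic main terms of the divisor sums. -/
noncomputable def logForm (w R : ℕ) (ℓ : ℝ) : ℝ :=
  ∑ r ∈ (sievePrimes w R).powerset, (∏ p ∈ r, oddsSix p) * (ℓ * cutoff R r ^ 2
    + ∑ p ∈ sievePrimes w R \ r, 2 / ((p : ℝ) - 1) * Real.log p
      * (2 * cutoff R r * cutoff R (insert p r) - (1 - oddsSix p) * cutoff R (insert p r) ^ 2))

/-- The integrand bounding `logForm`, as a polynomial in the remaining logarithmic length. -/
noncomputable def logPoly (θ K L Y : ℝ) : ℝ :=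
  (θ * L ^ 3 + K * L ^ 2) + (18 * θ + 2) * L ^ 2 * Y + (81 * θ + 36) * L * Y ^ 2 + 108 * Y ^ 3

lemma logPoly_mono {θ K L Y Y' : ℝ} (hθ : 0 ≤ θ) (hL : 0 ≤ L) (hY : 0 ≤ Y)
    (h : Y ≤ Y') : logPoly θ K L Y ≤ logPoly θ K L Y' := by
  have h2 := pow_le_pow_left₀ hY h 2
  have h3 := pow_le_pow_left₀ hY h 3
  have a1 := mul_le_mul_of_nonneg_left h (by positivity : 0 ≤ (18 * θ + 2) * L ^ 2)
  have a2 := mul_le_mul_of_nonneg_left h2 (by positivity : 0 ≤ (81 * θ + 36) * L)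
  rw [logPoly, logPoly]
  linarith

lemma logPoly_nonneg {θ K L Y : ℝ} (hθ : 0 ≤ θ) (hK : 0 ≤ K) (hL : 0 ≤ L) (hY : 0 ≤ Y) :
    0 ≤ logPoly θ K L Y := by
  rw [logPoly]; positivity

/-- `logPoly` at the remaining logarithmic length of `v`, extended by zero. -/
noncomputable def logCutoff (θ K : ℝ) (R : ℕ) (v : Finset ℕ) : ℝ :=
  if setLog v ≤ Real.log R then logPoly θ K (Real.log R) (Real.log R - setLog v) else 0

lemma logCutoff_nonneg {θ K : ℝ} (hθ : 0 ≤ θ) (hK : 0 ≤ K) (R : ℕ) (v : Finset ℕ) :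
    0 ≤ logCutoff θ K R v := by
  rw [logCutoff]
  split_ifs with h
  · exact logPoly_nonneg hθ hK (Real.log_natCast_nonneg R) (by linarith)
  · exact le_rfl

lemma logCutoff_mono {θ K : ℝ} (hθ : 0 ≤ θ) (hK : 0 ≤ K) (R : ℕ) {v d : Finset ℕ} (h : d ⊆ v) :
    logCutoff θ K R v ≤ logCutoff θ K R d := by
  have h1 := setLog_mono h
  by_cases hv : setLog v ≤ Real.log R
  · rw [logCutoff, logCutoff, if_pos hv, if_pos (h1.trans hv)]
    exact logPoly_mono hθ (Real.log_natCast_nonneg R) (by linarith) (by linarith)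
  · rw [logCutoff, if_neg hv]
    exact logCutoff_nonneg hθ hK R d

lemma exists_logForm_le_sum {w : ℕ} (hw : 10 ≤ w) {θ K₁ : ℝ} (hK₁ : 0 ≤ K₁) :
    ∃ K : ℝ, 0 ≤ K ∧ ∀ (R : ℕ) (ℓ : ℝ), ℓ ≤ θ * Real.log R + K₁ →
    logForm w R ℓ
      ≤ ∑ v ∈ (sievePrimes w R).powerset, (∏ p ∈ v, oddsSix p) * logCutoff θ K R v := by
  obtain ⟨K₂, hK₂, hadj⟩ := exists_sum_adjoin_le hw
  refine ⟨100 * K₁ + K₂, by positivity, fun R ℓ hℓ => sum_le_sum fun r hr => ?_⟩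
  rw [mem_powerset] at hr
  set L := Real.log R with hL
  have hL0 : 0 ≤ L := Real.log_natCast_nonneg R
  refine mul_le_mul_of_nonneg_left ?_ (prod_nonneg fun p hp =>
    oddsSix_nonneg hw (mem_sievePrimes.mp (hr hp)).1.1)
  rw [logCutoff]
  by_cases hrL : setLog r ≤ Real.log R
  swap
  · rw [if_neg hrL]
    have h0 : cutoff R r = 0 := if_neg hrL
    have h1 : ∀ p, cutoff R (insert p r) = 0 := fun p =>
      if_neg fun h => hrL ((setLog_mono (subset_insert p r)).trans h)
    simp [h0, h1]
  rw [if_pos hrL, ← hL]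
  set Y := L - setLog r with hY
  have hY0 : 0 ≤ Y := by linarith
  have hYL : Y ≤ L := by linarith [setLog_nonneg r]
  have hz : cutoff R r = L + 9 * Y := by rw [cutoff, if_pos hrL]
  rw [hz]
  have hsum : ∑ p ∈ sievePrimes w R \ r, 2 / ((p : ℝ) - 1) * Real.log p
      * (2 * (L + 9 * Y) * cutoff R (insert p r) - (1 - oddsSix p) * cutoff R (insert p r) ^ 2)
      ≤ 2 * (L + 9 * Y) ^ 2 * Y - 54 * Y ^ 3 + K₂ * L ^ 2 := by
    refine le_trans ?_ (hadj R Y hY0 hYL)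
    rw [sum_filter]
    have hnn : ∀ p ∈ sievePrimes w R, 0 ≤ if Real.log p ≤ Y then 2 / ((p : ℝ) - 1) * Real.log p
        * ((L + 9 * Y) ^ 2 - 81 * Real.log p ^ 2
          + oddsSix p * (L + 9 * (Y - Real.log p)) ^ 2) else 0 := by
      intro p hp
      split_ifs with h
      · have hwp := (mem_sievePrimes.mp hp).1.1
        have h1 : (11 : ℝ) ≤ p := by exact_mod_cast (by omega : 11 ≤ p)
        have h2 := Real.log_natCast_nonneg p
        have h3 := oddsSix_nonneg hw hwp
        have h4 : 81 * Real.log p ^ 2 ≤ (L + 9 * Y) ^ 2 := by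
          rw [show 81 * Real.log p ^ 2 = (9 * Real.log p) ^ 2 by ring]
          exact pow_le_pow_left₀ (by linarith) (by linarith) 2
        exact mul_nonneg (mul_nonneg (div_nonneg (by norm_num) (by linarith)) h2)
          (add_nonneg (by linarith) (mul_nonneg h3 (sq_nonneg _)))
      · exact le_rfl
    refine le_trans (sum_le_sum fun p hp => ?_)
      (sum_le_sum_of_subset_of_nonneg (sdiff_subset (s := sievePrimes w R) (t := r))
        fun p hp _ => hnn p hp)
    have hins := setLog_insert (mem_sdiff.mp hp).2
    rw [cutoff, hins]
    have hiff : Real.log p + setLog r ≤ Real.log R ↔ Real.log p ≤ Y := by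
      rw [hY, hL]; constructor <;> intro h <;> linarith
    simp only [hiff]
    split_ifs with h
    · refine le_of_eq ?_
      rw [hY, ← hL]; ring
    · simp
  have h1 := mul_le_mul_of_nonneg_right hℓ (sq_nonneg (L + 9 * Y))
  have h2 : K₁ * (L + 9 * Y) ^ 2 ≤ K₁ * (100 * L ^ 2) := by
    refine mul_le_mul_of_nonneg_left ?_ hK₁
    rw [show 100 * L ^ 2 = (10 * L) ^ 2 by ring]
    exact pow_le_pow_left₀ (by linarith) (by linarith) 2
  rw [logPoly]
  nlinarith

lemma exists_sum_logCutoff_le (w : ℕ) {θ K₁ : ℝ} (hθ : 0 ≤ θ) (hK₁ : 0 ≤ K₁) :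
    ∃ K : ℝ, 0 ≤ K ∧ ∀ R : ℕ, 1 ≤ Real.log R → ∀ r ∈ sieveSupport w R,
    ∑ m ∈ (sievePrimes w R \ r).powerset, (∏ p ∈ m, 1 / (p : ℝ)) * logCutoff θ K₁ R (r ∪ m)
      ≤ smallDensity w * (θ * Real.log R ^ 3 * (Real.log R - setLog r)
        + (9 * θ + 1) * Real.log R ^ 2 * (Real.log R - setLog r) ^ 2
        + (27 * θ + 12) * Real.log R * (Real.log R - setLog r) ^ 3
        + 27 * (Real.log R - setLog r) ^ 4) + K * Real.log R ^ 3 := by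
  obtain ⟨K, hK, hharm⟩ := exists_sum_inv_le w
  refine ⟨K₁ + K * (K₁ + (100 * θ + 146)), by positivity, fun R hR r hr => ?_⟩
  obtain ⟨hrP, hrL⟩ := mem_sieveSupport.mp hr
  set L := Real.log R with hL
  set Y := L - setLog r with hY
  have hY0 : 0 ≤ Y := by linarith
  have hYL : Y ≤ L := by linarith [setLog_nonneg r]
  set Q := sievePrimes w R \ r with hQ
  have hmom := fun n => sum_mul_sub_pow_le Q.powerset (fun m : Finset ℕ => ∏ p ∈ m, 1 / (p : ℝ))
    setLog n (fun m _ => setLog_nonneg m) hY0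
    fun y hy _ => hharm R Q sdiff_subset y hy
  have e0 := hmom 0
  have e1 := hmom 1
  have e2 := hmom 2
  have e3 := hmom 3
  norm_num at e0 e1 e2 e3
  have hs : ∑ m ∈ Q.powerset, (∏ p ∈ m, 1 / (p : ℝ)) * logCutoff θ K₁ R (r ∪ m)
      = (θ * L ^ 3 + K₁ * L ^ 2) * ∑ m ∈ Q.powerset.filter (fun m => setLog m ≤ Y),
          (∏ p ∈ m, (p : ℝ))⁻¹
        + (18 * θ + 2) * L ^ 2 * ∑ m ∈ Q.powerset.filter (fun m => setLog m ≤ Y),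
          (∏ p ∈ m, (p : ℝ))⁻¹ * (Y - setLog m)
        + (81 * θ + 36) * L * ∑ m ∈ Q.powerset.filter (fun m => setLog m ≤ Y),
          (∏ p ∈ m, (p : ℝ))⁻¹ * (Y - setLog m) ^ 2
        + 108 * ∑ m ∈ Q.powerset.filter (fun m => setLog m ≤ Y),
          (∏ p ∈ m, (p : ℝ))⁻¹ * (Y - setLog m) ^ 3 := by
    simp only [mul_sum]
    rw [← sum_add_distrib, ← sum_add_distrib, ← sum_add_distrib, sum_filter]
    refine sum_congr rfl fun m hm => ?_
    have hdisj : Disjoint r m := disjoint_of_subset_right (mem_powerset.mp hm) disjoint_sdiff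
    have hiff : setLog r + setLog m ≤ Real.log R ↔ setLog m ≤ Y := by
      rw [hY, hL]; constructor <;> intro h <;> linarith
    rw [logCutoff, setLog_union hdisj]
    simp only [hiff, one_div, prod_inv_distrib]
    split_ifs
    · rw [logPoly, ← hL, hY]; ring
    · simp
  rw [hs]
  have hκ := (smallDensity_pos w).le
  have hκ1 := smallDensity_le_one w
  have hL0 : 0 ≤ L := by linarith
  have g0 := mul_le_mul_of_nonneg_left e0 (by positivity : 0 ≤ θ * L ^ 3 + K₁ * L ^ 2)
  have g1 := mul_le_mul_of_nonneg_left e1 (by positivity : 0 ≤ (18 * θ + 2) * L ^ 2)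
  have g2 := mul_le_mul_of_nonneg_left e2 (by positivity : 0 ≤ (81 * θ + 36) * L)
  have g3 := mul_le_mul_of_nonneg_left e3 (by norm_num : (0 : ℝ) ≤ 108)
  have hL23 : L ^ 2 ≤ L ^ 3 := by nlinarith [sq_nonneg L]
  have k0 : K₁ * K * L ^ 2 ≤ K₁ * K * L ^ 3 := mul_le_mul_of_nonneg_left hL23 (by positivity)
  have k1 : smallDensity w * (K₁ * (L ^ 2 * Y)) ≤ K₁ * L ^ 3 := by
    have : L ^ 2 * Y ≤ L ^ 3 := by
      rw [show L ^ 3 = L ^ 2 * L by ring]; exact mul_le_mul_of_nonneg_left hYL (by positivity)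
    calc _ ≤ 1 * (K₁ * (L ^ 2 * Y)) := mul_le_mul_of_nonneg_right hκ1 (by positivity)
      _ ≤ _ := by rw [one_mul]; exact mul_le_mul_of_nonneg_left this hK₁
  have k2 : K * ((18 * θ + 2) * (L ^ 2 * Y)) ≤ K * ((18 * θ + 2) * L ^ 3) := by
    refine mul_le_mul_of_nonneg_left (mul_le_mul_of_nonneg_left ?_ (by positivity)) hK
    rw [show L ^ 3 = L ^ 2 * L by ring]; exact mul_le_mul_of_nonneg_left hYL (by positivity)
  have k3 : K * ((81 * θ + 36) * (L * Y ^ 2)) ≤ K * ((81 * θ + 36) * L ^ 3) := by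
    refine mul_le_mul_of_nonneg_left (mul_le_mul_of_nonneg_left ?_ (by positivity)) hK
    rw [show L ^ 3 = L * L ^ 2 by ring]
    exact mul_le_mul_of_nonneg_left (pow_le_pow_left₀ hY0 hYL 2) hL0
  have k4 : K * Y ^ 3 ≤ K * L ^ 3 := mul_le_mul_of_nonneg_left (pow_le_pow_left₀ hY0 hYL 3) hK
  linarith

/-- The upper bound for the quadratic form with logarithmic main terms. -/
lemma exists_logForm_le {w : ℕ} (hw : 10 ≤ w) {θ K₁ : ℝ} (hθ : 0 ≤ θ) (hK₁ : 0 ≤ K₁) :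
    ∃ K : ℝ, 0 ≤ K ∧ ∀ (R : ℕ) (ℓ : ℝ), 1 ≤ Real.log R → ℓ ≤ θ * Real.log R + K₁ →
    logForm w R ℓ ≤ Real.exp (12 / w) * (smallDensity w
      * (θ * Real.log R ^ 3 * supportMoment w R 1
        + (9 * θ + 1) * Real.log R ^ 2 * supportMoment w R 2
        + (27 * θ + 12) * Real.log R * supportMoment w R 3 + 27 * supportMoment w R 4)
        + K * Real.log R ^ 3 * supportMoment w R 0) := by
  obtain ⟨K₂, hK₂, h₂⟩ := exists_logForm_le_sum hw (θ := θ) hK₁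
  obtain ⟨K₃, hK₃, h₃⟩ := exists_sum_logCutoff_le w hθ hK₂
  refine ⟨K₃, hK₃, fun R ℓ hR hℓ => (h₂ R ℓ hℓ).trans ?_⟩
  have hlt : ∀ p ∈ sievePrimes w R, w < p := fun p hp => (mem_sievePrimes.mp hp).1.1
  have hge : ∀ p ∈ sievePrimes w R, (11 : ℝ) ≤ p := fun p hp => by
    have := hlt p hp
    exact_mod_cast (by omega : 11 ≤ p)
  have hfive : ∀ p ∈ sievePrimes w R, 0 ≤ oddsFive p := fun p hp =>
    (oddsFive_pos (by omega) hp).le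
  have hsplit := sum_powerset_prod_mul_le (P := sievePrimes w R) (h := oddsSix)
    (a := fun p => oddsFive p + 1 / p) (b := fun p => oddsSix p / p) (G := logCutoff θ K₂ R)
    (fun p hp => by
      have h1 := hge p hp
      have h2 : (p : ℝ) - 1 ≠ 0 := by linarith
      have h3 : (p : ℝ) - 5 ≠ 0 := by linarith
      have h4 : (p : ℝ) ≠ 0 := by linarith
      simp only [oddsSix, oddsFive]
      field_simp
      ring)
    (fun p hp => add_nonneg (hfive p hp) (by positivity))
    (fun p hp => div_nonneg (oddsSix_nonneg hw (hlt p hp)) (Nat.cast_nonneg p))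
    (fun v _ => logCutoff_nonneg hθ hK₂ R v) fun v _ d hd => logCutoff_mono hθ hK₂ R hd
  refine hsplit.trans ?_
  have hinner : ∑ d ∈ (sievePrimes w R).powerset, (∏ p ∈ d, (oddsFive p + 1 / (p : ℝ)))
        * logCutoff θ K₂ R d
      = ∑ r ∈ sieveSupport w R, (∏ p ∈ r, oddsFive p) * ∑ m ∈ (sievePrimes w R \ r).powerset,
        (∏ p ∈ m, 1 / (p : ℝ)) * logCutoff θ K₂ R (r ∪ m) := by
    have h1 : ∀ d ∈ (sievePrimes w R).powerset, (∏ p ∈ d, (oddsFive p + 1 / (p : ℝ)))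
          * logCutoff θ K₂ R d
        = ∑ r ∈ d.powerset, (∏ p ∈ r, oddsFive p) * ((∏ p ∈ d \ r, 1 / (p : ℝ))
          * logCutoff θ K₂ R (r ∪ (d \ r))) := by
      intro d _
      rw [prod_add, sum_mul]
      refine sum_congr rfl fun r hr => ?_
      rw [union_sdiff_of_subset (mem_powerset.mp hr), mul_assoc]
    rw [sum_congr rfl h1, sum_powerset_sum_powerset_sdiff _ fun r m => (∏ p ∈ r, oddsFive p)
      * ((∏ p ∈ m, 1 / (p : ℝ)) * logCutoff θ K₂ R (r ∪ m)), sieveSupport, sum_filter]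
    refine sum_congr rfl fun r _ => ?_
    split_ifs with h
    · rw [mul_sum]
    · refine sum_eq_zero fun m _ => ?_
      rw [logCutoff, if_neg fun h' => h ((setLog_mono subset_union_left).trans h')]
      simp
  rw [hinner]
  have hnn : ∀ r ∈ sieveSupport w R, 0 ≤ ∏ p ∈ r, oddsFive p := fun r hr =>
    prod_oddsFive_nonneg (by omega) (mem_sieveSupport.mp hr).1
  refine mul_le_mul (prod_one_add_le_exp hw) ?_ (sum_nonneg fun r hr => mul_nonneg (hnn r hr)
    (sum_nonneg fun m _ => mul_nonneg (prod_nonneg fun p _ => by positivity)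
      (logCutoff_nonneg hθ hK₂ R _))) (Real.exp_pos _).le
  refine (sum_le_sum fun r hr => mul_le_mul_of_nonneg_left (h₃ R hR r hr) (hnn r hr)).trans
    (le_of_eq ?_)
  simp only [supportMoment, mul_sum, ← sum_add_distrib]
  exact sum_congr rfl fun r _ => by ring

lemma injOn_prod_primes {I : Finset (Finset ℕ)} (hI : ∀ u ∈ I, ∀ p ∈ u, p.Prime) :
    Set.InjOn (fun u : Finset ℕ => ∏ p ∈ u, p) I := by
  intro u hu v hv h
  rw [← primeFactors_prod_primes (hI u hu), ← primeFactors_prod_primes (hI v hv)]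
  exact congrArg Nat.primeFactors h

lemma sum_inv_prod_primes_le {I : Finset (Finset ℕ)} (hI : ∀ u ∈ I, ∀ p ∈ u, p.Prime) {N : ℕ}
    (hN : ∀ u ∈ I, ∏ p ∈ u, p ≤ N) :
    ∑ u ∈ I, 1 / ((∏ p ∈ u, p : ℕ) : ℝ) ≤ 1 + Real.log N := by
  rw [← sum_image (f := fun n : ℕ => 1 / (n : ℝ)) (injOn_prod_primes hI)]
  calc _ ≤ ∑ n ∈ Icc 1 N, 1 / (n : ℝ) := by
        refine sum_le_sum_of_subset_of_nonneg (fun n hn => ?_) fun _ _ _ => by positivity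
        obtain ⟨u, hu, rfl⟩ := mem_image.mp hn
        exact mem_Icc.mpr ⟨prod_pos fun p hp => (hI u hu p hp).pos, hN u hu⟩
    _ = (harmonic N : ℝ) := by
        rw [harmonic_eq_sum_Icc]
        push_cast
        simp
    _ ≤ _ := harmonic_le_one_add_log N

lemma card_prod_primes_le {I : Finset (Finset ℕ)} (hI : ∀ u ∈ I, ∀ p ∈ u, p.Prime) {N : ℕ}
    (hN : ∀ u ∈ I, ∏ p ∈ u, p ≤ N) : #I ≤ N := by
  rw [← card_image_of_injOn (injOn_prod_primes hI)]
  calc _ ≤ #(Icc 1 N) := card_le_card fun n hn => by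
        obtain ⟨u, hu, rfl⟩ := mem_image.mp hn
        exact mem_Icc.mpr ⟨prod_pos fun p hp => (hI u hu p hp).pos, hN u hu⟩
    _ = N := by simp

lemma cutoff_nonneg (R : ℕ) (v : Finset ℕ) : 0 ≤ cutoff R v := by
  rw [cutoff]
  split_ifs with h
  · linarith [Real.log_natCast_nonneg R]
  · exact le_rfl

lemma cutoff_le (R : ℕ) (v : Finset ℕ) : cutoff R v ≤ 10 * Real.log R := by
  have := Real.log_natCast_nonneg R
  rw [cutoff]
  split_ifs with h
  · linarith [setLog_nonneg v]
  · linarith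

lemma prime_of_subset_sievePrimes {w R : ℕ} {A : Finset ℕ} (hA : A ⊆ sievePrimes w R) :
    ∀ p ∈ A, p.Prime := fun _ hp => (mem_sievePrimes.mp (hA hp)).2

lemma sieveWeight_eq_zero {w R : ℕ} {A : Finset ℕ} (hR : Real.log R < setLog A) (h : ℕ → ℝ) :
    sieveWeight h (sievePrimes w R) (cutoff R) A = 0 := by
  rw [sieveWeight]
  refine mul_eq_zero_of_right _ (sum_eq_zero fun u _ => mul_eq_zero_of_right _ (if_neg fun h' => ?_))
  linarith [setLog_mono (subset_union_left (s₁ := A) (s₂ := u))]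

lemma log_pow_le {t n : ℕ} (ht : 0 < t) : Real.log ((t ^ n : ℕ) : ℝ) ≤ n * t := by
  rw [Nat.cast_pow, Real.log_pow]
  have : (0 : ℝ) < t := by exact_mod_cast ht
  exact mul_le_mul_of_nonneg_left (by linarith [Real.log_le_sub_one_of_pos this]) (Nat.cast_nonneg n)

/-- The sieve weights are small. -/
lemma exists_abs_sieveWeight_le {w e : ℕ} (hw : 12 ≤ w) (he : 0 < e) : ∃ D : ℝ, 0 ≤ D ∧
    ∀ t : ℕ, 0 < t → ∀ A ⊆ sievePrimes w (t ^ (100 * e)),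
    |sieveWeight oddsSix (sievePrimes w (t ^ (100 * e))) (cutoff (t ^ (100 * e))) A|
      ≤ D * (t : ℝ) ^ 4 := by
  obtain ⟨C₂, -, h₂⟩ := exists_pow_card_le 2 (100 * e) (by norm_num) (by positivity)
  obtain ⟨C₃, -, h₃⟩ := exists_pow_card_le 12 (100 * e) (by norm_num) (by positivity)
  obtain ⟨E, hE⟩ : ∃ E : ℝ, E = ((100 * e : ℕ) : ℝ) := ⟨_, rfl⟩
  have hE0 : 0 ≤ E := hE ▸ Nat.cast_nonneg _
  refine ⟨C₂ * (10 * E * (C₃ * (1 + E))), by positivity, fun t ht A hA => ?_⟩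
  have ht1 : (1 : ℝ) ≤ t := by exact_mod_cast ht
  set R := t ^ (100 * e) with hR
  have hR0 : 0 < R := by positivity
  have hlogR : Real.log R ≤ E * t := hE ▸ log_pow_le ht
  by_cases hAR : setLog A ≤ Real.log R
  swap
  · rw [sieveWeight_eq_zero (not_le.mp hAR), abs_zero]
    positivity
  have hAp := prime_of_subset_sievePrimes hA
  have hlt : ∀ p ∈ sievePrimes w R, w < p := fun p hp => (mem_sievePrimes.mp hp).1.1
  have hA2 : |∏ p ∈ A, -(1 + oddsSix p)| ≤ C₂ * t := by
    rw [abs_prod]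
    calc _ ≤ ∏ p ∈ A, (2 : ℝ) := by
          refine prod_le_prod (fun p _ => abs_nonneg _) fun p hp => ?_
          have hp' := hlt p (hA hp)
          have h0 := oddsSix_nonneg (by omega : 10 ≤ w) hp'
          have h1 : oddsSix p ≤ 1 := (oddsSix_le (by omega) hp').trans (by
            rw [div_le_one (by exact_mod_cast (by omega : 0 < p))]
            exact_mod_cast (by omega : 12 ≤ p))
          rw [abs_neg, abs_of_nonneg (by linarith)]
          linarith
      _ = ((2 ^ #A : ℕ) : ℝ) := by rw [prod_const]; push_cast; ring
      _ ≤ ((C₂ * t : ℕ) : ℝ) := by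
          exact_mod_cast h₂ t A (fun p hp => (hAp p hp).pos) ((setLog_le_log_iff hAp hR0).mp hAR)
      _ = _ := by push_cast; ring
  have hsum : |∑ u ∈ (sievePrimes w R \ A).powerset, (∏ p ∈ u, oddsSix p) * cutoff R (A ∪ u)|
      ≤ 10 * (E * t) * (C₃ * t * ((1 + E) * t)) := by
    have hnn : ∀ u ∈ (sievePrimes w R \ A).powerset, 0 ≤ ∏ p ∈ u, oddsSix p := fun u hu =>
      prod_nonneg fun p hp => oddsSix_nonneg (by omega)
        (hlt p (mem_sdiff.mp (mem_powerset.mp hu hp)).1)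
    rw [abs_of_nonneg (sum_nonneg fun u hu => mul_nonneg (hnn u hu) (cutoff_nonneg R _))]
    calc _ ≤ ∑ u ∈ sieveSupport w R, 10 * (E * t) * (C₃ * t * (1 / ((∏ p ∈ u, p : ℕ) : ℝ))) := by
          have hsub : ∑ u ∈ (sievePrimes w R \ A).powerset, (∏ p ∈ u, oddsSix p) * cutoff R (A ∪ u)
              = ∑ u ∈ (sievePrimes w R \ A).powerset.filter (fun u => setLog u ≤ Real.log R),
                (∏ p ∈ u, oddsSix p) * cutoff R (A ∪ u) := by
            refine (sum_filter_of_ne fun u _ hne => ?_).symm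
            by_contra hcon
            refine hne (mul_eq_zero_of_right _ (if_neg fun h => ?_))
            exact hcon ((setLog_mono subset_union_right).trans h)
          rw [hsub]
          refine le_trans (sum_le_sum fun u hu => ?_) (sum_le_sum_of_subset_of_nonneg
            (filter_subset_filter _ (powerset_mono.mpr sdiff_subset)) fun _ _ _ => by positivity)
          obtain ⟨hu1, hu2⟩ := mem_filter.mp hu
          have huP : u ⊆ sievePrimes w R := (mem_powerset.mp hu1).trans sdiff_subset
          have hup := prime_of_subset_sievePrimes huP
          rw [mul_comm]
          refine mul_le_mul ((cutoff_le R _).trans (by linarith)) ?_ (hnn u hu1) (by positivity)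
          calc ∏ p ∈ u, oddsSix p ≤ ∏ p ∈ u, (12 / (p : ℝ)) := prod_le_prod
                (fun p hp => oddsSix_nonneg (by omega) (hlt p (huP hp)))
                fun p hp => oddsSix_le (by omega) (hlt p (huP hp))
            _ = ((12 ^ #u : ℕ) : ℝ) * (1 / ((∏ p ∈ u, p : ℕ) : ℝ)) := by
                rw [prod_div_distrib, prod_const]; push_cast; ring
            _ ≤ _ := by
                refine mul_le_mul_of_nonneg_right ?_ (by positivity)
                exact_mod_cast h₃ t u (fun p hp => (hup p hp).pos)
                  ((setLog_le_log_iff hup hR0).mp hu2)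
      _ = 10 * (E * t) * (C₃ * t * ∑ u ∈ sieveSupport w R, 1 / ((∏ p ∈ u, p : ℕ) : ℝ)) := by
          simp only [mul_sum]
      _ ≤ _ := by
          refine mul_le_mul_of_nonneg_left (mul_le_mul_of_nonneg_left ?_ (by positivity))
            (by positivity)
          have hp : ∀ u ∈ sieveSupport w R, ∀ p ∈ u, p.Prime := fun u hu =>
            prime_of_subset_sievePrimes (mem_sieveSupport.mp hu).1
          refine (sum_inv_prod_primes_le hp (N := R) fun u hu =>
            (setLog_le_log_iff (hp u hu) hR0).mp (mem_sieveSupport.mp hu).2).trans ?_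
          linarith
  rw [sieveWeight, abs_mul]
  calc _ ≤ C₂ * t * (10 * (E * t) * (C₃ * t * ((1 + E) * t))) :=
        mul_le_mul hA2 hsum (abs_nonneg _) (by positivity)
    _ = _ := by ring

/-- A sum over pairs of sets whose summand depends only on the union. -/
lemma sum_sum_union_le {I J : Finset (Finset ℕ)} (hIJ : ∀ A ∈ I, ∀ B ∈ I, A ∪ B ∈ J)
    {g : Finset ℕ → ℝ} (hg : ∀ C ∈ J, 0 ≤ g C) :
    ∑ A ∈ I, ∑ B ∈ I, g (A ∪ B) ≤ ∑ C ∈ J, (4 : ℝ) ^ #C * g C := by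
  rw [← sum_product']
  rw [← sum_fiberwise_of_maps_to (g := fun x : Finset ℕ × Finset ℕ => x.1 ∪ x.2) (t := J)
    fun x hx => hIJ _ (mem_product.mp hx).1 _ (mem_product.mp hx).2]
  refine sum_le_sum fun C hC => ?_
  rw [sum_congr rfl fun x hx => by rw [(mem_filter.mp hx).2], sum_const, nsmul_eq_mul]
  refine mul_le_mul_of_nonneg_right ?_ (hg C hC)
  have h1 : #((I ×ˢ I).filter fun x => x.1 ∪ x.2 = C) ≤ #(C.powerset ×ˢ C.powerset) :=
    card_le_card fun x hx => by
      have hx' := (mem_filter.mp hx).2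
      rw [mem_product, mem_powerset, mem_powerset, ← hx']
      exact ⟨subset_union_left, subset_union_right⟩
  rw [card_product, card_powerset, ← mul_pow] at h1
  exact_mod_cast h1

/-- The sets of sieving primes with product at most `R ^ 2`. -/
def unionSupport (w R : ℕ) : Finset (Finset ℕ) :=
  (sievePrimes w R).powerset.filter fun C => ∏ p ∈ C, p ≤ R ^ 2

lemma mem_unionSupport {w R : ℕ} {C : Finset ℕ} :
    C ∈ unionSupport w R ↔ C ⊆ sievePrimes w R ∧ ∏ p ∈ C, p ≤ R ^ 2 := by
  rw [unionSupport, mem_filter, mem_powerset]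

lemma exists_abs_sum_sieveWeight_le {w e : ℕ} (hw : 12 ≤ w) (he : 0 < e) : ∃ D : ℝ, 0 ≤ D ∧
    ∀ t : ℕ, 0 < t → ∀ f : Finset ℕ → ℝ,
    |∑ A ∈ (sievePrimes w (t ^ (100 * e))).powerset, ∑ B ∈ (sievePrimes w (t ^ (100 * e))).powerset,
      sieveWeight oddsSix (sievePrimes w (t ^ (100 * e))) (cutoff (t ^ (100 * e))) A
      * sieveWeight oddsSix (sievePrimes w (t ^ (100 * e))) (cutoff (t ^ (100 * e))) B * f (A ∪ B)|
      ≤ D * (t : ℝ) ^ 8 * ∑ C ∈ unionSupport w (t ^ (100 * e)), (4 : ℝ) ^ #C * |f C| := by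
  obtain ⟨D, hD, h⟩ := exists_abs_sieveWeight_le hw he
  refine ⟨D ^ 2, by positivity, fun t ht f => ?_⟩
  set R := t ^ (100 * e) with hR
  have hR0 : 0 < R := by positivity
  set l := sieveWeight oddsSix (sievePrimes w R) (cutoff R) with hl
  have hres : ∑ A ∈ (sievePrimes w R).powerset, ∑ B ∈ (sievePrimes w R).powerset,
      l A * l B * f (A ∪ B)
      = ∑ A ∈ sieveSupport w R, ∑ B ∈ sieveSupport w R, l A * l B * f (A ∪ B) := by
    have hz : ∀ A ∈ (sievePrimes w R).powerset, l A ≠ 0 → setLog A ≤ Real.log R := by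
      intro A _ hne
      by_contra hcon
      exact hne (sieveWeight_eq_zero (not_le.mp hcon) _)
    rw [sieveSupport]
    refine Eq.trans (sum_congr rfl fun A hA => (sum_filter_of_ne fun B hB hne => hz B hB ?_).symm)
      (sum_filter_of_ne fun A hA hne => hz A hA ?_).symm
    · exact right_ne_zero_of_mul (left_ne_zero_of_mul hne)
    · intro h0
      exact hne (sum_eq_zero fun B _ => by rw [h0]; ring)
  rw [hres]
  calc _ ≤ ∑ A ∈ sieveSupport w R, ∑ B ∈ sieveSupport w R, (D * (t : ℝ) ^ 4) ^ 2 * |f (A ∪ B)| := by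
        refine (abs_sum_le_sum_abs _ _).trans (sum_le_sum fun A hA => ?_)
        refine (abs_sum_le_sum_abs _ _).trans (sum_le_sum fun B hB => ?_)
        rw [abs_mul, abs_mul, sq]
        exact mul_le_mul_of_nonneg_right (mul_le_mul (h t ht A (mem_sieveSupport.mp hA).1)
          (h t ht B (mem_sieveSupport.mp hB).1) (abs_nonneg _) (by positivity)) (abs_nonneg _)
    _ = (D * (t : ℝ) ^ 4) ^ 2 * ∑ A ∈ sieveSupport w R, ∑ B ∈ sieveSupport w R, |f (A ∪ B)| := by
        simp only [mul_sum]
    _ ≤ (D * (t : ℝ) ^ 4) ^ 2 * ∑ C ∈ unionSupport w R, (4 : ℝ) ^ #C * |f C| := by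
        refine mul_le_mul_of_nonneg_left (sum_sum_union_le (g := fun C => |f C|)
          (fun A hA B hB => ?_) fun _ _ => abs_nonneg _) (by positivity)
        rw [mem_sieveSupport] at hA hB
        refine mem_unionSupport.mpr ⟨union_subset hA.1 hB.1, ?_⟩
        have hAR := (setLog_le_log_iff (prime_of_subset_sievePrimes hA.1) hR0).mp hA.2
        have hBR := (setLog_le_log_iff (prime_of_subset_sievePrimes hB.1) hR0).mp hB.2
        rw [← union_sdiff_self_eq_union, prod_union disjoint_sdiff, sq]
        refine Nat.mul_le_mul hAR (le_trans ?_ hBR)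
        exact Nat.le_of_dvd (prod_pos fun p hp => (prime_of_subset_sievePrimes hB.1 p hp).pos)
          (prod_dvd_prod_of_subset _ _ _ sdiff_subset)
    _ = _ := by ring

/-- The sum of the sieve weights over the sets of primes satisfying `H`. -/
noncomputable def sieveSum (w R : ℕ) (H : ℕ → Prop) : ℝ :=
  open scoped Classical in
  ∑ A ∈ (sievePrimes w R).powerset.filter (fun A => ∀ p ∈ A, H p),
    sieveWeight oddsSix (sievePrimes w R) (cutoff R) A

open scoped Classical in
lemma sieveSum_sq (w R : ℕ) (H : ℕ → Prop) (c : ℝ) :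
    c * sieveSum w R H ^ 2 = ∑ A ∈ (sievePrimes w R).powerset, ∑ B ∈ (sievePrimes w R).powerset,
      sieveWeight oddsSix (sievePrimes w R) (cutoff R) A
      * sieveWeight oddsSix (sievePrimes w R) (cutoff R) B
      * if ∀ p ∈ A ∪ B, H p then c else 0 := by
  rw [sieveSum, sq, sum_filter, sum_mul_sum, mul_sum]
  refine sum_congr rfl fun A _ => ?_
  rw [mul_sum]
  refine sum_congr rfl fun B _ => ?_
  have h : (∀ p ∈ A ∪ B, H p) ↔ (∀ p ∈ A, H p) ∧ ∀ p ∈ B, H p := by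
    simp only [mem_union, or_imp, forall_and]
  by_cases h1 : ∀ p ∈ A, H p
  · by_cases h2 : ∀ p ∈ B, H p
    · rw [if_pos h1, if_pos h2, if_pos (h.mpr ⟨h1, h2⟩)]; ring
    · rw [if_neg h2, if_neg fun h' => h2 (h.mp h').2]; ring
  · rw [if_neg h1, if_neg fun h' => h1 (h.mp h').1]; ring

lemma abs_card_mod_eq_sub_le {Q : ℕ} (hQ : 0 < Q) (N s : ℕ) (hs : s < Q) :
    |(#((range N).filter fun m => m % Q = s) : ℝ) - N / Q| ≤ 1 := by
  have h1 : #((range N).filter fun m => m % Q = s) = N / Q + if s % Q < N % Q then 1 else 0 := by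
    rw [← Nat.count_modEq_card N hQ s, Nat.count_eq_card_filter_range]
    congr 1
    ext m
    simp only [mem_filter, Nat.ModEq, Nat.mod_eq_of_lt hs]
  have hQ' : (0 : ℝ) < Q := by exact_mod_cast hQ
  have h2 : (N : ℝ) / Q = (N / Q : ℕ) + (N % Q : ℕ) / (Q : ℝ) := by
    have h3 : ((Q * (N / Q) + N % Q : ℕ) : ℝ) = N := by rw [Nat.div_add_mod]
    rw [← h3]
    push_cast
    field_simp
  have h3 : ((N % Q : ℕ) : ℝ) / Q ≤ 1 := by
    rw [div_le_one hQ']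
    exact_mod_cast (Nat.mod_lt N hQ).le
  have h4 : 0 ≤ ((N % Q : ℕ) : ℝ) / Q := by positivity
  rw [h1, h2, abs_le]
  push_cast
  split_ifs <;> constructor <;> linarith

lemma abs_card_mod_mem_sub_le {Q : ℕ} (hQ : 0 < Q) (N : ℕ) {S : Finset ℕ} (hS : S ⊆ range Q) :
    |(#((range N).filter fun m => m % Q ∈ S) : ℝ) - N * (#S / Q)| ≤ #S := by
  have h1 : (#((range N).filter fun m => m % Q ∈ S) : ℝ)
      = ∑ s ∈ S, (#((range N).filter fun m => m % Q = s) : ℝ) := by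
    rw [← Nat.cast_sum, ← card_biUnion]
    · congr 2
      ext m
      simp only [mem_filter, mem_biUnion]
      exact ⟨fun h => ⟨_, h.2, h.1, rfl⟩, fun ⟨s, hs, h, hm⟩ => ⟨h, hm ▸ hs⟩⟩
    · intro s _ s' _ hne
      refine disjoint_left.mpr fun m hm hm' => hne ?_
      rw [← (mem_filter.mp hm).2, ← (mem_filter.mp hm').2]
  have h2 : (N : ℝ) * (#S / Q) = ∑ s ∈ S, (N : ℝ) / Q := by
    rw [sum_const, nsmul_eq_mul]; ring
  rw [h1, h2, ← sum_sub_distrib]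
  refine (abs_sum_le_sum_abs _ _).trans ?_
  calc _ ≤ ∑ s ∈ S, (1 : ℝ) := sum_le_sum fun s hs =>
        abs_card_mod_eq_sub_le hQ N s (mem_range.mp (hS hs))
    _ = _ := by simp

/-- The residues `q i` are units and distinct modulo all primes exceeding `w`. -/
def IsAdmissible (w : ℕ) (q : Fin 5 → ℕ) : Prop :=
  ∀ p, p.Prime → w < p → (∀ i, (q i : ZMod p) ≠ 0) ∧ Function.Injective fun i => (q i : ZMod p)

/-- The prime `p` divides one of the values at `m` of the linear forms. -/
def Hits (q : Fin 5 → ℕ) (m p : ℕ) : Prop := ∃ i, p ∣ q i * m + 1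

/-- The residue classes modulo `p` on which one of the linear forms vanishes. -/
def hitResidues (q : Fin 5 → ℕ) (p : ℕ) : Finset (ZMod p) := univ.image fun i => -(q i : ZMod p)⁻¹

lemma IsAdmissible.hits_iff {w : ℕ} {q : Fin 5 → ℕ} (hq : IsAdmissible w q) {p : ℕ}
    (hp : p.Prime) (hwp : w < p) (m : ℕ) : Hits q m p ↔ (m : ZMod p) ∈ hitResidues q p := by
  have := Fact.mk hp
  simp only [Hits, hitResidues, mem_image, mem_univ, true_and]
  refine exists_congr fun i => ?_
  have h0 := (hq p hp hwp).1 i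
  rw [← CharP.cast_eq_zero_iff (ZMod p) p]
  push_cast
  rw [add_eq_zero_iff_eq_neg, ← eq_inv_mul_iff_mul_eq₀ h0, mul_neg, mul_one, eq_comm]

lemma IsAdmissible.card_hitResidues {w : ℕ} {q : Fin 5 → ℕ} (hq : IsAdmissible w q) {p : ℕ}
    (hp : p.Prime) (hwp : w < p) : #(hitResidues q p) = 5 := by
  have := Fact.mk hp
  rw [hitResidues, card_image_of_injective, card_univ, Fintype.card_fin]
  intro i j h
  exact (hq p hp hwp).2 (inv_injective (neg_injective h))

open scoped Classical in
lemma IsAdmissible.abs_sum_hits_sub_le {w R : ℕ} {q : Fin 5 → ℕ} (hq : IsAdmissible w q)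
    {C : Finset ℕ} (hC : C ⊆ sievePrimes w R) (N : ℕ) :
    |∑ m ∈ range N, (if ∀ p ∈ C, Hits q m p then (1 : ℝ) else 0) - N * ∏ p ∈ C, 5 / (p : ℝ)|
      ≤ 5 ^ #C := by
  have hCp := prime_of_subset_sievePrimes hC
  have hCw : ∀ p ∈ C, w < p := fun p hp => (mem_sievePrimes.mp (hC hp)).1.1
  have hcard : #(rootSet 1 (hitResidues q) C) = 5 ^ #C := by
    rw [card_rootSet one_pos _ _ fun p hp => ⟨hCp p hp, Nat.coprime_one_left p⟩,
      prod_congr rfl fun p hp => hq.card_hitResidues (hCp p hp) (hCw p hp), prod_const]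
  have h := abs_card_mod_mem_sub_le (Q := 1 * ∏ p ∈ C, p)
    (by rw [one_mul]; exact prod_pos fun p hp => (hCp p hp).pos) N
    (S := rootSet 1 (hitResidues q) C) (filter_subset _ _)
  rw [hcard] at h
  convert h using 3
  · rw [sum_boole]
    congr 2
    ext m
    simp only [mem_filter]
    refine and_congr_right fun _ => ?_
    rw [mod_mem_rootSet one_pos _ hCp, and_iff_right (Subsingleton.elim _ _)]
    exact forall₂_congr fun p hp => hq.hits_iff (hCp p hp) (hCw p hp) m
  · rw [prod_div_distrib, prod_const]
    push_cast
    rw [one_mul]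
  · push_cast; rfl

lemma exists_abs_sum_sieveSum_sq_sub_le {w e : ℕ} (hw : 12 ≤ w) (he : 0 < e) {q : Fin 5 → ℕ}
    (hq : IsAdmissible w q) : ∃ D : ℝ, 0 ≤ D ∧ ∀ t N : ℕ, 0 < t →
    |∑ m ∈ range N, sieveSum w (t ^ (100 * e)) (Hits q m) ^ 2
      - N * sieveForm oddsSix (fun p => 5 / (p : ℝ)) (sievePrimes w (t ^ (100 * e)))
        (cutoff (t ^ (100 * e)))| ≤ D * (t : ℝ) ^ (200 * e + 9) := by
  classical
  obtain ⟨D, hD, h⟩ := exists_abs_sum_sieveWeight_le hw he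
  obtain ⟨C₀, -, hC₀⟩ := exists_pow_card_le 20 (200 * e) (by norm_num) (by positivity)
  refine ⟨D * C₀, by positivity, fun t N ht => ?_⟩
  set R := t ^ (100 * e) with hR
  have hR2 : R ^ 2 = t ^ (200 * e) := by rw [hR, ← pow_mul]; congr 1; ring
  have h1 : ∑ m ∈ range N, sieveSum w R (Hits q m) ^ 2
      - N * sieveForm oddsSix (fun p => 5 / (p : ℝ)) (sievePrimes w R) (cutoff R)
      = ∑ A ∈ (sievePrimes w R).powerset, ∑ B ∈ (sievePrimes w R).powerset,
        sieveWeight oddsSix (sievePrimes w R) (cutoff R) A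
        * sieveWeight oddsSix (sievePrimes w R) (cutoff R) B
        * (∑ m ∈ range N, (if ∀ p ∈ A ∪ B, Hits q m p then (1 : ℝ) else 0)
          - N * ∏ p ∈ A ∪ B, 5 / (p : ℝ)) := by
    have h2 : ∀ m, sieveSum w R (Hits q m) ^ 2 = _ := fun m =>
      (one_mul _).symm.trans (sieveSum_sq w R (Hits q m) 1)
    simp only [h2]
    rw [sum_comm, sieveForm, mul_sum, ← sum_sub_distrib]
    refine sum_congr rfl fun A _ => ?_
    rw [sum_comm, mul_sum, ← sum_sub_distrib]
    refine sum_congr rfl fun B _ => ?_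
    rw [← mul_sum]
    ring
  rw [h1]
  refine (h t ht fun C => ∑ m ∈ range N, (if ∀ p ∈ C, Hits q m p then (1 : ℝ) else 0)
          - N * ∏ p ∈ C, 5 / (p : ℝ)).trans ?_
  have hbound : ∀ C ∈ unionSupport w R, (4 : ℝ) ^ #C
      * |∑ m ∈ range N, (if ∀ p ∈ C, Hits q m p then (1 : ℝ) else 0) - N * ∏ p ∈ C, 5 / (p : ℝ)|
      ≤ C₀ * t := by
    intro C hC
    obtain ⟨hCP, hCR⟩ := mem_unionSupport.mp hC
    calc _ ≤ (4 : ℝ) ^ #C * 5 ^ #C :=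
          mul_le_mul_of_nonneg_left (hq.abs_sum_hits_sub_le hCP N) (by positivity)
      _ = ((20 ^ #C : ℕ) : ℝ) := by rw [← mul_pow]; push_cast; norm_num
      _ ≤ ((C₀ * t : ℕ) : ℝ) := by
          exact_mod_cast hC₀ t C (fun p hp => (prime_of_subset_sievePrimes hCP p hp).pos)
            (hCR.trans hR2.le)
      _ = _ := by push_cast; ring
  have hcard : (#(unionSupport w R) : ℝ) ≤ (t : ℝ) ^ (200 * e) := by
    have := card_prod_primes_le (I := unionSupport w R)
      (fun u hu => prime_of_subset_sievePrimes (mem_unionSupport.mp hu).1)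
      fun u hu => (mem_unionSupport.mp hu).2
    rw [hR2] at this
    exact_mod_cast this
  calc _ ≤ D * (t : ℝ) ^ 8 * ∑ C ∈ unionSupport w R, (C₀ * t : ℝ) :=
        mul_le_mul_of_nonneg_left (sum_le_sum hbound) (by positivity)
    _ = D * (t : ℝ) ^ 8 * (C₀ * t) * #(unionSupport w R) := by
        rw [sum_const, nsmul_eq_mul]; ring
    _ ≤ D * (t : ℝ) ^ 8 * (C₀ * t) * (t : ℝ) ^ (200 * e) :=
        mul_le_mul_of_nonneg_left hcard (by positivity)
    _ = _ := by rw [pow_add]; ring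

/-- The residues modulo `p` of `q j * m + 1` for which `p` divides another linear form. -/
def otherResidues (q : Fin 5 → ℕ) (j : Fin 5) (p : ℕ) : Finset (ZMod p) :=
  (univ.erase j).image fun i => 1 - (q j : ZMod p) * (q i : ZMod p)⁻¹

lemma IsAdmissible.hits_iff_or {w : ℕ} {q : Fin 5 → ℕ} (hq : IsAdmissible w q) {p : ℕ}
    (hp : p.Prime) (hwp : w < p) (j : Fin 5) (m : ℕ) :
    Hits q m p ↔ p ∣ q j * m + 1 ∨ ((q j * m + 1 : ℕ) : ZMod p) ∈ otherResidues q j p := by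
  have := Fact.mk hp
  have hj := (hq p hp hwp).1 j
  have key : ∀ i, p ∣ q i * m + 1 ↔
      1 - (q j : ZMod p) * (q i : ZMod p)⁻¹ = ((q j * m + 1 : ℕ) : ZMod p) := by
    intro i
    have hi := (hq p hp hwp).1 i
    rw [← CharP.cast_eq_zero_iff (ZMod p) p]
    push_cast
    rw [sub_eq_iff_eq_add, add_right_comm, eq_comm (a := (1 : ZMod p)), add_eq_right, ← mul_add,
      mul_eq_zero, or_iff_right hj,
      ← mul_right_inj' hi (b := (m : ZMod p) + (q i : ZMod p)⁻¹), mul_add, mul_inv_cancel₀ hi, mul_zero]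
  simp only [Hits, otherResidues, mem_image, mem_erase, mem_univ, and_true]
  constructor
  · rintro ⟨i, hi⟩
    by_cases hij : i = j
    · exact Or.inl (hij ▸ hi)
    · exact Or.inr ⟨i, hij, (key i).mp hi⟩
  · rintro (h | ⟨i, -, hi⟩)
    · exact ⟨j, h⟩
    · exact ⟨i, (key i).mpr hi⟩

lemma IsAdmissible.zero_notMem_otherResidues {w : ℕ} {q : Fin 5 → ℕ} (hq : IsAdmissible w q)
    {p : ℕ} (hp : p.Prime) (hwp : w < p) (j : Fin 5) : 0 ∉ otherResidues q j p := by
  have := Fact.mk hp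
  simp only [otherResidues, mem_image, mem_erase, mem_univ, and_true, not_exists, not_and]
  intro i hij h
  have hi := (hq p hp hwp).1 i
  rw [sub_eq_zero, ← div_eq_mul_inv, eq_comm, div_eq_one_iff_eq hi] at h
  exact hij ((hq p hp hwp).2 h.symm)

lemma IsAdmissible.card_otherResidues {w : ℕ} {q : Fin 5 → ℕ} (hq : IsAdmissible w q)
    {p : ℕ} (hp : p.Prime) (hwp : w < p) (j : Fin 5) : #(otherResidues q j p) = 4 := by
  have := Fact.mk hp
  rw [otherResidues, card_image_of_injective, card_erase_of_mem (mem_univ j), card_univ,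
    Fintype.card_fin]
  intro i k h
  exact (hq p hp hwp).2 (inv_injective (mul_left_cancel₀ ((hq p hp hwp).1 j) (sub_right_injective h)))

open scoped Classical in
lemma IsAdmissible.hitSum_eq {w R : ℕ} {q : Fin 5 → ℕ} (hq : IsAdmissible w q) (j : Fin 5)
    (hj : 0 < q j) {C : Finset ℕ} (hC : C ⊆ sievePrimes w R) (M : ℕ) :
    hitSum (q j) (otherResidues q j) C ((q j * M + 1 : ℕ) : ℝ)
      = ∑ m ∈ range (M + 1), if ∀ p ∈ C, Hits q m p then (#(q j * m + 1).divisors : ℝ) else 0 := by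
  rw [hitSum, Nat.floor_natCast, ← sum_filter]
  have hcond : ∀ m, (∀ p ∈ C, Hits q m p) ↔ ∀ p ∈ C, p ∣ q j * m + 1
      ∨ ((q j * m + 1 : ℕ) : ZMod p) ∈ otherResidues q j p := fun m =>
    forall₂_congr fun p hp => hq.hits_iff_or (mem_sievePrimes.mp (hC hp)).2
      (mem_sievePrimes.mp (hC hp)).1.1 j m
  refine (sum_bij (fun m _ => q j * m + 1) ?_ ?_ ?_ ?_).symm
  · intro m hm
    simp only [mem_filter, mem_range, mem_Icc] at hm ⊢
    refine ⟨⟨by omega, ?_⟩, ?_, (hcond m).mp hm.2⟩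
    · exact Nat.succ_le_succ (Nat.mul_le_mul_left _ (by omega))
    · push_cast
      simp
  · intro m _ m' _ h
    exact Nat.eq_of_mul_eq_mul_left hj (Nat.succ_injective h)
  · intro n hn
    simp only [mem_filter, mem_Icc] at hn
    obtain ⟨⟨hn1, hnX⟩, hnq, hn3⟩ := hn
    obtain ⟨k, rfl⟩ : ∃ k, n = k + 1 := ⟨n - 1, by omega⟩
    have hdvd : q j ∣ k := by
      rw [← CharP.cast_eq_zero_iff (ZMod (q j)) (q j)]
      push_cast at hnq
      simpa using hnq
    obtain ⟨m, rfl⟩ := hdvd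
    refine ⟨m, ?_, rfl⟩
    simp only [mem_filter, mem_range]
    refine ⟨?_, (hcond m).mpr hn3⟩
    have := Nat.le_of_mul_le_mul_left (Nat.le_of_succ_le_succ hnX) hj
    omega
  · intro m _
    rfl

lemma density6_mul_one_add {w p : ℕ} (hw : 10 ≤ w) (hp : w < p) :
    density6 p * (1 + oddsSix p) = oddsSix p := by
  have h1 : (11 : ℝ) ≤ p := by exact_mod_cast (by omega : 11 ≤ p)
  have h2 : (p : ℝ) - 1 ≠ 0 := by linarith
  have h3 : (p : ℝ) - 5 ≠ 0 := by linarith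
  have h4 : (p : ℝ) ≠ 0 := by linarith
  rw [density6, oddsSix]
  field_simp
  ring

lemma logShift_mul_oddsSix {w p : ℕ} (hw : 10 ≤ w) (hp : w < p) :
    logShift p * oddsSix p = 2 / ((p : ℝ) - 1) * Real.log p := by
  have h1 : (11 : ℝ) ≤ p := by exact_mod_cast (by omega : 11 ≤ p)
  have h2 : (p : ℝ) - 1 ≠ 0 := by linarith
  have h3 : (p : ℝ) - 5 ≠ 0 := by linarith
  have h4 : 6 * (p : ℝ) - 5 ≠ 0 := by linarith
  rw [logShift, oddsSix]
  generalize 6 * (p : ℝ) - 5 = a at *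
  field_simp
  ring

lemma sum_sieveWeight_mul_hitMain {w : ℕ} (hw : 10 ≤ w) (R q : ℕ) (X : ℝ) :
    ∑ A ∈ (sievePrimes w R).powerset, ∑ B ∈ (sievePrimes w R).powerset,
      sieveWeight oddsSix (sievePrimes w R) (cutoff R) A
      * sieveWeight oddsSix (sievePrimes w R) (cutoff R) B * hitMain q (A ∪ B) X
      = X * (q.totient / (q : ℝ) ^ 2)
        * logForm w R (Real.log X + 2 * Real.eulerMascheroniConstant - 1 + 2 * logSum q) := by
  set P := sievePrimes w R with hP
  set l := sieveWeight oddsSix P (cutoff R) with hl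
  set ℓ := Real.log X + 2 * Real.eulerMascheroniConstant - 1 + 2 * logSum q with hℓ
  have hlt : ∀ p ∈ P, w < p := fun p hp => (mem_sievePrimes.mp hp).1.1
  have hk : ∀ p ∈ P, density6 p * (1 + oddsSix p) = oddsSix p := fun p hp =>
    density6_mul_one_add hw (hlt p hp)
  have h1 : ∑ A ∈ P.powerset, ∑ B ∈ P.powerset, l A * l B * hitMain q (A ∪ B) X
      = X * (q.totient / (q : ℝ) ^ 2) * (ℓ * sieveForm oddsSix density6 P (cutoff R)
        - ∑ p ∈ P, logShift p * ∑ A ∈ P.powerset, ∑ B ∈ P.powerset,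
          if p ∈ A ∪ B then l A * l B * ∏ p ∈ A ∪ B, density6 p else 0) := by
    have h2 : ∑ p ∈ P, logShift p * ∑ A ∈ P.powerset, ∑ B ∈ P.powerset,
          (if p ∈ A ∪ B then l A * l B * ∏ p ∈ A ∪ B, density6 p else 0)
        = ∑ A ∈ P.powerset, ∑ B ∈ P.powerset,
          (l A * l B * ∏ p ∈ A ∪ B, density6 p) * ∑ p ∈ A ∪ B, logShift p := by
      simp only [mul_sum]
      rw [sum_comm]
      refine sum_congr rfl fun A hA => ?_
      rw [sum_comm]
      refine sum_congr rfl fun B hB => ?_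
      have hAB : A ∪ B ⊆ P := union_subset (mem_powerset.mp hA) (mem_powerset.mp hB)
      rw [← sum_subset hAB fun p _ hp => by rw [if_neg hp, mul_zero]]
      refine sum_congr rfl fun p hp => ?_
      rw [if_pos hp, mul_comm]
    rw [h2, sieveForm, mul_sum, ← sum_sub_distrib, mul_sum]
    refine sum_congr rfl fun A _ => ?_
    rw [mul_sum, ← sum_sub_distrib, mul_sum]
    refine sum_congr rfl fun B _ => ?_
    rw [hitMain]
    ring
  rw [h1, sieveForm_diag hk]
  congr 1
  have h3 : ∑ p ∈ P, logShift p * ∑ A ∈ P.powerset, ∑ B ∈ P.powerset,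
        (if p ∈ A ∪ B then l A * l B * ∏ p ∈ A ∪ B, density6 p else 0)
      = -∑ r ∈ P.powerset, ∑ p ∈ P \ r, (∏ p ∈ r, oddsSix p) * (2 / ((p : ℝ) - 1) * Real.log p
        * (2 * cutoff R r * cutoff R (insert p r)
          - (1 - oddsSix p) * cutoff R (insert p r) ^ 2)) := by
    rw [sum_congr rfl fun p hp => by rw [sieveForm_sub_erase hk (cutoff R) hp]]
    simp only [mul_neg, sum_neg_distrib, mul_sum]
    rw [neg_inj]
    refine (sum_comm' (t' := P.powerset) (s' := fun r => P \ r) ?_).trans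
      (sum_congr rfl fun r _ => sum_congr rfl fun p hp => ?_)
    · intro p r
      simp only [mem_powerset, mem_sdiff, subset_erase]
      tauto
    · rw [← logShift_mul_oddsSix hw (hlt p (mem_sdiff.mp hp).1)]
      ring
  rw [h3, logForm, sub_neg_eq_add, mul_sum, ← sum_add_distrib]
  refine sum_congr rfl fun r _ => ?_
  rw [mul_add, mul_sum]
  ring

lemma exists_sum_hitSum_error_le {w e : ℕ} (he : 200 ≤ e) {q : Fin 5 → ℕ}
    (hq : IsAdmissible w q) (j : Fin 5) (hj : 0 < q j) : ∃ D : ℝ, 0 ≤ D ∧ ∀ t : ℕ, 0 < t →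
    ∀ X : ℝ, X = (q j * t ^ (351 * e) + 1 : ℕ) →
    ∑ C ∈ unionSupport w (t ^ (100 * e)), (4 : ℝ) ^ #C
      * |hitSum (q j) (otherResidues q j) C X - hitMain (q j) C X|
      ≤ D * (t : ℝ) ^ (351 * e) / (t : ℝ) ^ 78 := by
  have he0 : 0 < e := by omega
  obtain ⟨D, -, h⟩ := exists_abs_hitSum_sub_le hj he0 (q j + 1)
  obtain ⟨C₀, -, hC₀⟩ := exists_pow_card_le 28 (200 * e) (by norm_num) (by positivity)
  obtain ⟨E, hE⟩ : ∃ E : ℝ, E = ((200 * e : ℕ) : ℝ) := ⟨_, rfl⟩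
  have hE0 : 0 ≤ E := hE ▸ Nat.cast_nonneg _
  refine ⟨D * C₀ * ((q j + 1) * (1 + E) + 1), by positivity, fun t ht X hX => ?_⟩
  have ht1 : (1 : ℝ) ≤ t := by exact_mod_cast ht
  have ht0 : (0 : ℝ) < t := by linarith
  set R := t ^ (100 * e) with hR
  have hR2 : R ^ 2 = t ^ (200 * e) := by rw [hR, ← pow_mul]; congr 1; ring
  have hX0 : 0 < X := by rw [hX]; positivity
  have hXle : X ≤ (q j + 1) * (t : ℝ) ^ (351 * e) := by
    have : (1 : ℝ) ≤ (t : ℝ) ^ (351 * e) := one_le_pow₀ ht1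
    rw [hX]; push_cast; linarith
  have hCp : ∀ C ∈ unionSupport w R, ∀ p ∈ C, p.Prime := fun C hC =>
    prime_of_subset_sievePrimes (mem_unionSupport.mp hC).1
  have hbound : ∀ C ∈ unionSupport w R, (4 : ℝ) ^ #C
      * |hitSum (q j) (otherResidues q j) C X - hitMain (q j) C X|
      ≤ D * (C₀ * t) * (X * (t : ℝ) ^ 2 / (t : ℝ) ^ 100 * (1 / ((∏ p ∈ C, p : ℕ) : ℝ))
        + (t : ℝ) ^ (150 * e + 110)) := by
    intro C hC
    obtain ⟨hCP, hCR⟩ := mem_unionSupport.mp hC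
    have hCw : ∀ p ∈ C, w < p := fun p hp => (mem_sievePrimes.mp (hCP hp)).1.1
    have h1 := h t C (otherResidues q j) X ht (fun p hp => ⟨hCp C hC p hp, by
        rw [Nat.coprime_comm, (hCp C hC p hp).coprime_iff_not_dvd,
          ← CharP.cast_eq_zero_iff (ZMod p) p]
        exact (hq p (hCp C hC p hp) (hCw p hp)).1 j⟩) (hCR.trans hR2.le)
      (fun p hp => ⟨hq.zero_notMem_otherResidues (hCp C hC p hp) (hCw p hp) j,
        hq.card_otherResidues (hCp C hC p hp) (hCw p hp) j⟩) hX0 (by push_cast; exact hXle)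
    calc _ ≤ (4 : ℝ) ^ #C * _ := mul_le_mul_of_nonneg_left h1 (by positivity)
      _ = D * ((28 ^ #C : ℕ) : ℝ) * (X * (t : ℝ) ^ 2 / (t : ℝ) ^ 100
          * (1 / ((∏ p ∈ C, p : ℕ) : ℝ)) + (t : ℝ) ^ (150 * e + 110)) := by
          rw [show (28 : ℕ) = 4 * 7 by norm_num, mul_pow]
          push_cast
          rw [div_mul_div_comm, mul_one]
          ring
      _ ≤ _ := by
          refine mul_le_mul_of_nonneg_right (mul_le_mul_of_nonneg_left ?_ (by positivity))
            (by positivity)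
          exact_mod_cast hC₀ t C (fun p hp => (hCp C hC p hp).pos) (hCR.trans hR2.le)
  have hcard : (#(unionSupport w R) : ℝ) ≤ (t : ℝ) ^ (200 * e) := by
    have := card_prod_primes_le hCp fun u hu => (mem_unionSupport.mp hu).2
    rw [hR2] at this
    exact_mod_cast this
  have hinv : ∑ C ∈ unionSupport w R, 1 / ((∏ p ∈ C, p : ℕ) : ℝ) ≤ (1 + E) * t := by
    refine (sum_inv_prod_primes_le hCp fun u hu => (mem_unionSupport.mp hu).2).trans ?_
    rw [hR2]
    have := log_pow_le (n := 200 * e) ht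
    rw [← hE] at this
    linarith
  have hexp1 : (t : ℝ) ^ 84 ≤ (t : ℝ) ^ 100 := pow_le_pow_right₀ ht1 (by norm_num)
  calc _ ≤ ∑ C ∈ unionSupport w R, D * (C₀ * t) * (X * (t : ℝ) ^ 2 / (t : ℝ) ^ 100
          * (1 / ((∏ p ∈ C, p : ℕ) : ℝ)) + (t : ℝ) ^ (150 * e + 110)) := sum_le_sum hbound
    _ = D * (C₀ * t) * (X * (t : ℝ) ^ 2 / (t : ℝ) ^ 100
          * ∑ C ∈ unionSupport w R, 1 / ((∏ p ∈ C, p : ℕ) : ℝ)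
          + #(unionSupport w R) * (t : ℝ) ^ (150 * e + 110)) := by
        rw [← mul_sum, sum_add_distrib, ← mul_sum, sum_const, nsmul_eq_mul]
    _ ≤ D * (C₀ * t) * ((q j + 1) * (t : ℝ) ^ (351 * e) * (t : ℝ) ^ 2 / (t : ℝ) ^ 100
          * ((1 + E) * t) + (t : ℝ) ^ (200 * e) * (t : ℝ) ^ (150 * e + 110)) := by
        refine mul_le_mul_of_nonneg_left (add_le_add (mul_le_mul ?_ hinv (by positivity)
          (by positivity)) (mul_le_mul_of_nonneg_right hcard (by positivity))) (by positivity)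
        exact div_le_div_of_nonneg_right (mul_le_mul_of_nonneg_right hXle (by positivity))
          (by positivity)
    _ ≤ _ := by
        rw [le_div_iff₀ (by positivity)]
        have h1 : (t : ℝ) * ((t : ℝ) ^ 2 / (t : ℝ) ^ 100 * t) * (t : ℝ) ^ 78 ≤ 1 := by
          have : (t : ℝ) * ((t : ℝ) ^ 2 / (t : ℝ) ^ 100 * t) * (t : ℝ) ^ 78
              = (t : ℝ) ^ 82 / (t : ℝ) ^ 100 := by ring
          rw [this, div_le_one (by positivity)]
          exact pow_le_pow_right₀ ht1 (by norm_num)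
        have h2 : (t : ℝ) * ((t : ℝ) ^ (200 * e) * (t : ℝ) ^ (150 * e + 110)) * (t : ℝ) ^ 78
            ≤ (t : ℝ) ^ (351 * e) := by
          rw [← pow_add, ← pow_succ', ← pow_add]
          exact pow_le_pow_right₀ ht1 (by omega)
        have h3 : D * C₀ * ((q j + 1) * (1 + E)) * (t : ℝ) ^ (351 * e)
            * ((t : ℝ) * ((t : ℝ) ^ 2 / (t : ℝ) ^ 100 * t) * (t : ℝ) ^ 78)
            ≤ D * C₀ * ((q j + 1) * (1 + E)) * (t : ℝ) ^ (351 * e) * 1 :=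
          mul_le_mul_of_nonneg_left h1 (by positivity)
        have h4 := mul_le_mul_of_nonneg_left h2 (by positivity : (0 : ℝ) ≤ D * C₀)
        calc _ = D * C₀ * ((q j + 1) * (1 + E)) * (t : ℝ) ^ (351 * e)
            * ((t : ℝ) * ((t : ℝ) ^ 2 / (t : ℝ) ^ 100 * t) * (t : ℝ) ^ 78)
            + D * C₀ * ((t : ℝ) * ((t : ℝ) ^ (200 * e) * (t : ℝ) ^ (150 * e + 110))
              * (t : ℝ) ^ 78) := by ring
          _ ≤ _ := add_le_add h3 h4
          _ = _ := by ring

lemma exists_abs_sum_divisors_mul_sieveSum_sq_sub_le {w e : ℕ} (hw : 12 ≤ w) (he : 200 ≤ e)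
    {q : Fin 5 → ℕ} (hq : IsAdmissible w q) (j : Fin 5) (hj : 0 < q j) :
    ∃ D : ℝ, 0 ≤ D ∧ ∀ t : ℕ, 0 < t → ∀ X : ℝ, X = (q j * t ^ (351 * e) + 1 : ℕ) →
    |∑ m ∈ range (t ^ (351 * e) + 1), (#(q j * m + 1).divisors : ℝ)
        * sieveSum w (t ^ (100 * e)) (Hits q m) ^ 2
      - X * ((q j).totient / (q j : ℝ) ^ 2) * logForm w (t ^ (100 * e))
        (Real.log X + 2 * Real.eulerMascheroniConstant - 1 + 2 * logSum (q j))|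
      ≤ D * (t : ℝ) ^ (351 * e) / (t : ℝ) ^ 70 := by
  classical
  have he0 : 0 < e := by omega
  obtain ⟨D₁, hD₁, h₁⟩ := exists_abs_sum_sieveWeight_le hw he0
  obtain ⟨D₂, hD₂, h₂⟩ := exists_sum_hitSum_error_le he hq j hj
  refine ⟨D₁ * D₂, by positivity, fun t ht X hX => ?_⟩
  have ht0 : (0 : ℝ) < t := by exact_mod_cast ht
  set R := t ^ (100 * e) with hR
  set M := t ^ (351 * e) with hM
  rw [← sum_sieveWeight_mul_hitMain (by omega : 10 ≤ w)]
  simp only [sieveSum_sq]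
  have h3 : ∑ m ∈ range (M + 1), ∑ A ∈ (sievePrimes w R).powerset,
      ∑ B ∈ (sievePrimes w R).powerset, sieveWeight oddsSix (sievePrimes w R) (cutoff R) A
      * sieveWeight oddsSix (sievePrimes w R) (cutoff R) B
      * (if ∀ p ∈ A ∪ B, Hits q m p then (#(q j * m + 1).divisors : ℝ) else 0)
      - ∑ A ∈ (sievePrimes w R).powerset, ∑ B ∈ (sievePrimes w R).powerset,
        sieveWeight oddsSix (sievePrimes w R) (cutoff R) A
        * sieveWeight oddsSix (sievePrimes w R) (cutoff R) B * hitMain (q j) (A ∪ B) X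
      = ∑ A ∈ (sievePrimes w R).powerset, ∑ B ∈ (sievePrimes w R).powerset,
        sieveWeight oddsSix (sievePrimes w R) (cutoff R) A
        * sieveWeight oddsSix (sievePrimes w R) (cutoff R) B
        * (hitSum (q j) (otherResidues q j) (A ∪ B) X - hitMain (q j) (A ∪ B) X) := by
    rw [sum_comm, ← sum_sub_distrib]
    refine sum_congr rfl fun A hA => ?_
    rw [sum_comm, ← sum_sub_distrib]
    refine sum_congr rfl fun B hB => ?_
    rw [hX, hq.hitSum_eq j hj (union_subset (mem_powerset.mp hA) (mem_powerset.mp hB)) M,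
      ← mul_sum]
    ring
  rw [h3]
  calc _ ≤ D₁ * (t : ℝ) ^ 8 * _ :=
        h₁ t ht fun C => hitSum (q j) (otherResidues q j) C X - hitMain (q j) C X
    _ ≤ D₁ * (t : ℝ) ^ 8 * (D₂ * (t : ℝ) ^ (351 * e) / (t : ℝ) ^ 78) :=
        mul_le_mul_of_nonneg_left (h₂ t ht X hX) (by positivity)
    _ = _ := by
        rw [show (t : ℝ) ^ 78 = (t : ℝ) ^ 8 * (t : ℝ) ^ 70 by rw [← pow_add]]
        field_simp

theorem exp_twelve_div_le {w : ℕ} (hw : 4000 ≤ w) : Real.exp (12 / w) ≤ 1.004 := by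
  have hw' : (4000 : ℝ) ≤ w := by exact_mod_cast hw
  have h1 : 12 / (w : ℝ) ≤ 0.003 := by
    rw [div_le_iff₀ (by linarith)]; linarith
  have h2 : Real.exp (12 / (w : ℝ)) ≤ Real.exp 0.003 := Real.exp_le_exp.2 h1
  have h3 := Real.add_one_le_exp (-0.003 : ℝ)
  have h4 : Real.exp 0.003 * Real.exp (-0.003) = 1 := by
    rw [← Real.exp_add]; norm_num
  nlinarith [Real.exp_pos (0.003 : ℝ)]

/-- The sieve form exceeds the corresponding upper bound for the divisor sums. -/
theorem exists_sieveForm_gap {w : ℕ} (hw : 4000 ≤ w) {K₁ : ℝ} (hK₁ : 0 ≤ K₁) :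
    ∃ L₀ : ℝ, ∀ R : ℕ, L₀ ≤ Real.log R → ∃ B, 0 ≤ B ∧
      (∀ ℓ ≤ 351 / 100 * Real.log R + K₁, logForm w R ℓ ≤ B) ∧
      5 * smallDensity w * B + 1 ≤
        58 * sieveForm oddsSix (fun p => 5 / (p : ℝ)) (sievePrimes w R) (cutoff R) := by
  obtain ⟨K, hK, hmom⟩ := exists_abs_supportMoment_succ_le (w := w) (by lia)
  obtain ⟨K₂, hK₂, hlog⟩ := exists_logForm_le (w := w) (by lia)
    (by norm_num : (0 : ℝ) ≤ 351 / 100) hK₁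
  have hκ := smallDensity_pos w
  set κ := smallDensity w with hκdef
  refine ⟨max 1 ((200 * (κ ^ 2 * (1200 * K) + κ * (10 * K₂)) + 200) / κ ^ 2), fun R hR => ?_⟩
  obtain ⟨hL, hL'⟩ := max_le_iff.1 hR
  have hR0 : 0 < R := by
    rcases Nat.eq_zero_or_pos R with rfl | h
    · norm_num at hL
    · exact h
  have hform := le_sieveForm_five (w := w) (R := R) (by lia) hR0
  have h0 := hmom R 0
  have h1 := hmom R 1
  have h2 := hmom R 2
  have h3 := hmom R 3
  have hm0 : 1 ≤ supportMoment w R 0 := one_le_supportMoment_zero (by lia)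
  have hm1 : 0 ≤ supportMoment w R 1 := supportMoment_nonneg (by lia) 1
  have hm2 : 0 ≤ supportMoment w R 2 := supportMoment_nonneg (by lia) 2
  have hm3 : 0 ≤ supportMoment w R 3 := supportMoment_nonneg (by lia) 3
  have hm4 : 0 ≤ supportMoment w R 4 := supportMoment_nonneg (by lia) 4
  have hexpand : ∑ r ∈ sieveSupport w R, (∏ p ∈ r, oddsFive p) *
      (Real.log R * (Real.log R - setLog r) + 9 / 2 * (Real.log R - setLog r) ^ 2) ^ 2 =
      Real.log R ^ 2 * supportMoment w R 2 + 9 * Real.log R * supportMoment w R 3 +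
        81 / 4 * supportMoment w R 4 := by
    simp only [supportMoment, mul_sum, ← sum_add_distrib]
    refine sum_congr rfl fun r _ => ?_
    ring
  rw [hexpand] at hform
  have hlogR := hlog R
  norm_num only at h0 h1 h2 h3
  generalize supportMoment w R 0 = m₀ at *
  generalize supportMoment w R 1 = m₁ at *
  generalize supportMoment w R 2 = m₂ at *
  generalize supportMoment w R 3 = m₃ at *
  generalize supportMoment w R 4 = m₄ at *
  generalize sieveForm oddsSix (fun p => 5 / (p : ℝ)) (sievePrimes w R) (cutoff R) = S at *
  generalize Real.log R = L at *
  have hE := exp_twelve_div_le hw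
  have hE0 := Real.exp_pos (12 / (w : ℝ))
  generalize Real.exp (12 / (w : ℝ)) = E at *
  have hL0 : 0 < L := by linarith
  have hexp0 : 0 ≤ κ * (351 / 100 * L ^ 3 * m₁ + (9 * (351 / 100) + 1) * L ^ 2 * m₂ +
      (27 * (351 / 100) + 12) * L * m₃ + 27 * m₄) + K₂ * L ^ 3 * m₀ := by positivity
  refine ⟨_, by positivity, fun ℓ hℓ => hlogR ℓ hL hℓ, ?_⟩
  have scale : ∀ {x y : ℝ} (k : ℕ), |x| ≤ y → |L ^ k * x| ≤ L ^ k * y := fun {x y} k h => by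
    rw [abs_mul, abs_of_pos (pow_pos hL0 k)]
    exact mul_le_mul_of_nonneg_left h (pow_pos hL0 k).le
  obtain ⟨a0, b0⟩ := abs_le.1 (scale 3 h0)
  obtain ⟨a1, b1⟩ := abs_le.1 (scale 2 h1)
  obtain ⟨a2, b2⟩ := abs_le.1 (scale 1 h2)
  obtain ⟨a3, b3⟩ := abs_le.1 (scale 0 h3)
  have hgap : 5.02 * (351 / 100 * L ^ 3 * m₁ + (9 * (351 / 100) + 1) * L ^ 2 * m₂ +
      (27 * (351 / 100) + 12) * L * m₃ + 27 * m₄) + 1 / 100 * (L ^ 4 * m₀) ≤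
      58 * (L ^ 2 * m₂ + 9 * L * m₃ + 81 / 4 * m₄) + 1200 * (K * L ^ 3 * m₀) := by
    ring_nf at a0 b0 a1 b1 a2 b2 a3 b3 ⊢
    have hKL : 0 ≤ K * L ^ 3 * m₀ := by positivity
    linarith
  set Q := 351 / 100 * L ^ 3 * m₁ + (9 * (351 / 100) + 1) * L ^ 2 * m₂ +
    (27 * (351 / 100) + 12) * L * m₃ + 27 * m₄
  have hmain : 5 * κ * (E * (κ * Q + K₂ * L ^ 3 * m₀)) ≤
      5.02 * (κ * (κ * Q + K₂ * L ^ 3 * m₀)) := by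
    have := mul_le_mul_of_nonneg_right hE (mul_nonneg hκ.le hexp0)
    linarith
  have hgap' := mul_le_mul_of_nonneg_left hgap (sq_nonneg κ)
  rw [div_le_iff₀ (by positivity)] at hL'
  have hLm : 1 ≤ L ^ 3 * m₀ := by
    have := one_le_pow₀ hL (n := 3)
    nlinarith
  have hbig := mul_le_mul_of_nonneg_left hL' (zero_le_one.trans hLm)
  have hKK : 0 ≤ κ ^ 2 * K * (L ^ 3 * m₀) := by positivity
  have hKK' : 0 ≤ κ * K₂ * (L ^ 3 * m₀) := by positivity
  ring_nf at hmain hgap' hbig hform hKK hKK' hLm ⊢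
  linarith

theorem exists_abs_sieveSum_le {w e : ℕ} (hw : 12 ≤ w) (he : 0 < e) :
    ∃ D : ℝ, 0 ≤ D ∧ ∀ t : ℕ, 0 < t → ∀ H : ℕ → Prop,
      |sieveSum w (t ^ (100 * e)) H| ≤ D * (t : ℝ) ^ (100 * e + 4) := by
  classical
  obtain ⟨D, hD, hDt⟩ := exists_abs_sieveWeight_le hw he
  refine ⟨D, hD, fun t ht H => ?_⟩
  set R := t ^ (100 * e)
  have hR : 0 < R := pow_pos ht _
  set J := (sievePrimes w R).powerset.filter fun A => ∏ p ∈ A, p ≤ R with hJ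
  have hJP : ∀ A ∈ J, A ⊆ sievePrimes w R := fun A hA => mem_powerset.1 (mem_filter.1 hA).1
  have hcard : #J ≤ R := card_prod_primes_le
    (fun A hA => prime_of_subset_sievePrimes (hJP A hA)) fun A hA => (mem_filter.1 hA).2
  have hzero : ∀ A ∈ (sievePrimes w R).powerset, A ∉ J →
      |sieveWeight oddsSix (sievePrimes w R) (cutoff R) A| = 0 := fun A hA hAJ => by
    rw [abs_eq_zero]
    apply sieveWeight_eq_zero
    have hlt : R < ∏ p ∈ A, p := by
      by_contra! h
      exact hAJ (mem_filter.2 ⟨hA, h⟩)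
    have hne : ∀ p ∈ A, (p : ℝ) ≠ 0 := fun p hp => by
      exact_mod_cast (prime_of_subset_sievePrimes (mem_powerset.1 hA) p hp).ne_zero
    rw [setLog, ← Real.log_prod hne]
    exact Real.log_lt_log (by exact_mod_cast hR) (by rw [← Nat.cast_prod]; exact_mod_cast hlt)
  calc |sieveSum w R H| ≤ ∑ A ∈ (sievePrimes w R).powerset,
        |sieveWeight oddsSix (sievePrimes w R) (cutoff R) A| :=
        (abs_sum_le_sum_abs _ _).trans
          (sum_le_sum_of_subset_of_nonneg (filter_subset _ _) fun _ _ _ => abs_nonneg _)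
    _ = ∑ A ∈ J, |sieveWeight oddsSix (sievePrimes w R) (cutoff R) A| :=
        (sum_subset (filter_subset _ _) hzero).symm
    _ ≤ ∑ _A ∈ J, D * (t : ℝ) ^ 4 := sum_le_sum fun A hA => hDt t ht A (hJP A hA)
    _ = #J * (D * (t : ℝ) ^ 4) := by rw [sum_const, nsmul_eq_mul]
    _ ≤ (R : ℝ) * (D * (t : ℝ) ^ 4) := by gcongr
    _ = D * (t : ℝ) ^ (100 * e + 4) := by
        simp only [R]; push_cast; ring

theorem main_term_le {q M φ κ F B : ℝ} (hq : 1 ≤ q) (hM : 0 ≤ M) (hφ : φ / q = κ) (hκ : 0 ≤ κ)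
    (hB : 0 ≤ B) (hF : F ≤ B) : (q * M + 1) * (φ / q ^ 2) * F ≤ (M + 1) * (κ * B) := by
  have hfac : (q * M + 1) * (φ / q ^ 2) = (q * M + 1) / q * κ := by
    rw [← hφ]; field_simp
  have hfac' : (q * M + 1) / q ≤ M + 1 := by
    rw [div_le_iff₀ (by linarith)]; nlinarith
  calc _ = (q * M + 1) / q * κ * F := by rw [hfac]
    _ ≤ (q * M + 1) / q * κ * B := mul_le_mul_of_nonneg_left hF (by positivity)
    _ = (q * M + 1) / q * (κ * B) := by ring
    _ ≤ _ := mul_le_mul_of_nonneg_right hfac' (by positivity)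

theorem log_mul_add_one_le {q M : ℝ} (hq : 1 ≤ q) (hM : 1 ≤ M) :
    Real.log (q * M + 1) ≤ Real.log (q + 1) + Real.log M := by
  rw [← Real.log_mul (by positivity) (by positivity)]
  exact Real.log_le_log (by positivity) (by nlinarith)

theorem exists_sum_card_divisors_lt {w : ℕ} (hw : 4000 ≤ w) {q : Fin 5 → ℕ}
    (hq : IsAdmissible w q) (hpos : ∀ j, 0 < q j)
    (htot : ∀ j, ((q j).totient : ℝ) / q j = smallDensity w) (σ : Fin 5 → Fin 5) (n₀ : ℕ) :
    ∃ m > n₀, ∑ i, #(q (σ i) * m + 1).divisors < 58 := by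
  by_contra! hcon
  obtain ⟨e, he⟩ : ∃ e : ℕ, 200 ≤ e := ⟨200, le_rfl⟩
  have he0 : 0 < e := by lia
  have hκ := smallDensity_pos w
  set κ := smallDensity w
  set K₁ : ℝ := ∑ j, |Real.log (q j + 1) + 2 * Real.eulerMascheroniConstant - 1 +
    2 * logSum (q j)| with hK₁
  obtain ⟨L₀, hgap⟩ := exists_sieveForm_gap hw (K₁ := K₁) (sum_nonneg fun _ _ => abs_nonneg _)
  obtain ⟨D₁, hD₁, hsup⟩ := exists_abs_sieveSum_le (w := w) (by lia) he0
  obtain ⟨D₂, hD₂, hsq⟩ := exists_abs_sum_sieveSum_sq_sub_le (w := w) (by lia) he0 hq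
  choose D hD hdiv using fun j => exists_abs_sum_divisors_mul_sieveSum_sq_sub_le
    (w := w) (by lia) he hq j (hpos j)
  set C : ℝ := ∑ i, D (σ i) + 58 * D₂ + 58 * ((n₀ + 1) * D₁ ^ 2) with hC
  obtain ⟨t, ht⟩ := exists_nat_gt (max (max 1 C) (Real.exp L₀))
  obtain ⟨ht', htL⟩ := max_lt_iff.1 ht
  obtain ⟨ht1, htC⟩ := max_lt_iff.1 ht'
  have ht0 : 0 < t := by
    have : (0 : ℝ) < t := by linarith
    exact_mod_cast this
  have htR : (0 : ℝ) < t := by linarith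
  have hlogt : 0 ≤ Real.log t := Real.log_nonneg ht1.le
  set M := t ^ (351 * e) with hM
  set R := t ^ (100 * e) with hR
  have hlogR : Real.log R = 100 * e * Real.log t := by
    rw [hR]; push_cast; rw [Real.log_pow]; push_cast; ring
  have hlogM : Real.log M = 351 / 100 * Real.log R := by
    rw [hlogR, hM]; push_cast; rw [Real.log_pow]; push_cast; ring
  have hL₀ : L₀ ≤ Real.log R := by
    have h1 : L₀ ≤ Real.log t := (Real.le_log_iff_exp_le htR).2 htL.le
    have h2 : (1 : ℝ) ≤ 100 * e := by
      have : (200 : ℝ) ≤ e := by exact_mod_cast he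
      linarith
    rw [hlogR]
    nlinarith
  obtain ⟨B, hB, hlogForm, hgapR⟩ := hgap R hL₀
  set S := sieveForm oddsSix (fun p => 5 / (p : ℝ)) (sievePrimes w R) (cutoff R)
  have hM1 : 1 ≤ M := Nat.one_le_pow _ _ ht0
  have hM1' : (1 : ℝ) ≤ M := by exact_mod_cast hM1
  have hupper : ∀ j, ∑ m ∈ range (M + 1), (#(q j * m + 1).divisors : ℝ) *
      sieveSum w R (Hits q m) ^ 2 ≤ (M + 1) * (κ * B) + D j * (t : ℝ) ^ (351 * e) / (t : ℝ) ^ 70 := by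
    intro j
    have h := (abs_le.1 (hdiv j t ht0 _ rfl)).2
    rw [← hM, ← hR] at h
    have hqj : (1 : ℝ) ≤ q j := by exact_mod_cast hpos j
    have hX : ((q j * M + 1 : ℕ) : ℝ) = q j * M + 1 := by push_cast; rfl
    rw [hX] at h
    have hlogX := log_mul_add_one_le hqj hM1'
    have hK : Real.log (q j + 1) + 2 * Real.eulerMascheroniConstant - 1 + 2 * logSum (q j) ≤ K₁ :=
      (le_abs_self _).trans (single_le_sum (f := fun j => |Real.log (q j + 1) +
        2 * Real.eulerMascheroniConstant - 1 + 2 * logSum (q j)|)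
        (fun _ _ => abs_nonneg _) (mem_univ j))
    have hℓ := hlogForm (Real.log (q j * M + 1) + 2 * Real.eulerMascheroniConstant - 1 +
      2 * logSum (q j)) (by linarith)
    have h1 := main_term_le hqj (zero_le_one.trans hM1') (htot j) hκ.le hB hℓ
    linarith
  have hlower := (abs_le.1 (hsq t (M + 1) ht0)).1
  rw [← hR] at hlower
  push_cast at hlower
  have hpoint : ∀ m ∈ range (M + 1), 58 * sieveSum w R (Hits q m) ^ 2 ≤
      ∑ i, (#(q (σ i) * m + 1).divisors : ℝ) * sieveSum w R (Hits q m) ^ 2 +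
        if m ≤ n₀ then 58 * (D₁ * (t : ℝ) ^ (100 * e + 4)) ^ 2 else 0 := by
    intro m _
    rw [← sum_mul]
    split_ifs with h
    · have h1 := sq_le_sq' (abs_le.1 (hsup t ht0 (Hits q m))).1
        (abs_le.1 (hsup t ht0 (Hits q m))).2
      have h2 : (0 : ℝ) ≤ (∑ i, (#(q (σ i) * m + 1).divisors : ℝ)) *
        sieveSum w R (Hits q m) ^ 2 :=
        mul_nonneg (sum_nonneg fun _ _ => Nat.cast_nonneg _) (sq_nonneg _)
      linarith
    · have h1 : (58 : ℝ) ≤ ∑ i, (#(q (σ i) * m + 1).divisors : ℝ) := by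
        exact_mod_cast hcon m (not_le.1 h)
      have := mul_le_mul_of_nonneg_right h1 (sq_nonneg (sieveSum w R (Hits q m)))
      linarith
  have hsum := sum_le_sum hpoint
  rw [← mul_sum, sum_add_distrib, sum_comm, ← sum_filter, sum_const, nsmul_eq_mul] at hsum
  have hcard : ((#{m ∈ range (M + 1) | m ≤ n₀} : ℕ) : ℝ) ≤ n₀ + 1 := by
    have : #{m ∈ range (M + 1) | m ≤ n₀} ≤ #(range (n₀ + 1)) :=
      card_le_card fun m hm => by
        rw [mem_range]; have := (mem_filter.1 hm).2; lia
    rw [card_range] at this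
    exact_mod_cast this
  have hsmall := mul_le_mul_of_nonneg_right hcard
    (by positivity : 0 ≤ 58 * (D₁ * (t : ℝ) ^ (100 * e + 4)) ^ 2)
  have hT := sum_le_sum fun i (_ : i ∈ (univ : Finset (Fin 5))) => hupper (σ i)
  rw [sum_add_distrib, sum_const, card_univ, Fintype.card_fin, nsmul_eq_mul, ← sum_div,
    ← sum_mul] at hT
  set Y : ℝ := (t : ℝ) ^ (351 * e) / (t : ℝ) ^ 70 with hY
  have hYpow : Y = (t : ℝ) ^ (351 * e - 70) := by
    rw [hY, pow_sub₀ _ htR.ne' (by lia), div_eq_mul_inv]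
  have hp1 : (t : ℝ) ^ (200 * e + 9) ≤ Y := by
    rw [hYpow]; exact pow_le_pow_right₀ ht1.le (by lia)
  have hp2 : ((t : ℝ) ^ (100 * e + 4)) ^ 2 ≤ Y := by
    rw [hYpow, ← pow_mul]; exact pow_le_pow_right₀ ht1.le (by lia)
  have hCY : C * Y < M := by
    have hMY : (M : ℝ) = (t : ℝ) ^ 70 * Y := by
      rw [hY, hM]; push_cast; field_simp
    have hYpos : 0 < Y := by positivity
    rw [hMY]
    have : (t : ℝ) ≤ (t : ℝ) ^ 70 := le_self_pow₀ ht1.le (by norm_num)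
    exact mul_lt_mul_of_pos_right (by linarith) hYpos
  have hD₂Y := mul_le_mul_of_nonneg_left hp1 hD₂
  have hD₁Y := mul_le_mul_of_nonneg_left hp2
    (by positivity : 0 ≤ 58 * (((n₀ : ℝ) + 1) * D₁ ^ 2))
  have hgapM := mul_le_mul_of_nonneg_left hgapR (by linarith : (0 : ℝ) ≤ M + 1)
  have hCY' : C * Y = (∑ i, D (σ i)) * Y + 58 * D₂ * Y + 58 * ((n₀ + 1) * D₁ ^ 2) * Y := by
    rw [hC]; ring
  rw [mul_div_assoc, ← hY] at hT
  rw [mul_pow] at hsum hsmall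
  push_cast at hT
  linarith

theorem two_pow_card_primeFactors_le_card_divisors {n : ℕ} (hn : n ≠ 0) :
    2 ^ #n.primeFactors ≤ #n.divisors := by
  rw [Nat.card_divisors hn]
  calc 2 ^ #n.primeFactors = ∏ _p ∈ n.primeFactors, 2 := by rw [prod_const]
    _ ≤ ∏ p ∈ n.primeFactors, (n.factorization p + 1) := prod_le_prod' fun p hp => by
        have := (Nat.prime_of_mem_primeFactors hp).factorization_pos_of_dvd hn
          (Nat.dvd_of_mem_primeFactors hp)
        lia

theorem isAdmissible_mul_factorial {w : ℕ} {c : Fin 5 → ℕ} (hinj : Function.Injective c)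
    (hpos : ∀ i, 0 < c i) (hle : ∀ i, c i ≤ w) : IsAdmissible w fun i => c i * w.factorial := by
  intro p hp hwp
  have := Fact.mk hp
  have hW : ((w.factorial : ℕ) : ZMod p) ≠ 0 := by
    rw [Ne, ZMod.natCast_eq_zero_iff, hp.dvd_factorial]
    lia
  refine ⟨fun i => ?_, fun i j hij => ?_⟩
  · rw [Nat.cast_mul]
    refine mul_ne_zero ?_ hW
    rw [Ne, ZMod.natCast_eq_zero_iff]
    exact fun h => absurd (Nat.le_of_dvd (hpos i) h) (by have := hle i; lia)
  · simp only [Nat.cast_mul] at hij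
    have h := mul_right_cancel₀ hW hij
    rw [ZMod.natCast_eq_natCast_iff', Nat.mod_eq_of_lt ((hle i).trans_lt hwp),
      Nat.mod_eq_of_lt ((hle j).trans_lt hwp)] at h
    exact hinj h

theorem totient_mul_factorial_div {w c : ℕ} (hpos : 0 < c) (hle : c ≤ w) :
    ((c * w.factorial).totient : ℝ) / (c * w.factorial : ℕ) = smallDensity w := by
  have hW := w.factorial_ne_zero
  have hsub : c.primeFactors ⊆ w.factorial.primeFactors :=
    Nat.primeFactors_mono (Nat.dvd_factorial hpos hle) hW
  rw [totient_div_eq_prod (mul_ne_zero hpos.ne' hW), Nat.primeFactors_mul hpos.ne' hW,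
    union_eq_right.2 hsub, primeFactors_factorial, smallDensity]

/-- Every family of five positive integers factors through one with distinct values. -/
theorem exists_injective_reparametrization (c : Fin 5 → ℕ) (hc : ∀ i, 0 < c i) :
    ∃ (c' : Fin 5 → ℕ) (σ : Fin 5 → Fin 5), Function.Injective c' ∧ (∀ i, 0 < c' i) ∧
      ∀ i, c i = c' (σ i) := by
  let d : Fin 5 → ℕ+ := fun i => ⟨c i, hc i⟩
  obtain ⟨s, hs, hs5⟩ := Infinite.exists_superset_card_eq (univ.image d) 5
    (card_image_le.trans (by simp))
  let f := s.equivFinOfCardEq hs5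
  have hmem : ∀ i, d i ∈ s := fun i => hs (mem_image_of_mem d (mem_univ i))
  refine ⟨fun i => (f.symm i : ℕ+), fun i => f ⟨_, hmem i⟩, fun i j h => ?_,
    fun i => (f.symm i : ℕ+).pos, fun i => by simp [d]⟩
  exact f.symm.injective (Subtype.ext (PNat.coe_injective h))

end TwoPowOmega

/-- For any positive integers `c 0, …, c 4`, there are infinitely many positive
integers `n` such that `∑ i, 2 ^ ω(c i * n + 1) ≤ 57`. -/
theorem infinitely_many_sum_two_pow_omega_le_57 (c : Fin 5 → ℕ) (hc : ∀ i, 0 < c i) :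
    {n : ℕ | 0 < n ∧ ∑ i, 2 ^ (c i * n + 1).primeFactors.card ≤ 57}.Infinite := by
  refine Set.infinite_of_forall_exists_gt fun n₀ => ?_
  obtain ⟨c', σ, hinj, hpos, hcσ⟩ := TwoPowOmega.exists_injective_reparametrization c hc
  set w := 4000 + ∑ i, c' i with hw
  have hle : ∀ i, c' i ≤ w := fun i =>
    (Finset.single_le_sum (fun _ _ => Nat.zero_le _) (Finset.mem_univ i)).trans (Nat.le_add_left _ _)
  have hW := w.factorial_pos
  obtain ⟨m, hm, hlt⟩ := TwoPowOmega.exists_sum_card_divisors_lt (by lia)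
    (TwoPowOmega.isAdmissible_mul_factorial hinj hpos hle) (fun j => Nat.mul_pos (hpos j) hW)
    (fun j => TwoPowOmega.totient_mul_factorial_div (hpos j) (hle j)) σ n₀
  have hm' : m ≤ w.factorial * m := Nat.le_mul_of_pos_left m hW
  refine ⟨w.factorial * m, ⟨by lia, ?_⟩, by lia⟩
  refine Nat.lt_succ_iff.1 (lt_of_le_of_lt (Finset.sum_le_sum fun i _ => ?_) hlt)
  rw [hcσ, ← mul_assoc]
  exact TwoPowOmega.two_pow_card_primeFactors_le_card_divisors (Nat.succ_ne_zero _)
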